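/- Suppose z_T is sub-exponential (there exists σ_z > 0 with E exp(σ_z|z_T|) < ∞), that X_T ∈ [0,1]^{d_in×T} almost surely, and that f_0 belongs to the Hölder class H^β_{d_in·T, 1}([0,1]^{d_in×T}, U) for some β > 0 and U ≥ 1. Fix an even positive integer d_s and positive integers I, J, and let the class F^{(T)}_{d_in,1,d,d_s,L,U} have width d = 76(⌊β⌋+1)² 3^{d_in T} d_in^{⌊β⌋+2} T^{⌊β⌋+1} J ⌈log₂(8J)⌉ + d_s and depth L = 42(⌊β⌋+1)² I ⌈log₂(8I)⌉ + 6 d_in T. Then there exist constants c > 0 and C > 0, with C independent of d_in, d, L, U, β, N, I, and J, such that whenever N ≥ c·d²L² log max{d, L}, the empirical risk minimizer f̂ satisfies E_S[R(f̂) − R(f_0)] ≤ C U⁵ (log N)⁵ N⁻¹ d² L² log max{d, L} + 542 U² (⌊β⌋+1)⁴ (d_in T)^{2⌊β⌋ + max(β,1)} (JI)^{−4β/(d_in T)}. -/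

import Mathlib

open Matrix MeasureTheory

noncomputable section

/-- The ReLU activation function. -/
def relu (x : ℝ) : ℝ := max x 0

/-- A ParaRNN recurrent layer of width `d`: recurrent weights `Wh`, input weights `Wx`,
bias `b`, and initial hidden state `h0`. -/
structure RecLayer (d : ℕ) where
  Wh : Matrix (Fin d) (Fin d) ℝ
  Wx : Matrix (Fin d) (Fin d) ℝ
  b : Fin d → ℝ
  h0 : Fin d → ℝ

/-- The recurrent matrix is block diagonal with diagonal blocks of size `ds × ds`
(coordinates `i` and `j` interact only if they lie in the same block `⌊i/ds⌋ = ⌊j/ds⌋`). -/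
def RecLayer.BlockDiag {d : ℕ} (ds : ℕ) (ℓ : RecLayer d) : Prop :=
  ∀ i j : Fin d, (i : ℕ) / ds ≠ (j : ℕ) / ds → ℓ.Wh i j = 0

/-- Hidden states of a recurrent layer on the (0-indexed) input sequence `u`:
`state 0 = h0` and `state (t+1) = ReLU (Wh ⬝ state t + Wx ⬝ u t + b)`. -/
def RecLayer.state {d : ℕ} (ℓ : RecLayer d) (u : ℕ → Fin d → ℝ) : ℕ → Fin d → ℝ
  | 0 => ℓ.h0
  | t + 1 => fun i => relu (ℓ.Wh.mulVec (RecLayer.state ℓ u t) i + ℓ.Wx.mulVec (u t) i + ℓ.b i)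

/-- The output sequence of a recurrent layer: position `t` (0-indexed) carries the hidden
state after consuming inputs `u 0, …, u t`. -/
def RecLayer.out {d : ℕ} (ℓ : RecLayer d) (u : ℕ → Fin d → ℝ) : ℕ → Fin d → ℝ :=
  fun t => ℓ.state u (t + 1)

/-- A deep ParaRNN `N = Q ∘ F ∘ R_L ∘ ⋯ ∘ R_1 ∘ P` with input dimension `din`, output
dimension `dout`, width `d`, block size `ds`, and depth `L`. -/
structure ParaNet (din dout d ds L : ℕ) where
  P : Matrix (Fin d) (Fin din) ℝ
  layer : Fin L → RecLayer d
  blockdiag : ∀ l, (layer l).BlockDiag ds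
  Wf : Matrix (Fin d) (Fin d) ℝ
  bf : Fin d → ℝ
  Q : Matrix (Fin dout) (Fin d) ℝ

/-- Sequential application of a list of recurrent layers. -/
def applyLayers {d : ℕ} (ls : List (RecLayer d)) (u : ℕ → Fin d → ℝ) : ℕ → Fin d → ℝ :=
  ls.foldl (fun v ℓ => ℓ.out v) u

/-- The output sequence of a deep ParaRNN on a (0-indexed) input sequence: position `t`
is the paper's output `N(X)[t+1]`. -/
def ParaNet.forward {din dout d ds L : ℕ} (net : ParaNet din dout d ds L)
    (X : ℕ → Fin din → ℝ) : ℕ → Fin dout → ℝ :=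
  fun t => net.Q.mulVec fun i =>
    relu ((net.Wf.mulVec
        (applyLayers (List.ofFn net.layer) (fun s => net.P.mulVec (X s)) t)) i + net.bf i)

/-- Extend a length-`T` input sequence by zero; the ParaRNN output at positions `< T` only
depends on the first `T` inputs. -/
def extendInput {din T : ℕ} (X : Fin T → Fin din → ℝ) : ℕ → Fin din → ℝ :=
  fun t => if h : t < T then X ⟨t, h⟩ else 0

/-- `sup_{X ∈ ℝ^{din×T}, 1 ≤ t ≤ T} ‖N(X)[t]‖_∞ ≤ U`. -/
def ParaNet.Bounded {din dout d ds L : ℕ} (net : ParaNet din dout d ds L)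
    (T : ℕ) (U : ℝ) : Prop :=
  ∀ (X : Fin T → Fin din → ℝ) (t : ℕ), t < T → ∀ i, |net.forward (extendInput X) t i| ≤ U

/-- The ParaRNN function class `F^{(T)}_{din,dout,d,ds,L,U}`: maps `X ↦ N(X)[T]` for deep
ParaRNNs `N` with all outputs bounded by `U` in sup norm. -/
def ParaClass (din dout d ds L T : ℕ) (U : ℝ) :
    Set ((Fin T → Fin din → ℝ) → Fin dout → ℝ) :=
  {f | ∃ net : ParaNet din dout d ds L, net.Bounded T U ∧
        ∀ X, f X = net.forward (extendInput X) (T - 1)}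

/-- The scalar-output ParaRNN class `F^{(T)}_{din,1,d,ds,L,U}`, with outputs in `ℝ`. -/
def scalarClass (din d ds L T : ℕ) (U : ℝ) : Set ((Fin T → Fin din → ℝ) → ℝ) :=
  {f | ∃ net : ParaNet din 1 d ds L, net.Bounded T U ∧
        ∀ X, f X = net.forward (extendInput X) (T - 1) 0}

end
noncomputable section

/-- The unit cube `[0,1]^{din×T}` inside `ℝ^{din×T}`. -/
def cube (T din : ℕ) : Set (Fin T → Fin din → ℝ) :=
  {X | ∀ t i, X t i ∈ Set.Icc (0 : ℝ) 1}

/-- The coordinate basis vector of `ℝ^{din×T}` in direction `c = (t, i)`. -/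
def coordVec {T din : ℕ} (c : Fin T × Fin din) : Fin T → Fin din → ℝ :=
  Pi.single c.1 (Pi.single c.2 1)

/-- Iterated directional derivative (within a set `Ω`) along a list of directions. -/
def dirDerivList {E : Type*} [NormedAddCommGroup E] [NormedSpace ℝ E]
    (Ω : Set E) : List E → (E → ℝ) → E → ℝ
  | [], f => f
  | v :: l, f => fun x => fderivWithin ℝ (dirDerivList Ω l f) Ω x v

/-- The canonical list of coordinate directions associated to a multi-index `n`: each
coordinate `c` repeated `n c` times. -/
def dirsOf {T din : ℕ} {k : ℕ} (n : Fin T × Fin din → Fin (k + 1)) :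
    List (Fin T → Fin din → ℝ) :=
  (Finset.univ.toList (α := Fin T × Fin din)).foldr
    (fun c acc => List.replicate (n c : ℕ) (coordVec c) ++ acc) []

/-- Membership in the Hölder class `H^β_{din·T, dout}([0,1]^{din×T}, M)`: writing
`β = k + ω` with `k ∈ ℕ₀` and `ω ∈ (0,1]`, all partial derivatives up to order `k` exist
and are bounded, the order-`k` partial derivatives are `ω`-Hölder continuous, and for each
component the sum of the sup norms of the partial derivatives of order `< β` plus the sum
of the `ω`-Hölder seminorms of the order-`k` partial derivatives is at most `M`. -/
def MemHolderClass (T din dout : ℕ) (β M : ℝ)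
    (f : (Fin T → Fin din → ℝ) → Fin dout → ℝ) : Prop :=
  ∃ (k : ℕ) (ω : ℝ), β = k + ω ∧ ω ∈ Set.Ioc (0 : ℝ) 1 ∧
    (∀ (i : Fin dout) (l : List (Fin T × Fin din)), l.length < k → ∀ x ∈ cube T din,
      DifferentiableWithinAt ℝ
        (dirDerivList (cube T din) (l.map coordVec) (fun y => f y i)) (cube T din) x) ∧
    (∀ (i : Fin dout) (l : List (Fin T × Fin din)), l.length ≤ k →
      ∃ C : ℝ, ∀ x ∈ cube T din,
        |dirDerivList (cube T din) (l.map coordVec) (fun y => f y i) x| ≤ C) ∧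
    (∀ (i : Fin dout) (l : List (Fin T × Fin din)), l.length = k →
      ∃ C : ℝ, ∀ x ∈ cube T din, ∀ y ∈ cube T din,
        |dirDerivList (cube T din) (l.map coordVec) (fun z => f z i) x
          - dirDerivList (cube T din) (l.map coordVec) (fun z => f z i) y|
          ≤ C * ‖x - y‖ ^ ω) ∧
    (∀ i : Fin dout,
      (∑ n : Fin T × Fin din → Fin (k + 1),
        if (∑ c, ((n c : ℕ))) ≤ k then
          sSup ((fun x =>
            |dirDerivList (cube T din) (dirsOf n) (fun y => f y i) x|) '' cube T din)
        else 0)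
      + (∑ n : Fin T × Fin din → Fin (k + 1),
        if (∑ c, ((n c : ℕ))) = k then
          sSup {r : ℝ | ∃ x ∈ cube T din, ∃ y ∈ cube T din, x ≠ y ∧
            r = |dirDerivList (cube T din) (dirsOf n) (fun z => f z i) x
                  - dirDerivList (cube T din) (dirsOf n) (fun z => f z i) y|
                / ‖x - y‖ ^ ω}
        else 0) ≤ M)

end

noncomputable section

/-- The `L₂` risk `R(φ) = E[(φ(X_T) − z_T)²]`. -/
def risk {din T : ℕ} (μ : MeasureTheory.Measure ((Fin T → Fin din → ℝ) × ℝ))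
    (φ : (Fin T → Fin din → ℝ) → ℝ) : ℝ :=
  ∫ p, (φ p.1 - p.2) ^ 2 ∂μ

/-- The empirical risk `R_N(φ) = N⁻¹ Σᵢ (φ(X_{i,T}) − z_{i,T})²` on a sample `s`. -/
def empRisk {din T N : ℕ} (s : Fin N → (Fin T → Fin din → ℝ) × ℝ)
    (φ : (Fin T → Fin din → ℝ) → ℝ) : ℝ :=
  (N : ℝ)⁻¹ * ∑ i, (φ (s i).1 - (s i).2) ^ 2

/-- The ParaRNN width prescribed in the approximation theory (output dimension 1). -/
def widthOf (din T ds J : ℕ) (β : ℝ) : ℕ :=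
  76 * (⌊β⌋₊ + 1) ^ 2 * 3 ^ (din * T) * din ^ (⌊β⌋₊ + 2) * T ^ (⌊β⌋₊ + 1)
    * J * Nat.clog 2 (8 * J) + ds

/-- The ParaRNN depth prescribed in the approximation theory. -/
def depthOf (din T I : ℕ) (β : ℝ) : ℕ :=
  42 * (⌊β⌋₊ + 1) ^ 2 * I * Nat.clog 2 (8 * I) + 6 * din * T

end

/-! ### Isotropic position of a finite family of vectors -/

/-- The weighted Gram matrix `∑ w R • v R (v R)ᵀ`. -/
noncomputable def weightedGram {X : Type*} [Fintype X] {B : ℕ} (v : X → Fin B → ℝ) (w : X → ℝ) :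
    Matrix (Fin B) (Fin B) ℝ :=
  ∑ R, w R • vecMulVec (v R) (v R)

section Forster

variable {X : Type*} {B : ℕ}

lemma dotProduct_sum_smul_vecMulVec_mulVec (v : X → Fin B → ℝ) (w : X → ℝ) (s : Finset X)
    (x : Fin B → ℝ) :
    x ⬝ᵥ ((∑ R ∈ s, w R • vecMulVec (v R) (v R)) *ᵥ x) = ∑ R ∈ s, w R * (v R ⬝ᵥ x) ^ 2 := by
  rw [Matrix.sum_mulVec, dotProduct_sum]
  refine Finset.sum_congr rfl fun R _ => ?_
  rw [Matrix.smul_mulVec, dotProduct_smul, vecMulVec_mulVec, smul_eq_mul]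
  simp only [dotProduct_smul, MulOpposite.smul_eq_mul_unop, MulOpposite.unop_op]
  rw [dotProduct_comm x (v R)]
  ring

lemma isHermitian_sum_smul_vecMulVec (v : X → Fin B → ℝ) (w : X → ℝ) (s : Finset X) :
    (∑ R ∈ s, w R • vecMulVec (v R) (v R)).IsHermitian := by
  unfold Matrix.IsHermitian
  ext i j
  simp only [conjTranspose_apply, Matrix.sum_apply, Matrix.smul_apply, vecMulVec_apply, star_trivial,
    smul_eq_mul]
  exact Finset.sum_congr rfl fun R _ => by ring

/-- Every `B` of the vectors form a basis. -/
def IsGenericFamily (v : X → Fin B → ℝ) : Prop :=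
  ∀ f : Fin B ↪ X, (Matrix.of fun i => v (f i)).det ≠ 0

lemma posDef_sum_of_embedding {v : X → Fin B → ℝ} (hv : IsGenericFamily v) {w : X → ℝ}
    (hw : ∀ R, 0 < w R) (f : Fin B ↪ X) {s : Finset X} (hs : ∀ i, f i ∈ s) :
    (∑ R ∈ s, w R • vecMulVec (v R) (v R)).PosDef := by
  refine Matrix.PosDef.of_dotProduct_mulVec_pos (isHermitian_sum_smul_vecMulVec v w s) ?_
  intro x hx
  rw [star_trivial, dotProduct_sum_smul_vecMulVec_mulVec]
  have hne : (Matrix.of fun i => v (f i)) *ᵥ x ≠ 0 := by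
    intro h0
    exact hx (Matrix.eq_zero_of_mulVec_eq_zero (hv f) h0)
  obtain ⟨i, hi⟩ := Function.ne_iff.mp hne
  have hi' : v (f i) ⬝ᵥ x ≠ 0 := hi
  refine Finset.sum_pos' (fun R _ => mul_nonneg (hw R).le (sq_nonneg _)) ⟨f i, hs i, ?_⟩
  have := hw (f i)
  positivity

variable [Fintype X]

lemma det_add_smul_vecMulVec {A : Matrix (Fin B) (Fin B) ℝ} (hA : A.det ≠ 0) (c : ℝ)
    (x : Fin B → ℝ) :
    (A + c • vecMulVec x x).det = A.det * (1 + c * (x ⬝ᵥ (A⁻¹ *ᵥ x))) := by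
  have h := Matrix.det_add_replicateCol_mul_replicateRow (ι := Unit) (A := A)
    (isUnit_iff_ne_zero.mpr hA) (c • x) x
  have e1 : replicateCol Unit (c • x) * replicateRow Unit x = c • vecMulVec x x := by
    ext i j
    simp [Matrix.mul_apply, vecMulVec_apply, mul_assoc]
  rw [e1] at h
  rw [h]
  congr 1
  rw [Matrix.det_unique]
  simp only [Matrix.add_apply, one_apply_eq, Matrix.mul_assoc]
  congr 1
  simp only [Matrix.mul_apply, replicateRow_apply, replicateCol_apply, Pi.smul_apply, smul_eq_mul,
    dotProduct, mulVec, Finset.mul_sum]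
  exact Finset.sum_congr rfl fun i _ => Finset.sum_congr rfl fun j _ => by ring

lemma det_le_det_add_smul_vecMulVec {A : Matrix (Fin B) (Fin B) ℝ} (hA : A.PosDef) {c : ℝ}
    (hc : 0 ≤ c) (x : Fin B → ℝ) : A.det ≤ (A + c • vecMulVec x x).det := by
  rw [det_add_smul_vecMulVec hA.det_pos.ne']
  have h1 : 0 ≤ x ⬝ᵥ (A⁻¹ *ᵥ x) := by
    have := hA.inv.posSemidef.dotProduct_mulVec_nonneg x
    simpa using this
  have := hA.det_pos
  nlinarith [mul_nonneg this.le (mul_nonneg hc h1)]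

/-- The determinant of the Gram matrix dominates that of any `B`-element subfamily. -/
lemma prod_mul_sq_det_le_det_weightedGram {v : X → Fin B → ℝ} (hv : IsGenericFamily v) {w : X → ℝ}
    (hw : ∀ R, 0 < w R) (f : Fin B ↪ X) :
    (∏ i, w (f i)) * (Matrix.of fun i => v (f i)).det ^ 2 ≤ (weightedGram v w).det := by
  classical
  have base : (∑ R ∈ Finset.univ.map f, w R • vecMulVec (v R) (v R)).det
      = (∏ i, w (f i)) * (Matrix.of fun i => v (f i)).det ^ 2 := by
    have e : (∑ R ∈ Finset.univ.map f, w R • vecMulVec (v R) (v R))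
        = (Matrix.of fun i => v (f i))ᵀ * (Matrix.diagonal (fun i => w (f i))
            * (Matrix.of fun i => v (f i))) := by
      ext a b
      rw [Finset.sum_map, Matrix.mul_apply]
      simp only [Matrix.sum_apply, Matrix.smul_apply, vecMulVec_apply, transpose_apply, of_apply,
        diagonal_mul, smul_eq_mul]
      exact Finset.sum_congr rfl fun i _ => by ring
    rw [e, det_mul, det_mul, det_transpose, det_diagonal]
    ring
  have mono : ∀ s : Finset X, (∑ R ∈ Finset.univ.map f, w R • vecMulVec (v R) (v R)).det
      ≤ (∑ R ∈ Finset.univ.map f ∪ s, w R • vecMulVec (v R) (v R)).det := by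
    intro s
    induction s using Finset.induction_on with
    | empty => simp
    | insert a s has ih =>
      rw [Finset.union_insert]
      by_cases ha : a ∈ Finset.univ.map f ∪ s
      · rw [Finset.insert_eq_self.mpr ha]; exact ih
      · rw [Finset.sum_insert ha, add_comm]
        refine ih.trans (det_le_det_add_smul_vecMulVec
          (posDef_sum_of_embedding hv hw f fun i => ?_) (hw a).le _)
        simp
  have := mono Finset.univ
  rw [base, Finset.union_eq_right.mpr (Finset.subset_univ _)] at this
  exact this

lemma weightedGram_smul (v : X → Fin B → ℝ) (w : X → ℝ) (c : ℝ) :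
    weightedGram v (fun R => c * w R) = c • weightedGram v w := by
  simp only [weightedGram, Finset.smul_sum, smul_smul]

lemma weightedGram_update [DecidableEq X] (v : X → Fin B → ℝ) (w : X → ℝ) (R : X) (c : ℝ) :
    weightedGram v (Function.update w R (w R + c))
      = weightedGram v w + c • vecMulVec (v R) (v R) := by
  have : ∀ R', Function.update w R (w R + c) R' = w R' + (if R' = R then c else 0) := by
    intro R'
    by_cases h : R' = R
    · subst h; simp
    · simp [h]
  simp only [weightedGram, this, add_smul, Finset.sum_add_distrib, ite_smul, zero_smul,
    Finset.sum_ite_eq', Finset.mem_univ, if_true]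

lemma continuous_det_weightedGram_exp (v : X → Fin B → ℝ) :
    Continuous fun t : X → ℝ => (weightedGram v fun R => Real.exp (t R)).det := by
  refine Continuous.matrix_det ?_
  unfold weightedGram
  refine continuous_finsetSum _ fun R _ => ?_
  exact (Real.continuous_exp.comp (continuous_apply R)).smul continuous_const

/-- The sum of `t` over the best `B`-element subfamily dominates the maximum of `t`. -/
lemma exists_embedding_sum_ge (hB : 0 < B) (hn : B < Fintype.card X) (t : X → ℝ)
    (ht : ∑ R, t R = 0) (R₀ : X) (h0 : 0 ≤ t R₀) (hmax : ∀ R, t R ≤ t R₀) :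
    ∃ f : Fin B ↪ X, t R₀ ≤ (Fintype.card X - 1 : ℝ) * ∑ i, t (f i) := by
  classical
  have : Nonempty (Fin B ↪ X) := by
    refine Function.Embedding.nonempty_of_card_le ?_
    simpa using hn.le
  obtain ⟨f, hf⟩ := Finite.exists_max (fun f : Fin B ↪ X => ∑ i, t (f i))
  refine ⟨f, ?_⟩
  have hcard : (1 : ℝ) ≤ Fintype.card X - B := by
    have : B + 1 ≤ Fintype.card X := hn
    have : ((B + 1 : ℕ) : ℝ) ≤ Fintype.card X := by exact_mod_cast this
    push_cast at this; linarith
  have hB' : (1 : ℝ) ≤ B := by exact_mod_cast hB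
  have exch : ∀ i, ∀ R', R' ∉ Set.range f → t R' ≤ t (f i) := by
    intro i R' hR'
    have hinj : Function.Injective (Function.update f i R') := by
      intro a b hab
      by_cases ha : a = i <;> by_cases hb : b = i
      · rw [ha, hb]
      · subst ha
        rw [Function.update_self, Function.update_of_ne hb] at hab
        exact absurd ⟨b, hab.symm⟩ hR'
      · subst hb
        rw [Function.update_self, Function.update_of_ne ha] at hab
        exact absurd ⟨a, hab⟩ hR'
      · rw [Function.update_of_ne ha, Function.update_of_ne hb] at hab
        exact f.injective hab
    have h1 := hf ⟨Function.update f i R', hinj⟩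
    simp only [Function.Embedding.coeFn_mk] at h1
    rw [← Finset.add_sum_erase _ _ (Finset.mem_univ i),
      ← Finset.add_sum_erase _ (fun j => t (f j)) (Finset.mem_univ i)] at h1
    have h2 : ∑ j ∈ Finset.univ.erase i, t (Function.update f i R' j)
        = ∑ j ∈ Finset.univ.erase i, t (f j) := by
      refine Finset.sum_congr rfl fun j hj => ?_
      rw [Function.update_of_ne (Finset.ne_of_mem_erase hj)]
    rw [h2, Function.update_self] at h1
    linarith
  set σ := ∑ i, t (f i) with hσ
  by_cases hR : R₀ ∈ Set.range f
  · obtain ⟨i₀, rfl⟩ := hR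
    have hsplit : (∑ R ∈ Finset.univ.map f, t R) + ∑ R ∈ (Finset.univ.map f)ᶜ, t R = 0 := by
      rw [Finset.sum_add_sum_compl, ht]
    rw [Finset.sum_map] at hsplit
    have hlow : ∀ i, -σ ≤ (Fintype.card X - B : ℝ) * t (f i) := by
      intro i
      have h1 : ∑ R ∈ (Finset.univ.map f)ᶜ, t R ≤ ∑ R ∈ (Finset.univ.map f)ᶜ, t (f i) := by
        refine Finset.sum_le_sum fun R hR => exch i R ?_
        simpa using hR
      rw [Finset.sum_const, Finset.card_compl, Finset.card_map, Finset.card_univ,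
        Fintype.card_fin, nsmul_eq_mul, Nat.cast_sub hn.le] at h1
      linarith
    have h3 : (Fintype.card X - B : ℝ) * σ
        ≥ (Fintype.card X - B : ℝ) * t (f i₀) + (B - 1 : ℝ) * (-σ) := by
      rw [hσ, ← Finset.add_sum_erase _ _ (Finset.mem_univ i₀), mul_add, Finset.mul_sum]
      have : ∑ j ∈ Finset.univ.erase i₀, (-σ)
          ≤ ∑ j ∈ Finset.univ.erase i₀, (Fintype.card X - B : ℝ) * t (f j) :=
        Finset.sum_le_sum fun j _ => hlow j
      rw [Finset.sum_const, Finset.card_erase_of_mem (Finset.mem_univ _), Finset.card_univ,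
        Fintype.card_fin, nsmul_eq_mul, Nat.cast_sub hB, Nat.cast_one] at this
      rw [Finset.add_sum_erase _ (fun i => t (f i)) (Finset.mem_univ i₀), ← hσ]
      linarith
    nlinarith
  · have h4 : (B : ℝ) * t R₀ ≤ σ := by
      have : ∑ _i : Fin B, t R₀ ≤ ∑ i, t (f i) :=
        Finset.sum_le_sum fun i _ => exch i R₀ hR
      simpa using this
    have h5 : t R₀ ≤ σ := by nlinarith
    have h6 : (1 : ℝ) ≤ Fintype.card X - 1 := by linarith
    have h7 : 0 ≤ σ := h0.trans h5
    nlinarith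

/-- A generic family of vectors admits weights for which all leverage scores agree. -/
theorem exists_weights_leverage_eq (hB : 0 < B) (hn : B < Fintype.card X) {v : X → Fin B → ℝ}
    (hv : IsGenericFamily v) :
    ∃ w : X → ℝ, (∀ R, 0 < w R) ∧ (weightedGram v w).PosDef ∧
      ∀ R, w R * (v R ⬝ᵥ ((weightedGram v w)⁻¹ *ᵥ v R)) = B / Fintype.card X := by
  classical
  set n : ℝ := (Fintype.card X : ℝ) with hndef
  have hn1 : (1 : ℝ) < n := by
    rw [hndef]; exact_mod_cast (by omega : 1 < Fintype.card X)
  obtain ⟨f₀⟩ : Nonempty (Fin B ↪ X) :=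
    Function.Embedding.nonempty_of_card_le (by simpa using hn.le)
  have hpd : ∀ w : X → ℝ, (∀ R, 0 < w R) → (weightedGram v w).PosDef := fun w hw =>
    posDef_sum_of_embedding hv hw f₀ fun i => Finset.mem_univ _
  set g : (X → ℝ) → ℝ := fun t => (weightedGram v fun R => Real.exp (t R)).det with hg
  have hgc : Continuous g := continuous_det_weightedGram_exp v
  have hgpos : ∀ t, 0 < g t := fun t => (hpd _ fun R => Real.exp_pos _).det_pos
  have hne : Nonempty (Fin B ↪ X) := ⟨f₀⟩
  obtain ⟨fm, hfm⟩ := Finite.exists_min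
    (fun f : Fin B ↪ X => (Matrix.of fun i => v (f i)).det ^ 2)
  set c := (Matrix.of fun i => v (fm i)).det ^ 2 with hc
  have hcpos : 0 < c := by have := hv fm; positivity
  set K : Set (X → ℝ) := {t | ∑ R, t R = 0 ∧ g t ≤ g 0} with hK
  have hKclosed : IsClosed K :=
    (isClosed_eq (continuous_finsetSum _ fun R _ => continuous_apply R) continuous_const).inter
      (isClosed_le hgc continuous_const)
  set M : ℝ := (n - 1) * Real.log (g 0 / c) with hM
  have hXne : Nonempty X := Fintype.card_pos_iff.mp (by omega)
  have hupper : ∀ t ∈ K, ∀ R, t R ≤ M := by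
    intro t ht R
    obtain ⟨R₀, hR₀⟩ := Finite.exists_max t
    have h0 : 0 ≤ t R₀ := by
      by_contra hlt
      push Not at hlt
      have : ∑ R, t R < 0 :=
        Finset.sum_neg (fun R _ => (hR₀ R).trans_lt hlt) Finset.univ_nonempty
      linarith [ht.1]
    obtain ⟨f, hf⟩ := exists_embedding_sum_ge hB hn t ht.1 R₀ h0 hR₀
    have h1 := prod_mul_sq_det_le_det_weightedGram hv (w := fun R => Real.exp (t R))
      (fun R => Real.exp_pos _) f
    rw [← Real.exp_sum] at h1
    have h2 : Real.exp (∑ i, t (f i)) * c ≤ g 0 :=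
      (mul_le_mul_of_nonneg_left (hfm f) (Real.exp_pos _).le).trans (h1.trans ht.2)
    have h3 : ∑ i, t (f i) ≤ Real.log (g 0 / c) := by
      rw [Real.le_log_iff_exp_le (div_pos (hgpos 0) hcpos), le_div_iff₀ hcpos]
      exact h2
    refine (hR₀ R).trans (hf.trans ?_)
    exact mul_le_mul_of_nonneg_left h3 (by linarith)
  have hlower : ∀ t ∈ K, ∀ R, -(n * |M|) ≤ t R := by
    intro t ht R
    have h1 : t R = -∑ R' ∈ Finset.univ.erase R, t R' := by
      have := Finset.add_sum_erase Finset.univ t (Finset.mem_univ R)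
      rw [ht.1] at this; linarith
    have h2 : ∑ R' ∈ Finset.univ.erase R, t R' ≤ ∑ R' ∈ Finset.univ.erase R, |M| :=
      Finset.sum_le_sum fun R' _ => (hupper t ht R').trans (le_abs_self _)
    have h3 : ∑ R' ∈ Finset.univ.erase R, |M| ≤ ∑ _R' : X, |M| :=
      Finset.sum_le_sum_of_subset_of_nonneg (Finset.subset_univ _) fun _ _ _ => abs_nonneg _
    have h4 : ∑ _R' : X, |M| = n * |M| := by simp [hndef]
    rw [h1]; linarith
  have hKcomp : IsCompact K := by
    refine IsCompact.of_isClosed_subset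
      (isCompact_univ_pi fun _ : X => isCompact_Icc (a := -(n * |M|)) (b := M)) hKclosed ?_
    intro t ht R _
    exact ⟨hlower t ht R, hupper t ht R⟩
  have hK0 : (0 : X → ℝ) ∈ K := ⟨by simp, le_rfl⟩
  obtain ⟨t, htK, htmin⟩ := hKcomp.exists_isMinOn ⟨0, hK0⟩ hgc.continuousOn
  have hmin : ∀ t', ∑ R, t' R = 0 → g t ≤ g t' := by
    intro t' ht'
    by_cases h : g t' ≤ g 0
    · exact htmin ⟨ht', h⟩
    · exact htK.2.trans (not_le.mp h).le
  set w : X → ℝ := fun R => Real.exp (t R) with hw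
  have hwpos : ∀ R, 0 < w R := fun R => Real.exp_pos _
  refine ⟨w, hwpos, hpd w hwpos, fun R => ?_⟩
  set ℓ := w R * (v R ⬝ᵥ ((weightedGram v w)⁻¹ *ᵥ v R)) with hℓ
  have hdet : 0 < (weightedGram v w).det := (hpd w hwpos).det_pos
  have key : ∀ s : ℝ, Real.exp (s * (B / n)) ≤ 1 + (Real.exp s - 1) * ℓ := by
    intro s
    set t' : X → ℝ := fun R' => t R' + (if R' = R then s else 0) - s / n with ht'
    have hsum : ∑ R', t' R' = 0 := by
      simp only [ht', Finset.sum_sub_distrib, Finset.sum_add_distrib, htK.1, Finset.sum_ite_eq',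
        Finset.mem_univ, if_true, Finset.sum_const, Finset.card_univ, nsmul_eq_mul, ← hndef]
      field_simp
      ring
    have h1 := hmin t' hsum
    have h2 : (fun R' => Real.exp (t' R')) = fun R' => Real.exp (-(s / n)) *
        Function.update w R (w R + (Real.exp s - 1) * w R) R' := by
      ext R'
      by_cases h : R' = R
      · subst h
        simp only [ht', if_true, Function.update_self, hw]
        rw [sub_eq_add_neg, Real.exp_add, Real.exp_add]; ring
      · simp only [ht', if_neg h, Function.update_of_ne h, hw]
        rw [sub_eq_add_neg, Real.exp_add, add_zero]; ring
    have h3 : g t' = Real.exp (-(s / n)) ^ B *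
        ((weightedGram v w).det * (1 + (Real.exp s - 1) * ℓ)) := by
      simp only [hg]
      rw [h2, weightedGram_smul, weightedGram_update, det_smul, Fintype.card_fin,
        det_add_smul_vecMulVec hdet.ne', hℓ]
      ring
    have h4 : g t = (weightedGram v w).det := rfl
    rw [h3, h4, ← Real.exp_nat_mul] at h1
    have h5 : 1 ≤ Real.exp (B * -(s / n)) * (1 + (Real.exp s - 1) * ℓ) := by
      by_contra hlt
      push Not at hlt
      nlinarith
    have h6 : Real.exp (s * (B / n)) * Real.exp (B * -(s / n)) = 1 := by
      rw [← Real.exp_add]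
      have : s * (B / n) + B * -(s / n) = 0 := by ring
      rw [this, Real.exp_zero]
    calc Real.exp (s * (B / n)) = Real.exp (s * (B / n)) * 1 := by ring
      _ ≤ Real.exp (s * (B / n)) * (Real.exp (B * -(s / n)) * (1 + (Real.exp s - 1) * ℓ)) :=
        mul_le_mul_of_nonneg_left h5 (Real.exp_pos _).le
      _ = _ := by rw [← mul_assoc, h6, one_mul]
  have hloc : IsLocalMin (fun s : ℝ => 1 + (Real.exp s - 1) * ℓ - Real.exp (s * (B / n))) 0 := by
    refine Filter.Eventually.of_forall fun s => ?_
    simp only [Real.exp_zero, sub_self, zero_mul, add_zero]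
    linarith [key s]
  have hder : HasDerivAt (fun s : ℝ => 1 + (Real.exp s - 1) * ℓ - Real.exp (s * (B / n)))
      (ℓ - B / n) 0 := by
    have h1 : HasDerivAt (fun s : ℝ => 1 + (Real.exp s - 1) * ℓ) (Real.exp 0 * ℓ) 0 :=
      (((Real.hasDerivAt_exp 0).sub_const 1).mul_const ℓ).const_add 1
    have h2 : HasDerivAt (fun s : ℝ => Real.exp (s * (B / n)))
        (Real.exp (0 * (B / n)) * (1 * (B / n))) 0 :=
      ((hasDerivAt_id (0 : ℝ)).mul_const (B / n)).exp
    exact (h1.sub h2).congr_deriv (by simp)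
  have := hloc.hasDerivAt_eq_zero hder
  linarith

end Forster

section Forster

variable {X : Type*} [Fintype X] {B : ℕ}

/-- Forster's bound: an orthogonal sign matrix of order `n` has sign rank at least `√n`. -/
lemma card_le_sq_of_isGenericFamily [DecidableEq X] {v u : X → Fin B → ℝ}
    (hv : IsGenericFamily v) {H : X → X → ℝ}
    (habs : ∀ S R, |H S R| = 1)
    (horth : ∀ R R', ∑ S, H S R * H S R' = if R = R' then (Fintype.card X : ℝ) else 0)
    (hpos : ∀ S R, 0 < H S R * (u S ⬝ᵥ v R)) : Fintype.card X ≤ B ^ 2 := by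
  rcases isEmpty_or_nonempty X with hX | hX
  · simp
  have hB : 0 < B := by
    rcases Nat.eq_zero_or_pos B with h | h
    · subst h
      obtain ⟨R⟩ := hX
      have := hpos R R
      simp at this
    · exact h
  rcases Nat.lt_or_ge B (Fintype.card X) with hn | hn
  swap
  · exact hn.trans (Nat.le_self_pow two_ne_zero B)
  obtain ⟨w, hw, hpd, hlev⟩ := exists_weights_leverage_eq hB hn hv
  set G := weightedGram v w with hG
  set n : ℝ := (Fintype.card X : ℝ) with hndef
  have hnpos : 0 < n := by rw [hndef]; exact_mod_cast Fintype.card_pos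
  have hBpos : (0 : ℝ) < B := by exact_mod_cast hB
  have hdet : IsUnit G.det := isUnit_iff_ne_zero.mpr hpd.det_pos.ne'
  have hGinv := hpd.inv
  -- bilinear form of the inverse Gram matrix
  have hCS : ∀ x y : Fin B → ℝ, (x ⬝ᵥ y) ^ 2 ≤ (x ⬝ᵥ (G *ᵥ x)) * (y ⬝ᵥ (G⁻¹ *ᵥ y)) := by
    intro x y
    have hq : ∀ c : ℝ, 0 ≤ (y ⬝ᵥ (G⁻¹ *ᵥ y)) * (c * c) + (2 * (x ⬝ᵥ y)) * c + x ⬝ᵥ (G *ᵥ x) := by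
      intro c
      have h1 := hGinv.posSemidef.dotProduct_mulVec_nonneg (c • y + G *ᵥ x)
      rw [star_trivial, Matrix.mulVec_add, Matrix.mulVec_mulVec, Matrix.nonsing_inv_mul _ hdet,
        Matrix.one_mulVec, Matrix.mulVec_smul, add_dotProduct, dotProduct_add, dotProduct_add,
        smul_dotProduct, smul_dotProduct, dotProduct_smul, dotProduct_smul] at h1
      have h2 : (G *ᵥ x) ⬝ᵥ (G⁻¹ *ᵥ y) = x ⬝ᵥ y := by
        have hGt : Gᵀ = G := by
          have := hpd.isHermitian
          rwa [Matrix.IsHermitian, conjTranspose_eq_transpose_of_trivial] at this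
        rw [← hGt, Matrix.mulVec_transpose, ← Matrix.dotProduct_mulVec, hGt,
          Matrix.mulVec_mulVec, Matrix.mul_nonsing_inv _ hdet, Matrix.one_mulVec]
      rw [h2, dotProduct_comm (G *ᵥ x) x, dotProduct_comm y x] at h1
      simp only [smul_eq_mul] at h1
      nlinarith
    have := discrim_le_zero hq
    unfold discrim at this
    nlinarith
  have hquad : ∀ x : Fin B → ℝ, x ⬝ᵥ (G *ᵥ x) = ∑ R, w R * (v R ⬝ᵥ x) ^ 2 := fun x =>
    dotProduct_sum_smul_vecMulVec_mulVec v w Finset.univ x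
  set z : X → Fin B → ℝ := fun S => ∑ R, (Real.sqrt (w R) * H S R) • v R with hz
  have hsq : ∀ R, Real.sqrt (w R) * Real.sqrt (w R) = w R := fun R => Real.mul_self_sqrt (hw R).le
  -- lower bound for each row
  have hrow : ∀ S, n / B ≤ z S ⬝ᵥ (G⁻¹ *ᵥ z S) := by
    intro S
    have huz : u S ⬝ᵥ z S = ∑ R, Real.sqrt (w R) * |u S ⬝ᵥ v R| := by
      rw [hz, dotProduct_sum]
      refine Finset.sum_congr rfl fun R _ => ?_
      rw [dotProduct_smul, smul_eq_mul, mul_assoc]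
      congr 1
      rw [← abs_of_pos (hpos S R), abs_mul, habs, one_mul]
    set q := u S ⬝ᵥ (G *ᵥ u S) with hq
    have hq0 : 0 < q := by
      have R : X := hX.some
      rw [hq, hquad]
      refine Finset.sum_pos (fun R _ => ?_) Finset.univ_nonempty
      have h1 : v R ⬝ᵥ u S ≠ 0 := by
        intro h0
        have := hpos S R
        rw [dotProduct_comm, h0, mul_zero] at this
        exact lt_irrefl _ this
      have := hw R
      positivity
    have hmax : ∀ R, (Real.sqrt (w R) * |u S ⬝ᵥ v R|) ^ 2 ≤ q * (B / n) := by
      intro R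
      have h1 := hCS (u S) (v R)
      have h2 := hlev R
      calc (Real.sqrt (w R) * |u S ⬝ᵥ v R|) ^ 2 = w R * (u S ⬝ᵥ v R) ^ 2 := by
            rw [mul_pow, sq_abs, Real.sq_sqrt (hw R).le]
        _ ≤ w R * (q * (v R ⬝ᵥ (G⁻¹ *ᵥ v R))) := mul_le_mul_of_nonneg_left h1 (hw R).le
        _ = q * (w R * (v R ⬝ᵥ (G⁻¹ *ᵥ v R))) := by ring
        _ = q * (B / n) := by rw [h2]
    set m := Real.sqrt (q * (B / n)) with hm
    have hmpos : 0 < m := Real.sqrt_pos.mpr (by positivity)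
    have hmsq : m ^ 2 = q * (B / n) := Real.sq_sqrt (by positivity)
    have hle : ∀ R, Real.sqrt (w R) * |u S ⬝ᵥ v R| ≤ m := fun R =>
      Real.le_sqrt_of_sq_le (hmax R)
    have h3 : q ≤ m * (u S ⬝ᵥ z S) := by
      rw [hq, hquad, huz, Finset.mul_sum]
      refine Finset.sum_le_sum fun R _ => ?_
      have h4 : w R * (v R ⬝ᵥ u S) ^ 2
          = (Real.sqrt (w R) * |u S ⬝ᵥ v R|) * (Real.sqrt (w R) * |u S ⬝ᵥ v R|) := by
        rw [dotProduct_comm, ← sq_abs, ← hsq R]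
        rw [Real.sqrt_mul_self (Real.sqrt_nonneg _)]; ring
      rw [h4]
      exact mul_le_mul_of_nonneg_right (hle R) (by positivity)
    have h5 := hCS (u S) (z S)
    have h6 : q ^ 2 ≤ m ^ 2 * (q * (z S ⬝ᵥ (G⁻¹ *ᵥ z S))) := by
      calc q ^ 2 ≤ (m * (u S ⬝ᵥ z S)) ^ 2 := pow_le_pow_left₀ hq0.le h3 2
        _ = m ^ 2 * (u S ⬝ᵥ z S) ^ 2 := by ring
        _ ≤ _ := mul_le_mul_of_nonneg_left h5 (sq_nonneg _)
    rw [hmsq] at h6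
    have h7 : q ^ 2 * 1 ≤ q ^ 2 * ((B / n) * (z S ⬝ᵥ (G⁻¹ *ᵥ z S))) := by nlinarith
    have h8 := le_of_mul_le_mul_left h7 (by positivity)
    rw [div_le_iff₀ hBpos]
    calc n = n * 1 := by ring
      _ ≤ n * ((B / n) * (z S ⬝ᵥ (G⁻¹ *ᵥ z S))) := mul_le_mul_of_nonneg_left h8 hnpos.le
      _ = _ := by field_simp
  -- summing over the rows
  have hsum : ∑ S, z S ⬝ᵥ (G⁻¹ *ᵥ z S) = n * B := by
    have h1 : ∀ S, z S ⬝ᵥ (G⁻¹ *ᵥ z S) = ∑ R, ∑ R', (H S R * H S R') *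
        (Real.sqrt (w R) * Real.sqrt (w R') * (v R ⬝ᵥ (G⁻¹ *ᵥ v R'))) := by
      intro S
      rw [hz]
      simp only [Matrix.mulVec_sum, sum_dotProduct, dotProduct_sum, Matrix.mulVec_smul,
        smul_dotProduct, dotProduct_smul, smul_eq_mul]
      simp only [Finset.mul_sum]
      rw [Finset.sum_comm]
      refine Finset.sum_congr rfl fun R _ => Finset.sum_congr rfl fun R' _ => ?_
      ring
    simp only [h1]
    rw [Finset.sum_comm]
    have h2 : ∀ R, ∑ S, ∑ R', (H S R * H S R') *
        (Real.sqrt (w R) * Real.sqrt (w R') * (v R ⬝ᵥ (G⁻¹ *ᵥ v R'))) = B := by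
      intro R
      rw [Finset.sum_comm]
      simp only [← Finset.sum_mul, horth]
      simp only [ite_mul, zero_mul, Finset.sum_ite_eq, Finset.mem_univ, if_true]
      rw [hsq, hlev]
      field_simp
    simp only [h2, Finset.sum_const, Finset.card_univ, nsmul_eq_mul, ← hndef]
  have h9 : n * (n / B) ≤ n * B := by
    rw [← hsum]
    have : ∑ _S : X, n / B ≤ ∑ S, z S ⬝ᵥ (G⁻¹ *ᵥ z S) := Finset.sum_le_sum fun S _ => hrow S
    simpa [hndef] using this
  have h10 := le_of_mul_le_mul_left h9 hnpos
  rw [div_le_iff₀ hBpos] at h10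
  have : (Fintype.card X : ℝ) ≤ ((B ^ 2 : ℕ) : ℝ) := by push_cast; rw [← hndef]; nlinarith
  exact_mod_cast this

/-- Generic families are dense along a suitable direction. -/
lemma exists_perturbation_isGenericFamily (v : X → Fin B → ℝ) :
    ∃ w : X → Fin B → ℝ, ∀ η : ℝ, 0 < η → ∃ ε : ℝ, 0 < ε ∧ ε < η ∧
      IsGenericFamily (fun R => v R + ε • w R) := by
  classical
  set e := Fintype.equivFin X
  set w : X → Fin B → ℝ := fun R j => ((e R : ℕ) : ℝ) ^ (j : ℕ) with hw
  refine ⟨w, fun η hη => ?_⟩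
  set p : (Fin B ↪ X) → Polynomial ℝ := fun f =>
    ((Polynomial.X : Polynomial ℝ) • (Matrix.of fun i => w (f i)).map Polynomial.C
      + (Matrix.of fun i => v (f i)).map Polynomial.C).det with hp
  have hpne : ∀ f, p f ≠ 0 := by
    intro f h0
    have h1 := Polynomial.coeff_det_X_add_C_card (Matrix.of fun i => w (f i))
      (Matrix.of fun i => v (f i))
    have h2 : (Matrix.of fun i => w (f i)).det ≠ 0 := by
      have : (Matrix.of fun i => w (f i)) = Matrix.vandermonde fun i => ((e (f i) : ℕ) : ℝ) := by
        ext i j; simp [hw, Matrix.vandermonde]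
      rw [this, Matrix.det_vandermonde_ne_zero_iff]
      intro i j hij
      have : (e (f i) : ℕ) = e (f j) := by
        have hij' : ((e (f i) : ℕ) : ℝ) = ((e (f j) : ℕ) : ℝ) := hij
        exact_mod_cast hij'
      exact f.injective (e.injective (Fin.ext this))
    change (p f).coeff _ = _ at h1
    rw [h0, Polynomial.coeff_zero] at h1
    exact h2 h1.symm
  have hfin : (⋃ f, {ε : ℝ | (p f).IsRoot ε}).Finite :=
    Set.finite_iUnion fun f => Polynomial.finite_setOfPred_isRoot (hpne f)
  obtain ⟨ε, hε, hnot⟩ := (Set.Ioo_infinite hη).exists_notMem_finite hfin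
  refine ⟨ε, hε.1, hε.2, fun f h0 => hnot (Set.mem_iUnion.mpr ⟨f, ?_⟩)⟩
  change (p f).eval ε = 0
  rw [hp, ← Polynomial.coe_evalRingHom, RingHom.map_det]
  rw [← h0]
  congr 1
  ext i j
  simp [hw]
  ring

/-- Forster's sign-rank bound. -/
theorem card_le_sq_of_sign_factorization [DecidableEq X] {v u : X → Fin B → ℝ} {H : X → X → ℝ}
    (habs : ∀ S R, |H S R| = 1)
    (horth : ∀ R R', ∑ S, H S R * H S R' = if R = R' then (Fintype.card X : ℝ) else 0)
    (hpos : ∀ S R, 0 < H S R * (u S ⬝ᵥ v R)) : Fintype.card X ≤ B ^ 2 := by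
  obtain ⟨w, hw⟩ := exists_perturbation_isGenericFamily v
  have hev : ∀ᶠ ε : ℝ in nhds 0, ∀ S R, 0 < H S R * (u S ⬝ᵥ (v R + ε • w R)) := by
    rw [Filter.eventually_all]
    intro S
    rw [Filter.eventually_all]
    intro R
    have hc : Continuous fun ε : ℝ => H S R * (u S ⬝ᵥ (v R + ε • w R)) := by
      simp only [dotProduct_add, dotProduct_smul]
      fun_prop
    have := hc.tendsto 0
    refine this.eventually (lt_mem_nhds ?_)
    simpa using hpos S R
  obtain ⟨η, hη, hball⟩ := Metric.eventually_nhds_iff.mp hev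
  obtain ⟨ε, h0, h1, hgen⟩ := hw η hη
  refine card_le_sq_of_isGenericFamily hgen habs horth (u := u) (fun S R => ?_)
  refine hball ?_ S R
  rw [Real.dist_eq, sub_zero, abs_of_pos h0]
  exact h1

end Forster

/-! ### Counting sign patterns of polynomials -/

section SignPatterns

open Finset

variable {ι σ : Type*} [Fintype σ]

/-- The evaluation of a polynomial of bounded degree as an inner product with monomials. -/
lemma MvPolynomial.eval_eq_sum_bounded_monomials [DecidableEq σ] {D : ℕ} (p : MvPolynomial σ ℝ)
    (hp : p.totalDegree ≤ D) (θ : σ → ℝ) :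
    MvPolynomial.eval θ p = ∑ m : σ → Fin (D + 1),
      p.coeff (Finsupp.equivFunOnFinite.symm fun i => (m i : ℕ)) * ∏ i, θ i ^ (m i : ℕ) := by
  classical
  rw [MvPolynomial.eval_eq']
  set g : (σ → Fin (D + 1)) → (σ →₀ ℕ) :=
    fun m => Finsupp.equivFunOnFinite.symm fun i => (m i : ℕ) with hg
  have hinj : Function.Injective g := by
    intro a b hab
    have := Finsupp.equivFunOnFinite.symm.injective hab
    funext i
    exact Fin.ext (congrFun this i)
  have hsub : p.support ⊆ univ.image g := by
    intro d hd
    have hdeg : ∀ i, d i < D + 1 := fun i => by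
      have h1 : d i ≤ p.totalDegree := by
        refine le_trans ?_ (MvPolynomial.le_totalDegree hd)
        by_cases h : i ∈ d.support
        · exact Finset.single_le_sum (f := fun i => d i) (fun _ _ => Nat.zero_le _) h
        · simp [Finsupp.notMem_support_iff.mp h]
      omega
    refine mem_image.mpr ⟨fun i => ⟨d i, hdeg i⟩, mem_univ _, ?_⟩
    ext i
    simp [hg]
  rw [sum_subset hsub, sum_image hinj.injOn]
  · refine sum_congr rfl fun m _ => ?_
    simp [hg]
  · intro d _ hd
    rw [MvPolynomial.notMem_support_iff.mp hd, zero_mul]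

/-- If all `2 ^ M` sign patterns of `M` polynomials of degree at most `Δ` in `W` variables occur,
then `2 ^ M ≤ (M * Δ + 1) ^ (2 * W)`. -/
theorem two_pow_le_of_shattered [Fintype ι] {Δ : ℕ} (p : ι → MvPolynomial σ ℝ)
    (hp : ∀ i, (p i).totalDegree ≤ Δ)
    (hsh : ∀ S : Finset ι, ∃ θ : σ → ℝ, ∀ i, 0 < MvPolynomial.eval θ (p i) ↔ i ∈ S) :
    2 ^ Fintype.card ι ≤ (Fintype.card ι * Δ + 1) ^ (2 * Fintype.card σ) := by
  classical
  choose θ hθ using hsh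
  obtain ⟨η, hη, hηlt⟩ : ∃ η : ℝ, 0 < η ∧ ∀ S i, i ∈ S → η < MvPolynomial.eval (θ S) (p i) := by
    have hev : ∀ᶠ η : ℝ in nhdsWithin 0 (Set.Ioi 0),
        ∀ S i, i ∈ S → η < MvPolynomial.eval (θ S) (p i) := by
      rw [Filter.eventually_all]; intro S
      rw [Filter.eventually_all]; intro i
      by_cases h : i ∈ S
      · filter_upwards [nhdsWithin_le_nhds (gt_mem_nhds ((hθ S i).mpr h))] with η hη _
        exact hη
      · exact Filter.Eventually.of_forall fun _ h' => absurd h' h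
    obtain ⟨η, h1, h2⟩ := (hev.and self_mem_nhdsWithin).exists
    exact ⟨η, h2, h1⟩
  set D := Fintype.card ι * Δ with hD
  set q : Finset ι → MvPolynomial σ ℝ := fun S => ∏ i ∈ S, (p i - MvPolynomial.C η) with hq
  have hqdeg : ∀ S, (q S).totalDegree ≤ D := by
    intro S
    refine (MvPolynomial.totalDegree_finsetProd _ _).trans ?_
    calc ∑ i ∈ S, (p i - MvPolynomial.C η).totalDegree ≤ ∑ _i ∈ S, Δ := by
          refine sum_le_sum fun i _ => ?_
          refine (MvPolynomial.totalDegree_sub _ _).trans ?_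
          simpa using hp i
      _ = S.card * Δ := by simp
      _ ≤ D := Nat.mul_le_mul_right _ (card_le_univ _)
  set s : ι → Finset ι → ℝ := fun i R => if i ∈ R then 1 else -1 with hs
  set H : Finset ι → Finset ι → ℝ := fun S R => ∏ i ∈ S, s i R with hH
  set e := Fintype.equivFin (σ → Fin (D + 1)) with he
  have hcard : Fintype.card (σ → Fin (D + 1)) = (D + 1) ^ Fintype.card σ := by simp
  have key := card_le_sq_of_sign_factorization (X := Finset ι)
    (v := fun R j => ∏ i, θ R i ^ (e.symm j i : ℕ))
    (u := fun S j => (q S).coeff (Finsupp.equivFunOnFinite.symm fun i => (e.symm j i : ℕ)))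
    (H := H) ?_ ?_ ?_
  · rw [Fintype.card_finset, hcard] at key
    calc 2 ^ Fintype.card ι ≤ _ := key
      _ = _ := by rw [← pow_mul, mul_comm 2]
  · intro S R
    rw [hH]
    simp only [abs_prod]
    refine prod_eq_one fun i _ => ?_
    simp only [hs]
    split_ifs <;> simp
  · intro R R'
    simp only [hH, ← prod_mul_distrib]
    have h1 := prod_one_add (f := fun i => s i R * s i R') (univ : Finset ι)
    rw [powerset_univ] at h1
    rw [← h1]
    by_cases h : R = R'
    · subst h
      rw [if_pos rfl, Fintype.card_finset]
      have : ∀ i, 1 + s i R * s i R = 2 := by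
        intro i; simp only [hs]; split_ifs <;> norm_num
      simp [this]
    · rw [if_neg h]
      obtain ⟨i, hi⟩ : ∃ i, ¬(i ∈ R ↔ i ∈ R') := by
        by_contra hcon
        push Not at hcon
        exact h (Finset.ext hcon)
      refine prod_eq_zero (mem_univ i) ?_
      simp only [hs]
      by_cases h1 : i ∈ R <;> by_cases h2 : i ∈ R' <;> simp_all
  · intro S R
    have h1 : (fun j => (q S).coeff (Finsupp.equivFunOnFinite.symm fun i => (e.symm j i : ℕ)))
        ⬝ᵥ (fun j => ∏ i, θ R i ^ (e.symm j i : ℕ)) = MvPolynomial.eval (θ R) (q S) := by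
      rw [MvPolynomial.eval_eq_sum_bounded_monomials (q S) (hqdeg S)]
      simp only [dotProduct]
      exact e.symm.sum_comp (fun m : σ → Fin (D + 1) =>
        (q S).coeff (Finsupp.equivFunOnFinite.symm fun i => (m i : ℕ)) * ∏ i, θ R i ^ (m i : ℕ))
    rw [h1, hq, hH, map_prod, ← prod_mul_distrib]
    refine prod_pos fun i _ => ?_
    simp only [hs, map_sub, MvPolynomial.eval_C]
    split_ifs with h
    · have := hηlt R i h; linarith
    · have := (not_congr (hθ R i)).mpr h; linarith

lemma sum_choose_le_succ_pow (M v : ℕ) : ∑ k ∈ Iic v, M.choose k ≤ (M + 1) ^ v := by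
  rw [add_pow]
  have : Iic v = range (v + 1) := by ext; simp
  rw [this]
  refine sum_le_sum fun k hk => ?_
  have hk' : k ≤ v := by simpa [Nat.lt_succ_iff] using hk
  calc M.choose k ≤ M ^ k := Nat.choose_le_pow M k
    _ = M ^ k * 1 ^ (v - k) * 1 := by simp
    _ ≤ _ := Nat.mul_le_mul_left _ (Nat.choose_pos hk')

/-- A bound for the number of sign patterns of `M` polynomials of degree at most `Δ` in `W`
variables. -/
def signPatternBound (W Δ M : ℕ) : ℕ := (M + 1) ^ (2 * W * (Nat.log 2 (M * Δ + 1) + 1))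

theorem card_signPatterns_le [Fintype ι] {Δ : ℕ} (p : ι → MvPolynomial σ ℝ)
    (hp : ∀ i, (p i).totalDegree ≤ Δ) (𝒜 : Finset (Finset ι))
    (h𝒜 : ∀ S ∈ 𝒜, ∃ θ : σ → ℝ, ∀ i, 0 < MvPolynomial.eval θ (p i) ↔ i ∈ S) :
    𝒜.card ≤ signPatternBound (Fintype.card σ) Δ (Fintype.card ι) := by
  classical
  have hvc : 𝒜.vcDim ≤ 2 * Fintype.card σ * (Nat.log 2 (Fintype.card ι * Δ + 1) + 1) := by
    refine Finset.sup_le fun S hS => ?_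
    have hS' : 𝒜.Shatters S := mem_shatterer.mp hS
    have h1 := two_pow_le_of_shattered (ι := S) (fun i => p i) (fun i => hp i) (fun R => by
      obtain ⟨u, hu, hSu⟩ := hS' (t := R.map (Function.Embedding.subtype _)) (by
        intro x hx
        obtain ⟨y, _, rfl⟩ := mem_map.mp hx
        exact y.2)
      obtain ⟨θ, hθ⟩ := h𝒜 u hu
      refine ⟨θ, fun i => ?_⟩
      rw [hθ i]
      constructor
      · intro hi
        have : (i : ι) ∈ S ∩ u := mem_inter.mpr ⟨i.2, hi⟩
        rw [hSu] at this
        simpa using this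
      · intro hi
        have : (i : ι) ∈ R.map (Function.Embedding.subtype _) := by simpa using hi
        rw [← hSu] at this
        exact (mem_inter.mp this).2)
    rw [Fintype.card_coe] at h1
    have h2 : S.card * Δ + 1 ≤ Fintype.card ι * Δ + 1 :=
      Nat.succ_le_succ (Nat.mul_le_mul_right _ (card_le_univ _))
    have h3 : Fintype.card ι * Δ + 1 ≤ 2 ^ (Nat.log 2 (Fintype.card ι * Δ + 1) + 1) :=
      (Nat.lt_pow_succ_log_self one_lt_two _).le
    have h4 : 2 ^ S.card
        ≤ 2 ^ ((Nat.log 2 (Fintype.card ι * Δ + 1) + 1) * (2 * Fintype.card σ)) := by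
      rw [pow_mul]
      exact h1.trans (Nat.pow_le_pow_left (h2.trans h3) _)
    have := (Nat.pow_le_pow_iff_right one_lt_two).mp h4
    rwa [mul_comm] at this
  calc 𝒜.card ≤ 𝒜.shatterer.card := card_le_card_shatterer 𝒜
    _ ≤ ∑ k ∈ Iic 𝒜.vcDim, (Fintype.card ι).choose k := card_shatterer_le_sum_vcDim
    _ ≤ (Fintype.card ι + 1) ^ 𝒜.vcDim := sum_choose_le_succ_pow _ _
    _ ≤ _ := Nat.pow_le_pow_right (Nat.succ_pos _) hvc

end SignPatterns

/-! ### Piecewise polynomial dependence on the parameters -/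

section PolyOn

variable {σ γ γ' : Type*}

/-- `g` agrees with a polynomial of degree at most `Δ` on every fibre of `c`. -/
def PolyOn (c : (σ → ℝ) → γ) (Δ : ℕ) (g : (σ → ℝ) → ℝ) : Prop :=
  ∀ θ₀, ∃ p : MvPolynomial σ ℝ, p.totalDegree ≤ Δ ∧ ∀ θ, c θ = c θ₀ → g θ = MvPolynomial.eval θ p

/-- The fibres of `c'` refine those of `c`. -/
def Refines (c' : (σ → ℝ) → γ') (c : (σ → ℝ) → γ) : Prop :=
  ∀ θ θ', c' θ = c' θ' → c θ = c θ'

lemma PolyOn.refine {c : (σ → ℝ) → γ} {c' : (σ → ℝ) → γ'} {Δ : ℕ} {g : (σ → ℝ) → ℝ}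
    (h : PolyOn c Δ g) (hc : Refines c' c) : PolyOn c' Δ g := fun θ₀ => by
  obtain ⟨p, hp, hg⟩ := h θ₀
  exact ⟨p, hp, fun θ hθ => hg θ (hc _ _ hθ)⟩

lemma PolyOn.mono {c : (σ → ℝ) → γ} {Δ Δ' : ℕ} {g : (σ → ℝ) → ℝ}
    (h : PolyOn c Δ g) (hΔ : Δ ≤ Δ') : PolyOn c Δ' g := fun θ₀ => by
  obtain ⟨p, hp, hg⟩ := h θ₀
  exact ⟨p, hp.trans hΔ, hg⟩

lemma polyOn_const (c : (σ → ℝ) → γ) (Δ : ℕ) (r : ℝ) : PolyOn c Δ fun _ => r := fun _ =>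
  ⟨MvPolynomial.C r, by simp, fun _ _ => by simp⟩

lemma polyOn_coord (c : (σ → ℝ) → γ) (i : σ) : PolyOn c 1 fun θ => θ i := fun _ =>
  ⟨MvPolynomial.X i, by simp, fun _ _ => by simp⟩

lemma PolyOn.add {c : (σ → ℝ) → γ} {Δ : ℕ} {g g' : (σ → ℝ) → ℝ} (h : PolyOn c Δ g)
    (h' : PolyOn c Δ g') : PolyOn c Δ fun θ => g θ + g' θ := fun θ₀ => by
  obtain ⟨p, hp, hg⟩ := h θ₀
  obtain ⟨p', hp', hg'⟩ := h' θ₀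
  exact ⟨p + p', (MvPolynomial.totalDegree_add _ _).trans (max_le hp hp'), fun θ hθ => by
    rw [map_add, ← hg θ hθ, ← hg' θ hθ]⟩

lemma PolyOn.sub_const {c : (σ → ℝ) → γ} {Δ : ℕ} {g : (σ → ℝ) → ℝ} (h : PolyOn c Δ g) (r : ℝ) :
    PolyOn c Δ fun θ => g θ - r := by
  simpa only [sub_eq_add_neg] using h.add (polyOn_const c Δ (-r))

lemma PolyOn.mul {c : (σ → ℝ) → γ} {Δ Δ' : ℕ} {g g' : (σ → ℝ) → ℝ} (h : PolyOn c Δ g)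
    (h' : PolyOn c Δ' g') : PolyOn c (Δ + Δ') fun θ => g θ * g' θ := fun θ₀ => by
  obtain ⟨p, hp, hg⟩ := h θ₀
  obtain ⟨p', hp', hg'⟩ := h' θ₀
  exact ⟨p * p', (MvPolynomial.totalDegree_mul _ _).trans (add_le_add hp hp'), fun θ hθ => by
    rw [map_mul, ← hg θ hθ, ← hg' θ hθ]⟩

lemma PolyOn.sum {κ : Type*} {c : (σ → ℝ) → γ} {Δ : ℕ} (s : Finset κ) {g : κ → (σ → ℝ) → ℝ}
    (h : ∀ k ∈ s, PolyOn c Δ (g k)) : PolyOn c Δ fun θ => ∑ k ∈ s, g k θ := by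
  classical
  induction s using Finset.induction_on with
  | empty => simpa using polyOn_const c Δ 0
  | insert a s ha ih =>
    simp only [Finset.sum_insert ha]
    exact (h a (Finset.mem_insert_self _ _)).add
      (ih fun k hk => h k (Finset.mem_insert_of_mem hk))

lemma PolyOn.mulVec {m n : ℕ} {c : (σ → ℝ) → γ} {Δ : ℕ}
    {A : (σ → ℝ) → Matrix (Fin m) (Fin n) ℝ} {x : (σ → ℝ) → Fin n → ℝ}
    (hA : ∀ i j, PolyOn c 1 fun θ => A θ i j) (hx : ∀ j, PolyOn c Δ fun θ => x θ j) (i : Fin m) :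
    PolyOn c (Δ + 1) fun θ => (A θ).mulVec (x θ) i := by
  simp only [Matrix.mulVec, dotProduct]
  refine PolyOn.sum _ fun j _ => ?_
  rw [add_comm]
  exact (hA i j).mul (hx j)

variable [Fintype σ]

/-- The cells can be refined so that the signs of finitely many piecewise polynomials are
constant on the cells. -/
lemma exists_refines_sign {ι : Type*} [Fintype ι] {n Δ : ℕ} (c : (σ → ℝ) → Fin n)
    (g : ι → (σ → ℝ) → ℝ) (hg : ∀ i, PolyOn c Δ (g i)) :
    ∃ c' : (σ → ℝ) → Fin (n * signPatternBound (Fintype.card σ) Δ (Fintype.card ι)),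
      Refines c' c ∧ ∀ i θ θ', c' θ = c' θ' → (0 < g i θ ↔ 0 < g i θ') := by
  classical
  set S := signPatternBound (Fintype.card σ) Δ (Fintype.card ι)
  set pat : (σ → ℝ) → Finset ι := fun θ => Finset.univ.filter fun i => 0 < g i θ with hpat
  set 𝒜 : Fin n → Finset (Finset ι) := fun k =>
    Finset.univ.filter fun R => ∃ θ, c θ = k ∧ pat θ = R with h𝒜
  have hcard : ∀ k, (𝒜 k).card ≤ S := by
    intro k
    by_cases hk : ∃ θ₀, c θ₀ = k
    · obtain ⟨θ₀, rfl⟩ := hk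
      choose p hp hgp using fun i => hg i θ₀
      refine card_signPatterns_le p hp _ fun R hR => ?_
      obtain ⟨θ, hθ, hR⟩ := (Finset.mem_filter.mp hR).2
      refine ⟨θ, fun i => ?_⟩
      rw [← hgp i θ hθ, ← hR]
      simp [hpat]
    · have : 𝒜 k = ∅ := by
        refine Finset.eq_empty_of_forall_notMem fun R hR => hk ?_
        obtain ⟨θ, hθ, _⟩ := (Finset.mem_filter.mp hR).2
        exact ⟨θ, hθ⟩
      rw [this]; simp
  have hemb : ∀ k, Nonempty (𝒜 k ↪ Fin S) := fun k =>
    Function.Embedding.nonempty_of_card_le (by simpa using hcard k)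
  have hmem : ∀ θ, pat θ ∈ 𝒜 (c θ) := fun θ =>
    Finset.mem_filter.mpr ⟨Finset.mem_univ _, θ, rfl, rfl⟩
  set e := fun k => (hemb k).some with he
  refine ⟨fun θ => finProdFinEquiv (c θ, e (c θ) ⟨pat θ, hmem θ⟩), ?_, ?_⟩
  · intro θ θ' h
    exact congrArg Prod.fst (finProdFinEquiv.injective h)
  · intro i θ θ' h
    have h1 := finProdFinEquiv.injective h
    have h2 : c θ = c θ' := congrArg Prod.fst h1
    have h3 : e (c θ) ⟨pat θ, hmem θ⟩ = e (c θ') ⟨pat θ', hmem θ'⟩ := congrArg Prod.snd h1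
    have h4 : ∀ k (hk : c θ' = k) (hm : pat θ' ∈ 𝒜 k),
        e (c θ') ⟨pat θ', hmem θ'⟩ = e k ⟨pat θ', hm⟩ := by
      rintro k rfl _; rfl
    rw [h4 (c θ) h2.symm (h2 ▸ hmem θ')] at h3
    have h5 : pat θ = pat θ' := congrArg Subtype.val ((e (c θ)).injective h3)
    have h6 := Finset.ext_iff.mp h5 i
    simpa [hpat] using h6

lemma exists_refines_relu {ι : Type*} [Fintype ι] {n Δ : ℕ} (c : (σ → ℝ) → Fin n)
    (g : ι → (σ → ℝ) → ℝ) (hg : ∀ i, PolyOn c Δ (g i)) :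
    ∃ c' : (σ → ℝ) → Fin (n * signPatternBound (Fintype.card σ) Δ (Fintype.card ι)),
      Refines c' c ∧ ∀ i, PolyOn c' Δ fun θ => relu (g i θ) := by
  obtain ⟨c', hc', hs⟩ := exists_refines_sign c g hg
  refine ⟨c', hc', fun i θ₀ => ?_⟩
  by_cases h : 0 < g i θ₀
  · obtain ⟨p, hp, hgp⟩ := hg i θ₀
    refine ⟨p, hp, fun θ hθ => ?_⟩
    rw [← hgp θ (hc' _ _ hθ)]
    exact max_eq_left ((hs i θ θ₀ hθ).mpr h).le
  · refine ⟨0, by simp, fun θ hθ => ?_⟩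
    rw [map_zero]
    exact max_eq_right (not_lt.mp ((not_congr (hs i θ θ₀ hθ)).mpr h))

end PolyOn

lemma signPatternBound_mono (W : ℕ) {Δ Δ' M M' : ℕ} (hΔ : Δ ≤ Δ') (hM : M ≤ M') :
    signPatternBound W Δ M ≤ signPatternBound W Δ' M' := by
  unfold signPatternBound
  calc (M + 1) ^ (2 * W * (Nat.log 2 (M * Δ + 1) + 1))
      ≤ (M' + 1) ^ (2 * W * (Nat.log 2 (M * Δ + 1) + 1)) := Nat.pow_le_pow_left (by omega) _
    _ ≤ _ := Nat.pow_le_pow_right (by omega) (Nat.mul_le_mul_left _ (Nat.succ_le_succ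
        (Nat.log_mono_right (Nat.succ_le_succ (Nat.mul_le_mul hM hΔ)))))

lemma exists_refines_castLE {σ : Type*} {n n' : ℕ} (h : n ≤ n') (c : (σ → ℝ) → Fin n) :
    Refines (fun θ => Fin.castLE h (c θ)) c := fun _ _ hθ => Fin.castLE_injective h hθ

/-! ### Cells for deep ParaRNNs -/

section Cells

variable {σ : Type*} [Fintype σ] {d m T D n : ℕ}

/-- The parameters of a recurrent layer depend polynomially, with degree one, on `θ`. -/
structure IsLinearLayer (ℓ : (σ → ℝ) → RecLayer d) : Prop where
  Wh : ∀ {n : ℕ} (c : (σ → ℝ) → Fin n) i j, PolyOn c 1 fun θ => (ℓ θ).Wh i j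
  Wx : ∀ {n : ℕ} (c : (σ → ℝ) → Fin n) i j, PolyOn c 1 fun θ => (ℓ θ).Wx i j
  b : ∀ {n : ℕ} (c : (σ → ℝ) → Fin n) i, PolyOn c 1 fun θ => (ℓ θ).b i
  h0 : ∀ {n : ℕ} (c : (σ → ℝ) → Fin n) i, PolyOn c 1 fun θ => (ℓ θ).h0 i

lemma exists_cells_state {ℓ : (σ → ℝ) → RecLayer d} (hℓ : IsLinearLayer ℓ)
    (u : Fin m → (σ → ℝ) → ℕ → Fin d → ℝ) {Δ : ℕ} (hΔ : 1 ≤ Δ) (hD : Δ + T ≤ D)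
    (c : (σ → ℝ) → Fin n) (hu : ∀ a, ∀ t < T, ∀ i, PolyOn c Δ fun θ => u a θ t i) :
    ∀ s ≤ T, ∃ c' : (σ → ℝ) → Fin (n * signPatternBound (Fintype.card σ) D (m * d) ^ s),
      Refines c' c ∧ ∀ a, ∀ t ≤ s, ∀ i, PolyOn c' (Δ + s) fun θ => (ℓ θ).state (u a θ) t i := by
  intro s
  induction s with
  | zero =>
    intro _
    have e : n = n * signPatternBound (Fintype.card σ) D (m * d) ^ 0 := by simp
    refine ⟨fun θ => Fin.castLE e.le (c θ), exists_refines_castLE _ c, fun a t ht i => ?_⟩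
    obtain rfl : t = 0 := by omega
    exact ((hℓ.h0 c i).mono hΔ).refine (exists_refines_castLE _ c)
  | succ s ih =>
    intro hs
    obtain ⟨c', hc', hst⟩ := ih (by omega)
    have hpre : ∀ p : Fin m × Fin d, PolyOn c' (Δ + s + 1) fun θ =>
        (ℓ θ).Wh.mulVec ((ℓ θ).state (u p.1 θ) s) p.2 + (ℓ θ).Wx.mulVec (u p.1 θ s) p.2
          + (ℓ θ).b p.2 := by
      intro p
      refine PolyOn.add (PolyOn.add ?_ ?_) ?_
      · exact PolyOn.mulVec (hℓ.Wh c') (fun j => hst p.1 s le_rfl j) p.2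
      · exact PolyOn.mulVec (hℓ.Wx c')
          (fun j => ((hu p.1 s (by omega) j).refine hc').mono (Nat.le_add_right _ _)) p.2
      · exact (hℓ.b c' p.2).mono (by omega)
    obtain ⟨c'', hc'', hrelu⟩ := exists_refines_relu c' _ hpre
    have hle : n * signPatternBound (Fintype.card σ) D (m * d) ^ s
        * signPatternBound (Fintype.card σ) (Δ + s + 1) (Fintype.card (Fin m × Fin d))
        ≤ n * signPatternBound (Fintype.card σ) D (m * d) ^ (s + 1) := by
      rw [pow_succ, ← mul_assoc]
      refine Nat.mul_le_mul_left _ (signPatternBound_mono _ (by omega) (by simp))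
    have hr := exists_refines_castLE hle c''
    refine ⟨_, fun θ θ' h => hc' _ _ (hc'' _ _ (hr _ _ h)), fun a t ht i => ?_⟩
    rcases Nat.lt_or_ge s t with h | h
    · obtain rfl : t = s + 1 := by omega
      exact (hrelu (a, i)).refine hr
    · exact (((hst a t h i).mono (by omega)).refine hc'').refine hr

lemma exists_cells_applyLayers (T : ℕ) :
    ∀ (L : ℕ) (ℓ : Fin L → (σ → ℝ) → RecLayer d) (_ : ∀ l, IsLinearLayer (ℓ l))
    {n : ℕ} (u : Fin m → (σ → ℝ) → ℕ → Fin d → ℝ) {Δ : ℕ} (_ : 1 ≤ Δ) (_ : Δ + L * T ≤ D)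
    (c : (σ → ℝ) → Fin n) (_ : ∀ a, ∀ t < T, ∀ i, PolyOn c Δ fun θ => u a θ t i),
    ∃ c' : (σ → ℝ) → Fin (n * signPatternBound (Fintype.card σ) D (m * d) ^ (L * T)),
      ∀ a, ∀ t < T, ∀ i, PolyOn c' (Δ + L * T) fun θ =>
        applyLayers (List.ofFn fun l => ℓ l θ) (u a θ) t i := by
  intro L
  induction L with
  | zero =>
    intro ℓ _ n u Δ _ _ c hu
    have e : n = n * signPatternBound (Fintype.card σ) D (m * d) ^ (0 * T) := by simp
    refine ⟨fun θ => Fin.castLE e.le (c θ), fun a t ht i => ?_⟩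
    simpa [applyLayers] using (hu a t ht i).refine (exists_refines_castLE e.le c)
  | succ L ih =>
    intro ℓ hℓ n u Δ hΔ hD c hu
    have hLT : (L + 1) * T = L * T + T := by ring
    rw [hLT] at hD
    obtain ⟨c₁, hc₁, h₁⟩ := exists_cells_state (hℓ 0) u hΔ (D := D) (by omega) c hu T le_rfl
    obtain ⟨c₂, h₂⟩ := ih (fun l => ℓ l.succ) (fun l => hℓ l.succ)
      (fun a θ => (ℓ 0 θ).out (u a θ)) (Δ := Δ + T) (by omega) (by omega) c₁
      (fun a t ht i => h₁ a (t + 1) ht i)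
    have e : n * signPatternBound (Fintype.card σ) D (m * d) ^ T
        * signPatternBound (Fintype.card σ) D (m * d) ^ (L * T)
        = n * signPatternBound (Fintype.card σ) D (m * d) ^ ((L + 1) * T) := by
      rw [mul_assoc, ← pow_add, hLT, add_comm T]
    refine ⟨fun θ => Fin.castLE e.le (c₂ θ), fun a t ht i => ?_⟩
    have h3 := (h₂ a t ht i).refine (exists_refines_castLE e.le c₂)
    have h4 : Δ + T + L * T = Δ + (L + 1) * T := by rw [hLT]; ring
    rw [h4] at h3
    simpa [applyLayers, List.ofFn_succ] using h3

end Cells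

/-! ### The parameters of a ParaRNN with scalar output -/

/-- Indices of the parameters of a recurrent layer. -/
abbrev LayerIdx (d : ℕ) : Type := (Fin d × Fin d) ⊕ (Fin d × Fin d) ⊕ Fin d ⊕ Fin d

/-- Indices of the parameters of a ParaRNN with scalar output. -/
abbrev NetIdx (din d L : ℕ) : Type :=
  (Fin d × Fin din) ⊕ (Fin L × LayerIdx d) ⊕ (Fin d × Fin d) ⊕ Fin d ⊕ Fin d

section Params

variable {din d ds L T : ℕ}

/-- The recurrent layer with given parameters. -/
def layerOfParams (θ : LayerIdx d → ℝ) : RecLayer d where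
  Wh := fun i j => θ (.inl (i, j))
  Wx := fun i j => θ (.inr (.inl (i, j)))
  b := fun i => θ (.inr (.inr (.inl i)))
  h0 := fun i => θ (.inr (.inr (.inr i)))

/-- The parameters of a recurrent layer. -/
def RecLayer.params (ℓ : RecLayer d) : LayerIdx d → ℝ
  | .inl p => ℓ.Wh p.1 p.2
  | .inr (.inl p) => ℓ.Wx p.1 p.2
  | .inr (.inr (.inl i)) => ℓ.b i
  | .inr (.inr (.inr i)) => ℓ.h0 i

/-- The parameters of a ParaRNN with scalar output. -/
def ParaNet.params (net : ParaNet din 1 d ds L) : NetIdx din d L → ℝ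
  | .inl p => net.P p.1 p.2
  | .inr (.inl p) => (net.layer p.1).params p.2
  | .inr (.inr (.inl p)) => net.Wf p.1 p.2
  | .inr (.inr (.inr (.inl i))) => net.bf i
  | .inr (.inr (.inr (.inr i))) => net.Q 0 i

/-- The input to the last ReLU, as a function of the parameters and the input. -/
noncomputable def paramHidden (θ : NetIdx din d L → ℝ) (X : ℕ → Fin din → ℝ) (t : ℕ) (i : Fin d) :
    ℝ :=
  ((Matrix.of fun i j => θ (.inr (.inr (.inl (i, j))))).mulVec
    (applyLayers (List.ofFn fun l : Fin L => layerOfParams fun k => θ (.inr (.inl (l, k))))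
      (fun s => (Matrix.of fun i j => θ (.inl (i, j))).mulVec (X s)) t)) i
    + θ (.inr (.inr (.inr (.inl i))))

/-- The scalar output, as a function of the parameters and the input. -/
noncomputable def paramForward (θ : NetIdx din d L → ℝ) (X : ℕ → Fin din → ℝ) (t : ℕ) : ℝ :=
  ∑ i, θ (.inr (.inr (.inr (.inr i)))) * relu (paramHidden θ X t i)

lemma ParaNet.forward_eq_paramForward (net : ParaNet din 1 d ds L) (X : ℕ → Fin din → ℝ) (t : ℕ) :
    net.forward X t 0 = paramForward net.params X t := rfl

lemma card_netIdx : Fintype.card (NetIdx din d L)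
    = d * din + (L * (d * d + (d * d + (d + d))) + (d * d + (d + d))) := by
  simp

lemma isLinearLayer_layerOfParams {σ : Type*} (g : LayerIdx d → σ) :
    IsLinearLayer fun θ : σ → ℝ => layerOfParams fun k => θ (g k) where
  Wh c _ _ := polyOn_coord c _
  Wx c _ _ := polyOn_coord c _
  b c _ := polyOn_coord c _
  h0 c _ := polyOn_coord c _

/-- The number of cells of the parameter space on which the outputs of a ParaRNN at `m` inputs lie
on a given side of each of `r` thresholds. -/
def netCellBound (W D d L T m r : ℕ) : ℕ :=
  signPatternBound W D (m * d) ^ (L * T + 1) * signPatternBound W D (m * r)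

theorem exists_cells_net (hT : 0 < T) {m r : ℕ} (X : Fin m → ℕ → Fin din → ℝ) (τ : Fin r → ℝ) :
    ∃ c : (NetIdx din d L → ℝ) →
        Fin (netCellBound (Fintype.card (NetIdx din d L)) (L * T + 3) d L T m r),
      ∀ θ θ', c θ = c θ' → ∀ a j,
        (τ j < paramForward θ (X a) (T - 1) ↔ τ j < paramForward θ' (X a) (T - 1)) := by
  set D := L * T + 3 with hD
  obtain ⟨c₁, h₁⟩ := exists_cells_applyLayers (σ := NetIdx din d L) (m := m) (D := D) T L
    (fun l θ => layerOfParams fun k => θ (.inr (.inl (l, k))))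
    (fun l => isLinearLayer_layerOfParams _)
    (n := 1) (fun a θ s => (Matrix.of fun i j => θ (.inl (i, j))).mulVec (X a s))
    (Δ := 1) le_rfl (by omega) (fun _ => 0) (fun a t _ i =>
      PolyOn.mulVec (Δ := 0) (A := fun θ : NetIdx din d L → ℝ => Matrix.of fun i j => θ (.inl (i, j)))
        (x := fun _ => X a t) (fun i j => polyOn_coord _ _) (fun j => polyOn_const _ _ _) i)
  obtain ⟨c₂, hc₂, h₂⟩ := exists_refines_relu c₁ (ι := Fin m × Fin d) (Δ := L * T + 2)
    (fun p θ => paramHidden θ (X p.1) (T - 1) p.2) (fun p => by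
      refine PolyOn.add ?_ ((polyOn_coord _ _).mono (by omega))
      have := PolyOn.mulVec (A := fun θ : NetIdx din d L → ℝ =>
        Matrix.of fun i j => θ (.inr (.inr (.inl (i, j))))) (fun i j => polyOn_coord _ _)
        (fun j => h₁ p.1 (T - 1) (by omega) j) p.2
      exact this.mono (by omega))
  obtain ⟨c₃, -, h₃⟩ := exists_refines_sign c₂ (ι := Fin m × Fin r) (Δ := D)
    (fun p θ => paramForward θ (X p.1) (T - 1) - τ p.2) (fun p => by
      refine PolyOn.sub_const (PolyOn.sum _ fun i _ => ?_) _
      exact ((polyOn_coord _ _).mul (h₂ (p.1, i))).mono (by omega))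
  have hle : 1 * signPatternBound (Fintype.card (NetIdx din d L)) D (m * d) ^ (L * T)
      * signPatternBound (Fintype.card (NetIdx din d L)) (L * T + 2) (Fintype.card (Fin m × Fin d))
      * signPatternBound (Fintype.card (NetIdx din d L)) D (Fintype.card (Fin m × Fin r))
      ≤ netCellBound (Fintype.card (NetIdx din d L)) D d L T m r := by
    rw [netCellBound, pow_succ, one_mul, Fintype.card_prod, Fintype.card_prod]
    simp only [Fintype.card_fin]
    exact Nat.mul_le_mul_right _ (Nat.mul_le_mul_left _
      (signPatternBound_mono _ (by omega) le_rfl))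
  refine ⟨fun θ => Fin.castLE hle (c₃ θ), fun θ θ' h a j => ?_⟩
  have := h₃ (a, j) θ θ' (Fin.castLE_injective hle h)
  simpa [sub_pos] using this

/-! ### Continuity -/

variable {Ω : Type*} [TopologicalSpace Ω]

lemma continuous_relu : Continuous relu := continuous_id.max continuous_const

lemma continuous_mulVec_apply {m n : ℕ} {A : Ω → Matrix (Fin m) (Fin n) ℝ} {x : Ω → Fin n → ℝ}
    {i : Fin m} (hA : ∀ j, Continuous fun ω => A ω i j) (hx : ∀ j, Continuous fun ω => x ω j) :
    Continuous fun ω => (A ω).mulVec (x ω) i := by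
  simp only [Matrix.mulVec, dotProduct]
  fun_prop

lemma continuous_state {ℓ : Ω → RecLayer d} (hℓ : Continuous fun ω => (ℓ ω).params)
    {u : Ω → ℕ → Fin d → ℝ} (hu : ∀ t i, Continuous fun ω => u ω t i) (t : ℕ) (i : Fin d) :
    Continuous fun ω => (ℓ ω).state (u ω) t i := by
  have hc : ∀ k, Continuous fun ω => (ℓ ω).params k := fun k => (continuous_apply k).comp hℓ
  induction t generalizing i with
  | zero => exact hc (.inr (.inr (.inr i)))
  | succ t ih =>
    exact continuous_relu.comp (Continuous.add (Continuous.add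
      (continuous_mulVec_apply (fun j => hc (.inl (i, j))) ih)
      (continuous_mulVec_apply (fun j => hc (.inr (.inl (i, j)))) (hu t)))
      (hc (.inr (.inr (.inl i)))))

lemma continuous_applyLayers : ∀ (L : ℕ) (ℓ : Fin L → Ω → RecLayer d)
    (_ : ∀ l, Continuous fun ω => (ℓ l ω).params) (u : Ω → ℕ → Fin d → ℝ)
    (_ : ∀ t i, Continuous fun ω => u ω t i) (t : ℕ) (i : Fin d),
    Continuous fun ω => applyLayers (List.ofFn fun l => ℓ l ω) (u ω) t i
  | 0, ℓ, _, u, hu, t, i => by simpa [applyLayers] using hu t i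
  | L + 1, ℓ, hℓ, u, hu, t, i => by
    have := continuous_applyLayers L (fun l => ℓ l.succ) (fun l => hℓ l.succ)
      (fun ω => (ℓ 0 ω).out (u ω)) (fun t i => continuous_state (hℓ 0) hu (t + 1) i) t i
    simpa [applyLayers, List.ofFn_succ] using this

lemma continuous_paramForward {θ : Ω → NetIdx din d L → ℝ} (hθ : Continuous θ)
    {X : Ω → ℕ → Fin din → ℝ} (hX : ∀ t i, Continuous fun ω => X ω t i) (t : ℕ) :
    Continuous fun ω => paramForward (θ ω) (X ω) t := by
  have hc : ∀ k, Continuous fun ω => θ ω k := fun k => (continuous_apply k).comp hθ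
  refine continuous_finsetSum _ fun i _ => (hc _).mul (continuous_relu.comp
    (Continuous.add (continuous_mulVec_apply
    (A := fun ω => Matrix.of fun i j => θ ω (.inr (.inr (.inl (i, j))))) (fun j => hc _)
    fun j => ?_) (hc _)))
  refine continuous_applyLayers L _ (fun l => ?_) _ (fun t i => ?_) t j
  · refine continuous_pi fun k => ?_
    rcases k with p | p | i | i <;> exact hc _
  · exact continuous_mulVec_apply (A := fun ω => Matrix.of fun i j => θ ω (.inl (i, j)))
      (fun j => hc _) (hX t)

lemma continuous_extendInput (t : ℕ) (i : Fin din) :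
    Continuous fun X : Fin T → Fin din → ℝ => extendInput X t i := by
  unfold extendInput
  split_ifs with h
  · exact (continuous_apply i).comp (continuous_apply _)
  · exact continuous_const

end Params

/-! ### Rademacher averages over classes with finite empirical covers -/

/-- The sign encoded by a Boolean. -/
def boolSign (b : Bool) : ℝ := if b then 1 else -1

section Rademacher

variable {N : ℕ}

lemma sum_exp_boolSign_mul_le (a : Fin N → ℝ) :
    ∑ ε : Fin N → Bool, Real.exp (∑ i, boolSign (ε i) * a i)
      ≤ 2 ^ N * Real.exp (∑ i, a i ^ 2 / 2) := by
  have h1 : ∑ ε : Fin N → Bool, Real.exp (∑ i, boolSign (ε i) * a i)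
      = ∏ i, ∑ b : Bool, Real.exp (boolSign b * a i) := by
    rw [Fintype.prod_sum]
    simp [Real.exp_sum]
  rw [h1, Real.exp_sum]
  have h2 : (2 : ℝ) ^ N = ∏ _i : Fin N, 2 := by simp
  rw [h2, ← Finset.prod_mul_distrib]
  refine Finset.prod_le_prod (fun i _ => by positivity) fun i _ => ?_
  have := Real.cosh_le_exp_half_sq (a i)
  rw [Real.cosh_eq] at this
  simp [boolSign]
  linarith

/-- A penalised Rademacher average over a class with a finite cover in the supremum distance. -/
theorem exists_bound_rademacher {ι : Type*} [Nonempty ι] {n : ℕ} (c : ι → Fin n) {K r : ℝ}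
    (hK : 0 < K) (a b : ι → Fin N → ℝ) (hab : ∀ k i, a k i ^ 2 ≤ 2 * K ^ 2 * b k i)
    (hr : ∀ k l, c k = c l → ∀ i, |a k i - a l i| + |b k i - b l i| / 2 ≤ r) :
    ∃ Y : (Fin N → Bool) → ℝ,
      (∀ ε k, ∑ i, (boolSign (ε i) * a k i - b k i / 2) ≤ Y ε) ∧
      ∑ ε, Y ε ≤ 2 ^ N * (2 * K ^ 2 * Real.log n + N * r) := by
  classical
  have hn : 0 < n := (Fin.pos (c (Classical.arbitrary ι)))
  have hnR : (0 : ℝ) < n := by exact_mod_cast hn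
  set x : ι → (Fin N → Bool) → ℝ := fun k ε => ∑ i, (boolSign (ε i) * a k i - b k i / 2) with hx
  set p : Fin n → ι := fun j => if h : ∃ k, c k = j then h.choose else Classical.arbitrary ι with hp
  have hcp : ∀ k, c (p (c k)) = c k := fun k => by
    have h : ∃ l, c l = c k := ⟨k, rfl⟩
    simp only [hp, dif_pos h]
    exact h.choose_spec
  set lam : ℝ := 1 / (2 * K ^ 2) with hlam
  have hlam0 : 0 < lam := by positivity
  have hlamK : lam * (2 * K ^ 2) = 1 := by rw [hlam]; field_simp
  have hexp : ∀ k, ∑ ε, Real.exp (lam * x k ε) ≤ 2 ^ N := fun k => by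
    have h1 : ∀ ε, Real.exp (lam * x k ε)
        = Real.exp (∑ i, boolSign (ε i) * (lam * a k i)) * Real.exp (-(∑ i, lam * b k i / 2)) := by
      intro ε
      rw [← Real.exp_add]
      congr 1
      simp only [hx, Finset.mul_sum, ← Finset.sum_neg_distrib, ← Finset.sum_add_distrib]
      exact Finset.sum_congr rfl fun i _ => by ring
    simp_rw [h1, ← Finset.sum_mul]
    calc _ ≤ 2 ^ N * Real.exp (∑ i, (lam * a k i) ^ 2 / 2) * Real.exp (-(∑ i, lam * b k i / 2)) :=
          mul_le_mul_of_nonneg_right (sum_exp_boolSign_mul_le _) (Real.exp_pos _).le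
      _ = 2 ^ N * Real.exp (∑ i, ((lam * a k i) ^ 2 / 2 - lam * b k i / 2)) := by
          rw [mul_assoc, ← Real.exp_add, Finset.sum_sub_distrib]; rfl
      _ ≤ 2 ^ N * 1 := by
          refine mul_le_mul_of_nonneg_left (Real.exp_le_one_iff.2 ?_) (by positivity)
          refine Finset.sum_nonpos fun i _ => ?_
          have := mul_le_mul_of_nonneg_left (hab k i) (sq_nonneg lam)
          have h2 : lam ^ 2 * (2 * K ^ 2 * b k i) = lam * b k i * (lam * (2 * K ^ 2)) := by ring
          rw [h2, hlamK] at this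
          nlinarith
      _ = _ := mul_one _
  refine ⟨fun ε => (Real.log n + (∑ j, Real.exp (lam * x (p j) ε)) / n - 1) / lam + N * r,
    fun ε k => ?_, ?_⟩
  · have h1 : x k ε ≤ x (p (c k)) ε + N * r := by
      rw [← sub_le_iff_le_add']
      calc x k ε - x (p (c k)) ε
          = ∑ i, (boolSign (ε i) * (a k i - a (p (c k)) i) - (b k i - b (p (c k)) i) / 2) := by
            simp only [hx, ← Finset.sum_sub_distrib]
            exact Finset.sum_congr rfl fun i _ => by ring
        _ ≤ ∑ _i : Fin N, r := by
            refine Finset.sum_le_sum fun i _ => le_trans ?_ (hr k (p (c k)) (hcp k).symm i)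
            have h3 := abs_le.1 (le_refl |a k i - a (p (c k)) i|)
            have h4 := abs_le.1 (le_refl |b k i - b (p (c k)) i|)
            have h5 : boolSign (ε i) * (a k i - a (p (c k)) i) ≤ |a k i - a (p (c k)) i| := by
              unfold boolSign; split_ifs <;> linarith
            linarith
        _ = N * r := by simp
    refine h1.trans (add_le_add_left ?_ _)
    rw [le_div_iff₀ hlam0]
    have h6 := Real.add_one_le_exp (x (p (c k)) ε * lam - Real.log n)
    rw [Real.exp_sub, Real.exp_log hnR, mul_comm (x _ _)] at h6
    have h7 : Real.exp (lam * x (p (c k)) ε) / n ≤ (∑ j, Real.exp (lam * x (p j) ε)) / n :=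
      div_le_div_of_nonneg_right (Finset.single_le_sum
        (f := fun j => Real.exp (lam * x (p j) ε)) (fun j _ => (Real.exp_pos _).le)
        (Finset.mem_univ (c k))) hnR.le
    rw [mul_comm]
    linarith
  · have h1 : ∑ ε : Fin N → Bool, (∑ j, Real.exp (lam * x (p j) ε)) ≤ n * 2 ^ N := by
      rw [Finset.sum_comm]
      calc _ ≤ ∑ _j : Fin n, (2 : ℝ) ^ N := Finset.sum_le_sum fun j _ => hexp (p j)
        _ = _ := by simp
    have h2 : (∑ ε : Fin N → Bool, (∑ j, Real.exp (lam * x (p j) ε))) / n ≤ 2 ^ N := by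
      rw [div_le_iff₀ hnR]; linarith
    have hcard : (Finset.univ : Finset (Fin N → Bool)).card = 2 ^ N := by simp
    rw [Finset.sum_add_distrib, ← Finset.sum_div, Finset.sum_sub_distrib, Finset.sum_add_distrib,
      ← Finset.sum_div]
    simp only [Finset.sum_const, hcard, nsmul_eq_mul, Nat.cast_pow, Nat.cast_ofNat, mul_one]
    have h3 : (2 ^ N * Real.log n + (∑ ε : Fin N → Bool, ∑ j, Real.exp (lam * x (p j) ε)) / n
        - 2 ^ N) / lam ≤ 2 ^ N * (2 * K ^ 2 * Real.log n) := by
      rw [div_le_iff₀ hlam0]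
      have : 2 ^ N * (2 * K ^ 2 * Real.log n) * lam
        = 2 ^ N * Real.log n * (lam * (2 * K ^ 2)) := by ring
      rw [this, hlamK]
      linarith
    linarith

end Rademacher

section Symmetrization

variable {N : ℕ} {Z ι : Type*} [MeasurableSpace Z] [Fintype ι] [Nonempty ι]

lemma measurable_sup'_univ {S : Type*} [MeasurableSpace S] {F : ι → S → ℝ}
    (hF : ∀ k, Measurable (F k)) :
    Measurable fun s => Finset.univ.sup' Finset.univ_nonempty fun k => F k s := by
  have := Finset.measurable_sup' (s := Finset.univ) Finset.univ_nonempty (f := F)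
    fun k _ => hF k
  convert this using 1
  ext s
  rw [Finset.sup'_apply]

lemma abs_sup'_univ_le {x : ι → ℝ} {C : ℝ} (h : ∀ k, |x k| ≤ C) :
    |Finset.univ.sup' Finset.univ_nonempty x| ≤ C := by
  refine abs_le.2 ⟨?_, Finset.sup'_le _ _ fun k _ => (abs_le.1 (h k)).2⟩
  exact (abs_le.1 (h (Classical.arbitrary ι))).1.trans
    (Finset.le_sup' x (Finset.mem_univ _))

lemma integrable_of_abs_le {S : Type*} [MeasurableSpace S] {P : Measure S} [IsFiniteMeasure P]
    {f : S → ℝ} (hf : Measurable f) {C : ℝ} (hC : ∀ s, |f s| ≤ C) : Integrable f P :=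
  Integrable.of_bound hf.aestronglyMeasurable C (Filter.Eventually.of_forall hC)

lemma integrable_sup'_univ {S : Type*} [MeasurableSpace S] {P : Measure S} [IsFiniteMeasure P]
    {F : ι → S → ℝ} (hF : ∀ k, Measurable (F k)) {C : ℝ} (hC : ∀ k s, |F k s| ≤ C) :
    Integrable (fun s => Finset.univ.sup' Finset.univ_nonempty fun k => F k s) P :=
  integrable_of_abs_le (measurable_sup'_univ hF) fun s => abs_sup'_univ_le fun k => hC k s

lemma integral_offset {S : Type*} [MeasurableSpace S] {P : Measure S} [IsProbabilityMeasure P]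
    {f g : S → ℝ} (hf : Integrable f P) (hg : Integrable g P) (a b : ℝ) :
    ∫ s, (f s - a - (b + g s) / 2) ∂P = (∫ s, f s ∂P) - a - (b + ∫ s, g s ∂P) / 2 := by
  have h : ∀ s, f s - a - (b + g s) / 2 = (f s - 2⁻¹ * g s) + (-a - b / 2) := fun s => by ring
  simp_rw [h]
  rw [integral_add (f := fun s => f s - 2⁻¹ * g s) (hf.sub (hg.const_mul _)) (integrable_const _),
    integral_sub hf (hg.const_mul _), integral_const_mul]
  simp
  ring

/-- Symmetrization for a finite class with a quadratic offset. -/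
theorem integral_sup_le_of_sign_average (μ : Measure Z) [IsProbabilityMeasure μ] {h q : ι → Z → ℝ}
    (hh : ∀ k, Measurable (h k)) (hq : ∀ k, Measurable (q k)) {A M : ℝ}
    (hhA : ∀ k z, |h k z| ≤ A) (hqA : ∀ k z, |q k z| ≤ A)
    (hM : ∀ w : Fin N → Z × Z, ∑ ε : Fin N → Bool, (Finset.univ.sup' Finset.univ_nonempty fun k =>
      ∑ i, (boolSign (ε i) * (h k (w i).2 - h k (w i).1) - (q k (w i).1 + q k (w i).2) / 2))
      ≤ 2 ^ N * M) :
    ∫ s, (Finset.univ.sup' Finset.univ_nonempty fun k =>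
      ∑ i, ((∫ z, h k z ∂μ) - h k (s i) - (q k (s i) + ∫ z, q k z ∂μ) / 2))
        ∂(Measure.pi fun _ : Fin N => μ) ≤ M := by
  set P := Measure.pi fun _ : Fin N => μ with hP
  set F : ι → (Fin N → Z) × (Fin N → Z) → ℝ := fun k p =>
    ∑ i, (h k (p.2 i) - h k (p.1 i) - (q k (p.1 i) + q k (p.2 i)) / 2) with hF
  have hFm : ∀ k, Measurable (F k) := fun k => by
    refine Finset.measurable_sum _ fun i _ => ?_
    have h1 : Measurable fun p : (Fin N → Z) × (Fin N → Z) => p.1 i :=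
      (measurable_pi_apply i).comp measurable_fst
    have h2 : Measurable fun p : (Fin N → Z) × (Fin N → Z) => p.2 i :=
      (measurable_pi_apply i).comp measurable_snd
    exact (((hh k).comp h2).sub ((hh k).comp h1)).sub
      ((((hq k).comp h1).add ((hq k).comp h2)).div_const 2)
  have hFb : ∀ k p, |F k p| ≤ N * (3 * A) := fun k p => by
    refine (Finset.abs_sum_le_sum_abs _ _).trans ((Finset.sum_le_sum (g := fun _ => 3 * A)
      fun i _ => ?_).trans (by simp))
    have h1 := abs_le.1 (hhA k (p.1 i))
    have h2 := abs_le.1 (hhA k (p.2 i))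
    have h3 := abs_le.1 (hqA k (p.1 i))
    have h4 := abs_le.1 (hqA k (p.2 i))
    exact abs_le.2 ⟨by linarith, by linarith⟩
  have hint : Integrable (fun p => Finset.univ.sup' Finset.univ_nonempty fun k => F k p)
      (P.prod P) := integrable_sup'_univ hFm hFb
  have hev : ∀ i : Fin N, MeasurePreserving (fun s : Fin N → Z => s i) P μ := fun i =>
    measurePreserving_eval (fun _ : Fin N => μ) i
  have hih : ∀ k i, Integrable (fun s : Fin N → Z => h k (s i)) P := fun k i =>
    integrable_of_abs_le ((hh k).comp (measurable_pi_apply i)) fun s => hhA k _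
  have hiq : ∀ k i, Integrable (fun s : Fin N → Z => q k (s i)) P := fun k i =>
    integrable_of_abs_le ((hq k).comp (measurable_pi_apply i)) fun s => hqA k _
  have hEh : ∀ k i, ∫ s, h k (s i) ∂P = ∫ z, h k z ∂μ := fun k i => by
    rw [← (hev i).map_eq, integral_map (hev i).measurable.aemeasurable
      (hh k).aestronglyMeasurable]
  have hEq : ∀ k i, ∫ s, q k (s i) ∂P = ∫ z, q k z ∂μ := fun k i => by
    rw [← (hev i).map_eq, integral_map (hev i).measurable.aemeasurable
      (hq k).aestronglyMeasurable]
  have hghost : ∀ k s, ∑ i, ((∫ z, h k z ∂μ) - h k (s i) - (q k (s i) + ∫ z, q k z ∂μ) / 2)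
      = ∫ s', F k (s, s') ∂P := fun k s => by
    simp only [hF]
    rw [integral_finsetSum]
    · refine Finset.sum_congr rfl fun i _ => ?_
      rw [integral_offset (hih k i) (hiq k i), hEh, hEq]
    · exact fun i _ => ((hih k i).sub (integrable_const _)).sub
        (((integrable_const _).add (hiq k i)).div_const 2)
  calc ∫ s, _ ∂P ≤ ∫ s, ∫ s', (Finset.univ.sup' Finset.univ_nonempty fun k => F k (s, s')) ∂P ∂P := by
        refine integral_mono ?_ hint.integral_prod_left fun s => ?_
        · refine integrable_sup'_univ (C := N * (3 * A)) (fun k => ?_) fun k s => ?_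
          · refine Finset.measurable_sum _ fun i _ => ?_
            have h1 := (hh k).comp (measurable_pi_apply (X := fun _ : Fin N => Z) i)
            have h2 := (hq k).comp (measurable_pi_apply (X := fun _ : Fin N => Z) i)
            exact (measurable_const.sub h1).sub ((h2.add measurable_const).div_const 2)
          · rw [hghost]
            have := norm_integral_le_of_norm_le_const (μ := P) (f := fun s' => F k (s, s'))
              (Filter.Eventually.of_forall fun s' => hFb k (s, s'))
            simpa using this
        · refine Finset.sup'_le _ _ fun k _ => ?_
          rw [hghost]
          refine integral_mono (integrable_of_abs_le ((hFm k).comp measurable_prodMk_left)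
            fun s' => hFb k _) (integrable_sup'_univ (fun k => (hFm k).comp measurable_prodMk_left)
            fun k s' => hFb k _) fun s' => ?_
          exact Finset.le_sup' (fun k => F k (s, s')) (Finset.mem_univ k)
    _ = ∫ p, (Finset.univ.sup' Finset.univ_nonempty fun k => F k p) ∂(P.prod P) :=
        (integral_prod _ hint).symm
    _ ≤ M := ?_
  set Q := Measure.pi fun _ : Fin N => μ.prod μ with hQ
  set G : (Fin N → Z × Z) → ℝ := fun w => Finset.univ.sup' Finset.univ_nonempty fun k =>
    F k (fun i => (w i).1, fun i => (w i).2) with hG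
  have hGm : Measurable G := measurable_sup'_univ fun k => (hFm k).comp
    ((measurable_pi_lambda _ fun i => measurable_fst.comp (measurable_pi_apply i)).prodMk
      (measurable_pi_lambda _ fun i => measurable_snd.comp (measurable_pi_apply i)))
  have hpair : ∫ p, (Finset.univ.sup' Finset.univ_nonempty fun k => F k p) ∂(P.prod P)
      = ∫ w, G w ∂Q :=
    ((measurePreserving_arrowProdEquivProdArrow Z Z (Fin N) (fun _ => μ)
      fun _ => μ).integral_comp' _).symm
  set S : (Fin N → Bool) → (Fin N → Z × Z) → Fin N → Z × Z := fun ε w i =>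
    (if ε i then id else Prod.swap) (w i) with hS
  have hSm : ∀ ε, MeasurePreserving (S ε) Q Q := fun ε =>
    measurePreserving_pi (fun _ => μ.prod μ) (fun _ => μ.prod μ)
      (f := fun i => if ε i then id else Prod.swap) fun i => by
        split_ifs
        · exact MeasurePreserving.id _
        · exact Measure.measurePreserving_swap
  have hinv : ∀ ε, ∫ w, G (S ε w) ∂Q = ∫ w, G w ∂Q := fun ε => by
    conv_rhs => rw [← (hSm ε).map_eq, integral_map (hSm ε).measurable.aemeasurable
      hGm.aestronglyMeasurable]
  have hGi : ∀ ε, Integrable (fun w => G (S ε w)) Q := fun ε =>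
    integrable_of_abs_le (hGm.comp (hSm ε).measurable) fun w => abs_sup'_univ_le fun k => hFb k _
  have hsum : ∑ ε : Fin N → Bool, ∫ w, G (S ε w) ∂Q ≤ 2 ^ N * M := by
    rw [← integral_finsetSum _ fun ε _ => hGi ε]
    calc _ ≤ ∫ _w, 2 ^ N * M ∂Q := by
          refine integral_mono (integrable_finsetSum _ fun ε _ => hGi ε) (integrable_const _)
            fun w => (le_of_eq ?_).trans (hM w)
          refine Finset.sum_congr rfl fun ε _ => ?_
          simp only [hG, hF, hS]
          congr 1
          ext k
          refine Finset.sum_congr rfl fun i _ => ?_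
          unfold boolSign
          cases ε i
          · simp; ring
          · simp
      _ = _ := by simp
  simp only [hinv, Finset.sum_const, nsmul_eq_mul, Finset.card_univ, Fintype.card_fun,
    Fintype.card_bool, Fintype.card_fin, Nat.cast_pow, Nat.cast_ofNat] at hsum
  rw [hpair]
  exact le_of_mul_le_mul_left hsum (by positivity)

end Symmetrization

/-! ### Truncation of sub-exponential responses -/

/-- Truncation of a real number to `[-B, B]`. -/
noncomputable def clip (B z : ℝ) : ℝ := max (-B) (min z B)

lemma measurable_clip (B : ℝ) : Measurable (clip B) :=
  measurable_const.max (measurable_id.min measurable_const)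

lemma abs_clip_le {B : ℝ} (hB : 0 ≤ B) (z : ℝ) : |clip B z| ≤ B :=
  abs_le.2 ⟨le_max_left _ _, max_le (by linarith) (min_le_right _ _)⟩

lemma clip_of_abs_le {B z : ℝ} (h : |z| ≤ B) : clip B z = z := by
  obtain ⟨h1, h2⟩ := abs_le.1 h
  rw [clip, min_eq_left h2, max_eq_right h1]

lemma abs_sub_clip_le {σ B : ℝ} (hσ : 0 < σ) (hB : 0 ≤ B) (z : ℝ) :
    |z - clip B z| ≤ Real.exp (σ * |z|) * (Real.exp (-(σ * B)) / σ) := by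
  rcases le_or_gt |z| B with h | h
  · rw [clip_of_abs_le h, sub_self, abs_zero]; positivity
  · have h1 : |z - clip B z| ≤ |z| - B := by
      unfold clip
      rcases le_total 0 z with hz | hz
      · rw [abs_of_nonneg hz] at h ⊢
        rw [min_eq_right h.le, max_eq_right (by linarith), abs_of_nonneg (by linarith)]
      · rw [abs_of_nonpos hz] at h ⊢
        rw [min_eq_left (by linarith), max_eq_left (by linarith), abs_of_nonpos (by linarith)]
        linarith
    have h2 := Real.add_one_le_exp (σ * (|z| - B))
    have h3 : Real.exp (σ * |z|) * (Real.exp (-(σ * B)) / σ) = Real.exp (σ * (|z| - B)) / σ := by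
      rw [mul_div_assoc', ← Real.exp_add]; ring_nf
    rw [h3, le_div_iff₀ hσ]
    nlinarith

section FiniteClass

variable {E : Type*} [MeasurableSpace E] {μ : Measure (E × ℝ)} {σ : ℝ}

lemma integrable_pow_snd (hσ : 0 < σ) (hexp : Integrable (fun p => Real.exp (σ * |p.2|)) μ)
    (n : ℕ) : Integrable (fun p => p.2 ^ n) μ := by
  refine (hexp.const_mul (n.factorial / σ ^ n)).mono'
    (measurable_snd.pow_const n).aestronglyMeasurable (Filter.Eventually.of_forall fun p => ?_)
  have h := Real.pow_div_factorial_le_exp (σ * |p.2|) (by positivity) n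
  rw [div_le_iff₀ (by positivity), mul_pow] at h
  rw [Real.norm_eq_abs, abs_pow, div_mul_eq_mul_div, le_div_iff₀ (by positivity)]
  linarith

lemma integrable_clip_error (hσ : 0 < σ) (hexp : Integrable (fun p => Real.exp (σ * |p.2|)) μ)
    {B : ℝ} (hB : 0 ≤ B) : Integrable (fun p => |p.2 - clip B p.2|) μ := by
  refine (hexp.mul_const (Real.exp (-(σ * B)) / σ)).mono' ?_ (Filter.Eventually.of_forall fun p => ?_)
  · exact (measurable_snd.sub ((measurable_clip B).comp measurable_snd)).abs.aestronglyMeasurable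
  · rw [Real.norm_eq_abs, abs_abs]
    exact abs_sub_clip_le hσ hB _

lemma integral_clip_error_le (hσ : 0 < σ) (hexp : Integrable (fun p => Real.exp (σ * |p.2|)) μ)
    {B : ℝ} (hB : 0 ≤ B) :
    ∫ p, |p.2 - clip B p.2| ∂μ
      ≤ (∫ p, Real.exp (σ * |p.2|) ∂μ) * (Real.exp (-(σ * B)) / σ) := by
  rw [← integral_mul_const]
  exact integral_mono (integrable_clip_error hσ hexp hB) (hexp.mul_const _)
    fun p => abs_sub_clip_le hσ hB _

variable [IsProbabilityMeasure μ]

lemma integrable_loss_sub (hsnd : Integrable (fun p : E × ℝ => p.2) μ) {U : ℝ} {f g : E → ℝ}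
    (hf : Measurable f) (hfU : ∀ x, |f x| ≤ U) (hg : Measurable g) (hgU : ∀ x, |g x| ≤ U) :
    Integrable (fun p : E × ℝ => (g p.1 - p.2) ^ 2 - (f p.1 - p.2) ^ 2) μ := by
  have h : ∀ p : E × ℝ, (g p.1 - p.2) ^ 2 - (f p.1 - p.2) ^ 2
      = (g p.1 - f p.1) * (g p.1 + f p.1 - 2 * p.2) := fun p => by ring
  simp_rw [h]
  have hgm := hg.comp ((measurable_fst : Measurable (Prod.fst : E × ℝ → E)))
  have hfm := hf.comp ((measurable_fst : Measurable (Prod.fst : E × ℝ → E)))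
  refine Integrable.bdd_mul (c := 2 * U) (Integrable.sub ?_ (hsnd.const_mul 2))
    (hgm.sub hfm).aestronglyMeasurable (Filter.Eventually.of_forall fun p => ?_)
  · exact (integrable_of_abs_le hgm fun p => hgU p.1).add
      (integrable_of_abs_le hfm fun p => hfU p.1)
  · exact (abs_sub _ _).trans (by linarith [hgU p.1, hfU p.1])

lemma integrable_sup'_univ_of_integrable {ι S : Type*} [Fintype ι] [Nonempty ι]
    [MeasurableSpace S] {P : Measure S} {F : ι → S → ℝ} (hF : ∀ k, Integrable (F k) P) :
    Integrable (fun s => Finset.univ.sup' Finset.univ_nonempty fun k => F k s) P := by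
  have := Finset.sup'_induction (s := Finset.univ) Finset.univ_nonempty F
    (p := fun f => Integrable f P) (fun f hf g hg => hf.sup hg) fun k _ => hF k
  convert this using 1
  ext s
  rw [Finset.sup'_apply]

/-- The offset empirical process of a finite class with a finite cover on samples. -/
theorem integral_sup_offset_le {ι : Type*} [Fintype ι] [Nonempty ι] {N n : ℕ} (hσ : 0 < σ)
    (hexp : Integrable (fun p => Real.exp (σ * |p.2|)) μ) {U B δ : ℝ} (hU : 1 ≤ U) (hB : 0 ≤ B)
    {f0 : E → ℝ} (hf0 : Measurable f0) (hf0U : ∀ x, |f0 x| ≤ U)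
    (hreg : ∀ g : E → ℝ, Measurable g → (∀ x, |g x| ≤ 2 * U) →
      ∫ p, g p.1 * (f0 p.1 - p.2) ∂μ = 0)
    {φ : ι → E → ℝ} (hφ : ∀ k, Measurable (φ k)) (hφU : ∀ k x, |φ k x| ≤ U)
    (hcover : ∀ x : Fin N ⊕ Fin N → E, ∃ c : ι → Fin n, ∀ k l, c k = c l →
      ∀ a, |φ k (x a) - φ l (x a)| ≤ δ) :
    ∫ s, (Finset.univ.sup' Finset.univ_nonempty fun k =>
      N * (∫ p, (φ k p.1 - f0 p.1) ^ 2 ∂μ)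
        - 2 * ∑ i, ((φ k (s i).1 - (s i).2) ^ 2 - (f0 (s i).1 - (s i).2) ^ 2))
        ∂(Measure.pi fun _ : Fin N => μ)
      ≤ 2 * (7 * U + 4 * B) ^ 2 * Real.log n + N * ((24 * U + 8 * B) * δ)
        + N * (16 * U * ∫ p, |p.2 - clip B p.2| ∂μ) := by
  set P := Measure.pi fun _ : Fin N => μ with hP
  set τ := ∫ p, |p.2 - clip B p.2| ∂μ with hτ
  set e : E × ℝ → ℝ := fun p => f0 p.1 - clip B p.2 with he
  set g : ι → E × ℝ → ℝ := fun k p => φ k p.1 - f0 p.1 with hg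
  set q : ι → E × ℝ → ℝ := fun k p => g k p ^ 2 with hq
  set h : ι → E × ℝ → ℝ := fun k p => 3 / 2 * g k p ^ 2 + 4 * (g k p * e p) with hh
  have hem : Measurable e := (hf0.comp measurable_fst).sub ((measurable_clip B).comp measurable_snd)
  have hgm : ∀ k, Measurable (g k) := fun k =>
    ((hφ k).comp measurable_fst).sub (hf0.comp measurable_fst)
  have hqm : ∀ k, Measurable (q k) := fun k => (hgm k).pow_const 2
  have hhm : ∀ k, Measurable (h k) := fun k =>
    (((hgm k).pow_const 2).const_mul _).add (((hgm k).mul hem).const_mul _)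
  have heb : ∀ p, |e p| ≤ U + B := fun p =>
    (abs_sub _ _).trans (add_le_add (hf0U _) (abs_clip_le hB _))
  have hgb : ∀ k p, |g k p| ≤ 2 * U := fun k p =>
    (abs_sub _ _).trans (by linarith [hφU k p.1, hf0U p.1])
  have hhb : ∀ k p, |h k p| ≤ (7 * U + 4 * B) * |g k p| := fun k p => by
    have h1 : h k p = g k p * (3 / 2 * g k p + 4 * e p) := by simp only [hh]; ring
    rw [h1, abs_mul, mul_comm]
    refine mul_le_mul_of_nonneg_right ?_ (abs_nonneg _)
    have h2 := abs_le.1 (hgb k p)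
    have h3 := abs_le.1 (heb p)
    exact abs_le.2 ⟨by linarith, by linarith⟩
  set A : ℝ := (7 * U + 4 * B) * (2 * U) with hA
  have hhA : ∀ k p, |h k p| ≤ A := fun k p =>
    (hhb k p).trans (mul_le_mul_of_nonneg_left (hgb k p) (by linarith))
  have hqA : ∀ k p, |q k p| ≤ A := fun k p => by
    simp only [hq]
    rw [abs_pow]
    have := hgb k p
    have h0 := abs_nonneg (g k p)
    have h1 : |g k p| ^ 2 ≤ (2 * U) ^ 2 := by gcongr
    simp only [hA]
    nlinarith
  have hclip := integrable_clip_error hσ hexp hB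
  have hsnd : Integrable (fun p : E × ℝ => p.2) μ := by
    simpa using integrable_pow_snd hσ hexp 1
  have hge : ∀ k, -(2 * U * τ) ≤ ∫ p, g k p * e p ∂μ := fun k => by
    have h0 := hreg (fun x => φ k x - f0 x) ((hφ k).sub hf0) (fun x => hgb k (x, 0))
    have i1 : Integrable (fun p => g k p * (f0 p.1 - p.2)) μ :=
      Integrable.bdd_mul (c := 2 * U) ((integrable_of_abs_le (hf0.comp measurable_fst)
        fun p => hf0U p.1).sub hsnd) (hgm k).aestronglyMeasurable
        (Filter.Eventually.of_forall fun p => hgb k p)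
    have i2 : Integrable (fun p => g k p * e p) μ :=
      Integrable.bdd_mul (c := 2 * U) (integrable_of_abs_le hem heb) (hgm k).aestronglyMeasurable
        (Filter.Eventually.of_forall fun p => hgb k p)
    have h1 : -(2 * U * τ) = ∫ p, -(2 * U * |p.2 - clip B p.2|) ∂μ := by
      rw [integral_neg, integral_const_mul]
    have h2 : ∫ p, g k p * e p ∂μ = ∫ p, (g k p * e p - g k p * (f0 p.1 - p.2)) ∂μ := by
      rw [integral_sub i2 i1]; linarith
    rw [h1, h2]
    refine integral_mono (hclip.const_mul _).neg (i2.sub i1) fun p => ?_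
    have h3 : g k p * e p - g k p * (f0 p.1 - p.2) = g k p * (p.2 - clip B p.2) := by
      simp only [he]; ring
    simp only [h3]
    have h4 := abs_mul (g k p) (p.2 - clip B p.2)
    have h5 := mul_le_mul_of_nonneg_right (hgb k p) (abs_nonneg (p.2 - clip B p.2))
    linarith [neg_abs_le (g k p * (p.2 - clip B p.2))]
  set W : (Fin N → E × ℝ) → ℝ := fun s => Finset.univ.sup' Finset.univ_nonempty fun k =>
      ∑ i, ((∫ z, h k z ∂μ) - h k (s i) - (q k (s i) + ∫ z, q k z ∂μ) / 2) with hW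
  set V : (Fin N → E × ℝ) → ℝ := fun s =>
    ∑ i, (8 * U * τ + 8 * U * |(s i).2 - clip B (s i).2|) with hV
  have hpt : ∀ k s, N * (∫ p, (φ k p.1 - f0 p.1) ^ 2 ∂μ)
        - 2 * ∑ i, ((φ k (s i).1 - (s i).2) ^ 2 - (f0 (s i).1 - (s i).2) ^ 2)
      ≤ (∑ i, ((∫ z, h k z ∂μ) - h k (s i) - (q k (s i) + ∫ z, q k z ∂μ) / 2)) + V s := by
    intro k s
    have h1 : N * (∫ p, (φ k p.1 - f0 p.1) ^ 2 ∂μ) = ∑ _i : Fin N, ∫ p, q k p ∂μ := by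
      simp [hq, hg]
    rw [h1, Finset.mul_sum, ← Finset.sum_sub_distrib, hV, ← Finset.sum_add_distrib]
    refine Finset.sum_le_sum fun i _ => ?_
    have h2 : ∫ z, h k z ∂μ = 3 / 2 * (∫ z, q k z ∂μ) + 4 * ∫ p, g k p * e p ∂μ := by
      simp only [hh, hq]
      rw [integral_add, integral_const_mul, integral_const_mul]
      · exact (integrable_of_abs_le (hqm k) (hqA k)).const_mul _
      · refine (integrable_of_abs_le ((hgm k).mul hem) (C := 2 * U * (U + B)) fun p => ?_).const_mul _
        rw [Pi.mul_apply, abs_mul]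
        exact mul_le_mul (hgb k p) (heb p) (abs_nonneg _) (by linarith)
    have h3 : (φ k (s i).1 - (s i).2) ^ 2 - (f0 (s i).1 - (s i).2) ^ 2
        = q k (s i) + 2 * (g k (s i) * e (s i))
          - 2 * (g k (s i) * ((s i).2 - clip B (s i).2)) := by
      simp only [hq, hg, he]; ring
    have h4 := abs_mul (g k (s i)) ((s i).2 - clip B (s i).2)
    have h5 := mul_le_mul_of_nonneg_right (hgb k (s i)) (abs_nonneg ((s i).2 - clip B (s i).2))
    have h6 := le_abs_self (g k (s i) * ((s i).2 - clip B (s i).2))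
    have h7 : h k (s i) = 3 / 2 * q k (s i) + 4 * (g k (s i) * e (s i)) := rfl
    rw [h3, h2, h7]
    linarith [hge k]
  have hWi : Integrable W P := by
    refine integrable_sup'_univ (C := ∑ _i : Fin N, 3 * A) (fun k => ?_) fun k s => ?_
    · refine Finset.measurable_sum _ fun i _ => ?_
      have h1 := (hhm k).comp (measurable_pi_apply (X := fun _ : Fin N => E × ℝ) i)
      have h2 := (hqm k).comp (measurable_pi_apply (X := fun _ : Fin N => E × ℝ) i)
      exact (measurable_const.sub h1).sub ((h2.add measurable_const).div_const 2)
    · refine (Finset.abs_sum_le_sum_abs _ _).trans (Finset.sum_le_sum fun i _ => ?_)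
      have e1 := norm_integral_le_of_norm_le_const (μ := μ) (f := h k)
        (Filter.Eventually.of_forall (hhA k))
      have e2 := norm_integral_le_of_norm_le_const (μ := μ) (f := q k)
        (Filter.Eventually.of_forall (hqA k))
      simp only [Real.norm_eq_abs, probReal_univ, mul_one] at e1 e2
      have h1 := abs_le.1 e1
      have h2 := abs_le.1 e2
      have h3 := abs_le.1 (hhA k (s i))
      have h4 := abs_le.1 (hqA k (s i))
      exact abs_le.2 ⟨by linarith, by linarith⟩
  have hci : ∀ i : Fin N, Integrable (fun s : Fin N → E × ℝ => |(s i).2 - clip B (s i).2|) P :=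
    fun i => (measurePreserving_eval (fun _ : Fin N => μ) i).integrable_comp_of_integrable hclip
  have hti : ∀ i : Fin N, Integrable (fun s : Fin N → E × ℝ =>
      8 * U * τ + 8 * U * |(s i).2 - clip B (s i).2|) P := fun i =>
    (integrable_const _).add ((hci i).const_mul _)
  have hVi : Integrable V P := integrable_finsetSum _ fun i _ => hti i
  have hVint : ∫ s, V s ∂P = N * (16 * U * τ) := by
    simp only [hV]
    rw [integral_finsetSum _ fun i _ => hti i]
    have : ∀ i : Fin N, ∫ s, (8 * U * τ + 8 * U * |(s i).2 - clip B (s i).2|) ∂P = 16 * U * τ := by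
      intro i
      have h1 : ∫ s, |(s i).2 - clip B (s i).2| ∂P = τ := by
        have hmp := measurePreserving_eval (fun _ : Fin N => μ) i
        rw [hτ]
        conv_rhs => rw [← hmp.map_eq, integral_map hmp.measurable.aemeasurable
          (by rw [hmp.map_eq]; exact hclip.aestronglyMeasurable)]

      rw [integral_add (integrable_const _) ((hci i).const_mul _), integral_const_mul (8 * U) fun s : Fin N → E × ℝ => |(s i).2 - clip B (s i).2|, h1]
      simp
      ring
    simp [this]
  have hWM : ∫ s, W s ∂P ≤ 2 * (7 * U + 4 * B) ^ 2 * Real.log n + N * ((24 * U + 8 * B) * δ) := by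
    refine integral_sup_le_of_sign_average μ hhm hqm hhA hqA fun w => ?_
    obtain ⟨c, hc⟩ := hcover (Sum.elim (fun i => (w i).1.1) fun i => (w i).2.1)
    have hab : ∀ k i, (h k (w i).2 - h k (w i).1) ^ 2
        ≤ 2 * (7 * U + 4 * B) ^ 2 * (q k (w i).1 + q k (w i).2) := by
      intro k i
      have h1 := sq_le_sq.2 ((hhb k (w i).1).trans (le_abs_self _))
      have h2 := sq_le_sq.2 ((hhb k (w i).2).trans (le_abs_self _))
      rw [mul_pow, sq_abs] at h1 h2
      have h3 : (h k (w i).2 - h k (w i).1) ^ 2 = 2 * h k (w i).1 ^ 2 + 2 * h k (w i).2 ^ 2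
          - (h k (w i).2 + h k (w i).1) ^ 2 := by ring
      have h4 := sq_nonneg (h k (w i).2 + h k (w i).1)
      rw [h3, mul_add]
      simp only [hq]
      linarith
    have hr : ∀ k l, c k = c l → ∀ i, |(h k (w i).2 - h k (w i).1) - (h l (w i).2 - h l (w i).1)|
        + |(q k (w i).1 + q k (w i).2) - (q l (w i).1 + q l (w i).2)| / 2
        ≤ (24 * U + 8 * B) * δ := by
      intro k l hkl i
      have hd1 : |g k (w i).1 - g l (w i).1| ≤ δ := by
        have := hc k l hkl (.inl i)
        simpa [hg] using this
      have hd2 : |g k (w i).2 - g l (w i).2| ≤ δ := by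
        have := hc k l hkl (.inr i)
        simpa [hg] using this
      have key : ∀ p, |g k p - g l p| ≤ δ → |q k p - q l p| ≤ 4 * U * δ
          ∧ |h k p - h l p| ≤ (10 * U + 4 * B) * δ := by
        intro p hp
        have h1 := abs_le.1 (hgb k p)
        have h2 := abs_le.1 (hgb l p)
        have h3 := abs_le.1 (heb p)
        constructor
        · have : q k p - q l p = (g k p + g l p) * (g k p - g l p) := by simp only [hq]; ring
          rw [this, abs_mul]
          exact mul_le_mul (abs_le.2 ⟨by linarith, by linarith⟩) hp (abs_nonneg _) (by linarith)
        · have : h k p - h l p = (3 / 2 * (g k p + g l p) + 4 * e p) * (g k p - g l p) := by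
            simp only [hh]; ring
          rw [this, abs_mul]
          exact mul_le_mul (abs_le.2 ⟨by linarith, by linarith⟩) hp (abs_nonneg _) (by linarith)
      obtain ⟨a1, a2⟩ := key _ hd1
      obtain ⟨b1, b2⟩ := key _ hd2
      have e1 : |h k (w i).2 - h k (w i).1 - (h l (w i).2 - h l (w i).1)|
          ≤ 2 * ((10 * U + 4 * B) * δ) := by
        have := abs_sub (h k (w i).2 - h l (w i).2) (h k (w i).1 - h l (w i).1)
        rw [sub_sub_sub_comm]
        linarith
      have e2 : |q k (w i).1 + q k (w i).2 - (q l (w i).1 + q l (w i).2)|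
          ≤ 2 * (4 * U * δ) := by
        have := abs_add_le (q k (w i).1 - q l (w i).1) (q k (w i).2 - q l (w i).2)
        rw [add_sub_add_comm]
        linarith
      linarith
    obtain ⟨Y, hY, hYs⟩ := exists_bound_rademacher (N := N) c (by linarith : 0 < 7 * U + 4 * B)
      _ _ hab hr
    exact (Finset.sum_le_sum fun ε _ => Finset.sup'_le _ _ fun k _ => hY ε k).trans hYs
  have hloss : ∀ k, Integrable (fun p : E × ℝ =>
      (φ k p.1 - p.2) ^ 2 - (f0 p.1 - p.2) ^ 2) μ := fun k =>
    integrable_loss_sub hsnd hf0 hf0U (hφ k) (hφU k)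
  calc _ ≤ ∫ s, (W s + V s) ∂P := by
        refine integral_mono (integrable_sup'_univ_of_integrable fun k => ?_) (hWi.add hVi)
          fun s => Finset.sup'_le _ _ fun k _ => (hpt k s).trans ?_
        · refine (integrable_const _).sub ((integrable_finsetSum _ fun i _ => ?_).const_mul 2)
          exact (measurePreserving_eval (fun _ : Fin N => μ) i).integrable_comp_of_integrable
            (hloss k)
        · have := Finset.le_sup' (fun k =>
            ∑ i, ((∫ z, h k z ∂μ) - h k (s i) - (q k (s i) + ∫ z, q k z ∂μ) / 2))
            (Finset.mem_univ k)
          simp only [hW]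
          linarith
    _ = (∫ s, W s ∂P) + ∫ s, V s ∂P := integral_add hWi hVi
    _ ≤ _ := by rw [hVint]; linarith

end FiniteClass

section Erm

/-- An integrable function that is dominated by the supremum of a sequence inherits bounds on the
integrals of the finite suprema. -/
lemma integral_le_of_sup_le {S : Type*} [MeasurableSpace S] {P : Measure S} [IsProbabilityMeasure P]
    {V : S → ℝ} (hV : Integrable V P) {A : ℕ → S → ℝ} (hA : ∀ k, Integrable (A k) P)
    (hVA : ∀ s, ∀ ε > 0, ∃ k, V s ≤ A k s + ε) {M : ℝ}
    (hM : ∀ m : ℕ, ∫ s, (Finset.univ.sup' Finset.univ_nonempty fun k : Fin (m + 1) => A k s) ∂P ≤ M) :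
    ∫ s, V s ∂P ≤ M := by
  refine le_of_forall_pos_le_add fun ε hε => ?_
  set B : ℕ → S → ℝ := fun m s => Finset.univ.sup' Finset.univ_nonempty fun k : Fin (m + 1) => A k s
    with hB
  have hBi : ∀ m, Integrable (B m) P := fun m =>
    integrable_sup'_univ_of_integrable fun k : Fin (m + 1) => hA k
  have hle : ∀ m s (k : ℕ), k ≤ m → A k s ≤ B m s := fun m s k hk =>
    Finset.le_sup' (fun k : Fin (m + 1) => A k s) (Finset.mem_univ ⟨k, by omega⟩)
  have hlim : Filter.Tendsto (fun m => ∫ s, min (V s) (B m s + ε) ∂P) Filter.atTop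
      (nhds (∫ s, V s ∂P)) := by
    refine tendsto_integral_of_dominated_convergence (fun s => |V s| + |A 0 s| + ε)
      (fun m => (hV.inf ((hBi m).add (integrable_const ε))).aestronglyMeasurable)
      ((hV.abs.add (hA 0).abs).add (integrable_const ε))
      (fun m => Filter.Eventually.of_forall fun s => ?_) (Filter.Eventually.of_forall fun s => ?_)
    · have h1 := hle m s 0 (Nat.zero_le _)
      have h2 := abs_nonneg (A 0 s)
      have h3 := abs_nonneg (V s)
      refine abs_le.2 ⟨le_min (by linarith [neg_abs_le (V s)]) (by linarith [neg_abs_le (A 0 s)]),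
        (min_le_left _ _).trans (by linarith [le_abs_self (V s)])⟩
    · obtain ⟨k, hk⟩ := hVA s ε hε
      refine tendsto_const_nhds.congr' ?_
      filter_upwards [Filter.eventually_ge_atTop k] with m hm
      exact (min_eq_left (hk.trans (by linarith [hle m s k hm]))).symm
  refine le_of_tendsto' hlim fun m => ?_
  calc _ ≤ ∫ s, (B m s + ε) ∂P := integral_mono (hV.inf ((hBi m).add (integrable_const ε)))
        ((hBi m).add (integrable_const ε)) fun s => min_le_right _ _
    _ = (∫ s, B m s ∂P) + ε := by
        rw [integral_add (hBi m) (integrable_const ε)]; simp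
    _ ≤ _ := by linarith [hM m]

variable {E : Type*} [MeasurableSpace E] {μ : Measure (E × ℝ)} [IsProbabilityMeasure μ] {σ : ℝ}

lemma integrable_sq_loss (hσ : 0 < σ) (hexp : Integrable (fun p => Real.exp (σ * |p.2|)) μ)
    {U : ℝ} {g : E → ℝ} (hg : Measurable g) (hgU : ∀ x, |g x| ≤ U) :
    Integrable (fun p : E × ℝ => (g p.1 - p.2) ^ 2) μ := by
  have h0 : Integrable (fun p : E × ℝ => (0 - p.2) ^ 2) μ := by
    simpa using integrable_pow_snd hσ hexp 2
  have hU : 0 ≤ U := by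
    obtain ⟨p⟩ : Nonempty (E × ℝ) := nonempty_of_isProbabilityMeasure μ
    exact (abs_nonneg _).trans (hgU p.1)
  have hsnd : Integrable (fun p : E × ℝ => p.2) μ := by simpa using integrable_pow_snd hσ hexp 1
  have := (integrable_loss_sub hsnd (f := fun _ => 0) (U := U) measurable_const (fun _ => by simpa using hU)
    hg hgU).add h0
  refine this.congr (Filter.Eventually.of_forall fun p => ?_)
  simp

lemma excess_risk_eq (hσ : 0 < σ) (hexp : Integrable (fun p => Real.exp (σ * |p.2|)) μ) {U : ℝ}
    {f0 : E → ℝ} (hf0 : Measurable f0) (hf0U : ∀ x, |f0 x| ≤ U)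
    (hreg : ∀ g : E → ℝ, Measurable g → (∀ x, |g x| ≤ 2 * U) →
      ∫ p, g p.1 * (f0 p.1 - p.2) ∂μ = 0)
    {g : E → ℝ} (hg : Measurable g) (hgU : ∀ x, |g x| ≤ U) :
    (∫ p, (g p.1 - p.2) ^ 2 ∂μ) - ∫ p, (f0 p.1 - p.2) ^ 2 ∂μ = ∫ p, (g p.1 - f0 p.1) ^ 2 ∂μ := by
  have hd : ∀ x, |g x - f0 x| ≤ 2 * U := fun x =>
    (abs_sub _ _).trans (by linarith [hgU x, hf0U x])
  have hdm : Measurable fun p : E × ℝ => g p.1 - f0 p.1 :=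
    (hg.comp measurable_fst).sub (hf0.comp measurable_fst)
  have hsq : Integrable (fun p : E × ℝ => (g p.1 - f0 p.1) ^ 2) μ :=
    integrable_of_abs_le (hdm.pow_const 2) (C := (2 * U) ^ 2) fun p => by
      rw [abs_pow]; exact pow_le_pow_left₀ (abs_nonneg _) (hd p.1) 2
  have hsnd : Integrable (fun p : E × ℝ => p.2) μ := by simpa using integrable_pow_snd hσ hexp 1
  have hmul : Integrable (fun p : E × ℝ => 2 * ((g p.1 - f0 p.1) * (f0 p.1 - p.2))) μ :=
    (Integrable.bdd_mul (c := 2 * U) ((integrable_of_abs_le (hf0.comp measurable_fst)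
      fun p => hf0U p.1).sub hsnd) hdm.aestronglyMeasurable
      (Filter.Eventually.of_forall fun p => hd p.1)).const_mul 2
  rw [← integral_sub (integrable_sq_loss hσ hexp hg hgU) (integrable_sq_loss hσ hexp hf0 hf0U)]
  have h1 : ∀ p : E × ℝ, (g p.1 - p.2) ^ 2 - (f0 p.1 - p.2) ^ 2
      = (g p.1 - f0 p.1) ^ 2 + 2 * ((g p.1 - f0 p.1) * (f0 p.1 - p.2)) := fun p => by ring
  simp_rw [h1]
  rw [integral_add hsq hmul, integral_const_mul, hreg (fun x => g x - f0 x) (hg.sub hf0) hd]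
  ring

/-- Oracle inequality for empirical risk minimization over the closure of a sequence with finite
covers on samples. -/
theorem integral_erm_excess_le {N n : ℕ} (hN : 0 < N) (hσ : 0 < σ)
    (hexp : Integrable (fun p => Real.exp (σ * |p.2|)) μ) {U B δ : ℝ} (hU : 1 ≤ U) (hB : 0 ≤ B)
    {f0 : E → ℝ} (hf0 : Measurable f0) (hf0U : ∀ x, |f0 x| ≤ U)
    (hreg : ∀ g : E → ℝ, Measurable g → (∀ x, |g x| ≤ 2 * U) →
      ∫ p, g p.1 * (f0 p.1 - p.2) ∂μ = 0)
    {φ : ℕ → E → ℝ} (hφ : ∀ k, Measurable (φ k)) (hφU : ∀ k x, |φ k x| ≤ U)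
    (hcover : ∀ x : Fin N ⊕ Fin N → E, ∃ c : ℕ → Fin n, ∀ k l, c k = c l →
      ∀ a, |φ k (x a) - φ l (x a)| ≤ δ)
    {fhat : (Fin N → E × ℝ) → E → ℝ}
    (hfhat : ∀ s, ∃ u : ℕ → ℕ, ∀ x,
      Filter.Tendsto (fun k => φ (u k) x) Filter.atTop (nhds (fhat s x)))
    {ψ : E → ℝ} (hψ : Measurable ψ) (hψU : ∀ x, |ψ x| ≤ U)
    (herm : ∀ s : Fin N → E × ℝ,
      ∑ i, (fhat s (s i).1 - (s i).2) ^ 2 ≤ ∑ i, (ψ (s i).1 - (s i).2) ^ 2)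
    (hint : Integrable (fun s => ∫ p, (fhat s p.1 - p.2) ^ 2 ∂μ) (Measure.pi fun _ : Fin N => μ)) :
    ∫ s, ((∫ p, (fhat s p.1 - p.2) ^ 2 ∂μ) - ∫ p, (f0 p.1 - p.2) ^ 2 ∂μ)
        ∂(Measure.pi fun _ : Fin N => μ)
      ≤ 2 * (∫ p, (ψ p.1 - f0 p.1) ^ 2 ∂μ)
        + (2 * (7 * U + 4 * B) ^ 2 * Real.log n / N + (24 * U + 8 * B) * δ
          + 16 * U * ∫ p, |p.2 - clip B p.2| ∂μ) := by
  set P := Measure.pi fun _ : Fin N => μ with hP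
  have hsnd : Integrable (fun p : E × ℝ => p.2) μ := by simpa using integrable_pow_snd hσ hexp 1
  set ℓ : (E → ℝ) → E × ℝ → ℝ := fun g p => (g p.1 - p.2) ^ 2 - (f0 p.1 - p.2) ^ 2 with hℓ
  have hℓi : ∀ g, Measurable g → (∀ x, |g x| ≤ U) → Integrable (ℓ g) μ := fun g hg hgU =>
    integrable_loss_sub hsnd hf0 hf0U hg hgU
  have hmp : ∀ i : Fin N, MeasurePreserving (fun s : Fin N → E × ℝ => s i) P μ := fun i =>
    measurePreserving_eval (fun _ : Fin N => μ) i
  have hsum : ∀ g, Measurable g → (∀ x, |g x| ≤ U) →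
      Integrable (fun s : Fin N → E × ℝ => ∑ i, ℓ g (s i)) P := fun g hg hgU =>
    integrable_finsetSum _ fun i _ => (hmp i).integrable_comp_of_integrable (hℓi g hg hgU)
  set A : ℕ → (Fin N → E × ℝ) → ℝ := fun k s =>
    N * (∫ p, (φ k p.1 - f0 p.1) ^ 2 ∂μ) - 2 * ∑ i, ℓ (φ k) (s i) with hA
  set V : (Fin N → E × ℝ) → ℝ := fun s =>
    N * ((∫ p, (fhat s p.1 - p.2) ^ 2 ∂μ) - ∫ p, (f0 p.1 - p.2) ^ 2 ∂μ) - 2 * ∑ i, ℓ ψ (s i)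
    with hV
  have hVi : Integrable V P :=
    ((hint.sub (integrable_const _)).const_mul _).sub ((hsum ψ hψ hψU).const_mul 2)
  have hfm : ∀ s, Measurable (fhat s) := fun s => by
    obtain ⟨u, hu⟩ := hfhat s
    exact measurable_of_tendsto_metrizable (fun k => hφ (u k)) (tendsto_pi_nhds.2 hu)
  have hfU : ∀ s x, |fhat s x| ≤ U := fun s x => by
    obtain ⟨u, hu⟩ := hfhat s
    exact le_of_tendsto' (hu x).abs fun k => hφU (u k) x
  have hVA : ∀ s, ∀ ε > 0, ∃ k, V s ≤ A k s + ε := by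
    intro s ε hε
    obtain ⟨u, hu⟩ := hfhat s
    have h1 : Filter.Tendsto (fun j => A (u j) s) Filter.atTop
        (nhds (N * (∫ p, (fhat s p.1 - f0 p.1) ^ 2 ∂μ) - 2 * ∑ i, ℓ (fhat s) (s i))) := by
      refine Filter.Tendsto.sub (Filter.Tendsto.const_mul _ ?_) (Filter.Tendsto.const_mul _ ?_)
      · refine tendsto_integral_of_dominated_convergence (fun _ => (2 * U) ^ 2)
          (fun j => ((((hφ (u j)).comp measurable_fst).sub
            (hf0.comp measurable_fst)).pow_const 2).aestronglyMeasurable) (integrable_const _)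
          (fun j => Filter.Eventually.of_forall fun p => ?_)
          (Filter.Eventually.of_forall fun p => ((hu p.1).sub_const _).pow 2)
        rw [Real.norm_eq_abs, abs_pow]
        exact pow_le_pow_left₀ (abs_nonneg _)
          ((abs_sub _ _).trans (by linarith [hφU (u j) p.1, hf0U p.1])) 2
      · exact tendsto_finsetSum _ fun i _ => (((hu (s i).1).sub_const _).pow 2).sub_const _
    have h2 : V s ≤ N * (∫ p, (fhat s p.1 - f0 p.1) ^ 2 ∂μ) - 2 * ∑ i, ℓ (fhat s) (s i) := by
      simp only [hV, hℓ]
      rw [excess_risk_eq hσ hexp hf0 hf0U hreg (hfm s) (hfU s), Finset.sum_sub_distrib,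
        Finset.sum_sub_distrib]
      linarith [herm s]
    obtain ⟨j, hj⟩ := (h1.eventually (lt_mem_nhds (sub_lt_self _ hε))).exists
    exact ⟨u j, by linarith⟩
  have hmain := integral_le_of_sup_le hVi (A := A)
    (fun k => (integrable_const _).sub ((hsum (φ k) (hφ k) (hφU k)).const_mul 2)) hVA
    (fun m => integral_sup_offset_le (N := N) (n := n) (ι := Fin (m + 1)) hσ hexp hU hB hf0 hf0U
      hreg (φ := fun k => φ k) (fun k => hφ k) (fun k => hφU k) (fun x => by
        obtain ⟨c, hc⟩ := hcover x
        exact ⟨fun k => c k, fun k l h a => hc k l h a⟩))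
  have hNR : (0 : ℝ) < N := by exact_mod_cast hN
  have hψsum : ∫ s, ∑ i, ℓ ψ (s i) ∂P = N * ∫ p, (ψ p.1 - f0 p.1) ^ 2 ∂μ := by
    have h0 : ∀ i : Fin N, Integrable (fun s : Fin N → E × ℝ => ℓ ψ (s i)) P := fun i =>
      (hmp i).integrable_comp_of_integrable (hℓi ψ hψ hψU)
    rw [integral_finsetSum _ fun i _ => h0 i]
    have h1 : ∀ i : Fin N, ∫ s, ℓ ψ (s i) ∂P = ∫ p, (ψ p.1 - f0 p.1) ^ 2 ∂μ := fun i => by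
      rw [← excess_risk_eq hσ hexp hf0 hf0U hreg hψ hψU,
        ← integral_sub (integrable_sq_loss hσ hexp hψ hψU) (integrable_sq_loss hσ hexp hf0 hf0U)]
      conv_rhs => rw [← (hmp i).map_eq, integral_map (hmp i).measurable.aemeasurable
          (by rw [(hmp i).map_eq]; exact (hℓi ψ hψ hψU).aestronglyMeasurable)]
    simp [h1]
  have hVint : ∫ s, V s ∂P
      = N * (∫ s, ((∫ p, (fhat s p.1 - p.2) ^ 2 ∂μ) - ∫ p, (f0 p.1 - p.2) ^ 2 ∂μ) ∂P)
        - 2 * (N * ∫ p, (ψ p.1 - f0 p.1) ^ 2 ∂μ) := by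
    rw [← hψsum, ← integral_const_mul, ← integral_const_mul]
    exact integral_sub ((hint.sub (integrable_const _)).const_mul _)
      ((hsum ψ hψ hψU).const_mul 2)
  rw [hVint] at hmain
  refine le_of_mul_le_mul_left ?_ hNR
  have h3 : (N : ℝ) * (2 * (7 * U + 4 * B) ^ 2 * Real.log n / N)
      = 2 * (7 * U + 4 * B) ^ 2 * Real.log n := by field_simp
  rw [mul_add, mul_add, mul_add, h3]
  linarith

end Erm

/-! ### The regression function -/

lemma exists_measurable_regression {E : Type*} [MeasurableSpace E] {μ : Measure (E × ℝ)}
    [IsProbabilityMeasure μ] (hsnd : Integrable (fun p : E × ℝ => p.2) μ) {U : ℝ} (hU : 0 ≤ U)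
    {f0 : E → ℝ} (hf0 : (fun p => f0 p.1)
      =ᵐ[μ] μ[(fun p => p.2) | MeasurableSpace.comap Prod.fst inferInstance])
    (hf0U : ∀ᵐ p ∂μ, |f0 p.1| ≤ U) :
    ∃ f1 : E → ℝ, Measurable f1 ∧ (∀ x, |f1 x| ≤ U) ∧ (∀ᵐ p ∂μ, f1 p.1 = f0 p.1) ∧
      ∀ g : E → ℝ, Measurable g → (∀ x, |g x| ≤ 2 * U) →
        ∫ p, g p.1 * (f1 p.1 - p.2) ∂μ = 0 := by
  have hgz : ∀ g : E → ℝ, Measurable g → (∀ x, |g x| ≤ 2 * U) →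
      Integrable (fun p : E × ℝ => g p.1 * p.2) μ := fun g hg hgU =>
    Integrable.bdd_mul (c := 2 * U) hsnd (hg.comp measurable_fst).aestronglyMeasurable
      (Filter.Eventually.of_forall fun p => hgU p.1)
  have hgf : ∀ g h : E → ℝ, Measurable g → Measurable h → (∀ x, |g x| ≤ 2 * U) →
      Integrable (fun p : E × ℝ => g p.1 * clip U (h p.1)) μ := fun g h hg hh hgU =>
    Integrable.bdd_mul (c := 2 * U) (integrable_of_abs_le
      (((measurable_clip U).comp hh).comp measurable_fst) fun p => abs_clip_le hU _)
      (hg.comp measurable_fst).aestronglyMeasurable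
      (Filter.Eventually.of_forall fun p => hgU p.1)
  set m : MeasurableSpace (E × ℝ) := MeasurableSpace.comap Prod.fst inferInstance with hm
  have hle : m ≤ Prod.instMeasurableSpace := measurable_fst.comap_le
  obtain ⟨h, hh, hhe⟩ := (stronglyMeasurable_condExp (m := m) (μ := μ)
    (f := fun p : E × ℝ => p.2)).measurable.exists_eq_measurable_comp
  have hae : ∀ᵐ p ∂μ, clip U (h p.1) = f0 p.1 := by
    filter_upwards [hf0, hf0U] with p hp hpU
    have h1 : h p.1 = f0 p.1 := by rw [hp, hhe]; rfl
    rw [h1, clip_of_abs_le hpU]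
  refine ⟨fun x => clip U (h x), (measurable_clip U).comp hh, fun x => abs_clip_le hU _, hae,
    fun g hg hgU => ?_⟩
  have hgm : StronglyMeasurable[m] fun p : E × ℝ => g p.1 :=
    (hg.comp (comap_measurable (Prod.fst : E × ℝ → E))).stronglyMeasurable
  have hpull := condExp_stronglyMeasurable_mul_of_bound hle hgm hsnd (2 * U)
    (Filter.Eventually.of_forall fun p => hgU p.1)
  simp_rw [mul_sub]
  rw [integral_sub (hgf g h hg hh hgU) (hgz g hg hgU), sub_eq_zero, ← integral_condExp hle (f := fun p : E × ℝ => g p.1 * p.2)]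
  refine integral_congr_ae ?_
  filter_upwards [hpull, hae, hf0] with p h1 h2 h3
  have h4 : μ[(fun p : E × ℝ => g p.1 * p.2) | m] p
    = g p.1 * μ[(fun p : E × ℝ => p.2) | m] p := h1
  rw [h4, h2, ← h3]

/-! ### Covers of the ParaRNN class -/

section Cover

variable {din d ds L T : ℕ}

/-- Every nonempty set in a second countable metrizable space has a dense sequence. -/
lemma exists_seq_forall_tendsto {α : Type*} [TopologicalSpace α] [SecondCountableTopology α]
    [FrechetUrysohnSpace α] {S : Set α} (hS : S.Nonempty) :
    ∃ D : ℕ → α, (∀ k, D k ∈ S) ∧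
      ∀ x ∈ S, ∃ u : ℕ → ℕ, Filter.Tendsto (fun k => D (u k)) Filter.atTop (nhds x) := by
  have : Nonempty S := hS.to_subtype
  refine ⟨fun k => TopologicalSpace.denseSeq S k, fun k => (TopologicalSpace.denseSeq S k).2,
    fun x hx => ?_⟩
  have h1 : x ∈ closure (Set.range fun k => (TopologicalSpace.denseSeq S k : α)) := by
    have h2 : (⟨x, hx⟩ : S) ∈ closure (Set.range (TopologicalSpace.denseSeq S)) :=
      TopologicalSpace.denseRange_denseSeq S _
    rw [closure_subtype, ← Set.range_comp] at h2
    exact h2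
  obtain ⟨y, hy, hlim⟩ := mem_closure_iff_seq_limit.1 h1
  choose u hu using hy
  exact ⟨u, by simpa only [hu] using hlim⟩

/-- The scalar ParaRNN class is contained in the pointwise sequential closure of a sequence. -/
lemma exists_dense_seq_scalarClass {U : ℝ} (hne : (scalarClass din d ds L T U).Nonempty) :
    ∃ θ : ℕ → NetIdx din d L → ℝ,
      (∀ k X, |paramForward (θ k) (extendInput (T := T) X) (T - 1)| ≤ U ∨ T = 0) ∧
      ∀ f ∈ scalarClass din d ds L T U, ∃ u : ℕ → ℕ, ∀ X : Fin T → Fin din → ℝ,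
        Filter.Tendsto (fun k => paramForward (θ (u k)) (extendInput X) (T - 1)) Filter.atTop
          (nhds (f X)) := by
  set S : Set (NetIdx din d L → ℝ) :=
    {θ | ∃ net : ParaNet din 1 d ds L, net.Bounded T U ∧ net.params = θ} with hS
  have hSne : S.Nonempty := by
    obtain ⟨f, net, hb, -⟩ := hne
    exact ⟨net.params, net, hb, rfl⟩
  obtain ⟨D, hD, hlim⟩ := exists_seq_forall_tendsto hSne
  refine ⟨D, fun k X => ?_, fun f ⟨net, hb, hf⟩ => ?_⟩
  · rcases Nat.eq_zero_or_pos T with hT | hT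
    · exact .inr hT
    · obtain ⟨net, hb, he⟩ := hD k
      rw [← he, ← net.forward_eq_paramForward]
      exact .inl (hb X _ (by omega) 0)
  · obtain ⟨u, hu⟩ := hlim net.params ⟨net, hb, rfl⟩
    refine ⟨u, fun X => ?_⟩
    rw [hf X, net.forward_eq_paramForward]
    have hc : Continuous fun θ : NetIdx din d L → ℝ => paramForward θ (extendInput X) (T - 1) :=
      continuous_paramForward (θ := fun θ => θ) (X := fun _ => extendInput X) continuous_id'
        (fun t i => continuous_const) _
    exact (hc.tendsto net.params).comp hu

/-- Empirical covers of the ParaRNN class. -/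
lemma exists_cover_paramForward (hT : 0 < T) {ι : Type*} {U δ : ℝ} (hδ : 0 < δ)
    {θ : ι → NetIdx din d L → ℝ} {m r : ℕ} (hr : 2 * U / δ ≤ r)
    (X : Fin m → ℕ → Fin din → ℝ) (hb : ∀ k a, |paramForward (θ k) (X a) (T - 1)| ≤ U) :
    ∃ c : ι → Fin (netCellBound (Fintype.card (NetIdx din d L)) (L * T + 3) d L T m (r + 1)),
      ∀ k l, c k = c l → ∀ a,
        |paramForward (θ k) (X a) (T - 1) - paramForward (θ l) (X a) (T - 1)| ≤ δ := by
  obtain ⟨c, hc⟩ := exists_cells_net (L := L) (d := d) hT X fun j : Fin (r + 1) => -U + j * δ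
  have key : ∀ k l, c (θ k) = c (θ l) → ∀ a,
      paramForward (θ k) (X a) (T - 1) ≤ paramForward (θ l) (X a) (T - 1) + δ := by
    intro k l h a
    by_contra! hlt
    set x := paramForward (θ k) (X a) (T - 1)
    set y := paramForward (θ l) (X a) (T - 1)
    have hx := abs_le.1 (hb k a)
    have hy := abs_le.1 (hb l a)
    have hy0 : 0 ≤ (y + U) / δ := div_nonneg (by linarith) hδ.le
    set j := ⌈(y + U) / δ⌉₊ with hj
    have hjr : j ≤ r := by
      refine Nat.ceil_le.2 (le_trans ?_ hr)
      gcongr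
      linarith
    have h1 : (y + U) / δ ≤ j := Nat.le_ceil _
    have h2 : (j : ℝ) < (y + U) / δ + 1 := Nat.ceil_lt_add_one hy0
    rw [div_le_iff₀ hδ] at h1
    have h3 : (j : ℝ) * δ < y + U + δ := by
      have := mul_lt_mul_of_pos_right h2 hδ
      rwa [add_mul, one_mul, div_mul_cancel₀ _ hδ.ne'] at this
    have h4 := (hc (θ k) (θ l) h a ⟨j, by omega⟩).1 (by simp only; linarith)
    simp only at h4
    linarith
  exact ⟨fun k => c (θ k), fun k l h a =>
    abs_sub_le_iff.2 ⟨by linarith [key k l h a], by linarith [key l k h.symm a]⟩⟩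

/-- Oracle inequality for empirical risk minimization over ParaRNNs. -/
theorem integral_erm_scalarClass_le (hT : 0 < T) {N r : ℕ} (hN : 0 < N)
    {μ : Measure ((Fin T → Fin din → ℝ) × ℝ)} [IsProbabilityMeasure μ] {σ : ℝ} (hσ : 0 < σ)
    (hexp : Integrable (fun p => Real.exp (σ * |p.2|)) μ) {U B δ : ℝ} (hU : 1 ≤ U) (hB : 0 ≤ B)
    (hδ : 0 < δ) (hr : 2 * U / δ ≤ r) {f0 : (Fin T → Fin din → ℝ) → ℝ}
    (hf0 : (fun p => f0 p.1)
      =ᵐ[μ] μ[(fun p => p.2) | MeasurableSpace.comap Prod.fst inferInstance])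
    (hf0U : ∀ᵐ p ∂μ, |f0 p.1| ≤ U)
    {fhat : (Fin N → (Fin T → Fin din → ℝ) × ℝ) → (Fin T → Fin din → ℝ) → ℝ}
    (hfhat : ∀ s, fhat s ∈ scalarClass din d ds L T U)
    (herm : ∀ s, ∀ φ ∈ scalarClass din d ds L T U, empRisk s (fhat s) ≤ empRisk s φ)
    (hint : Integrable (fun s => risk μ (fhat s)) (Measure.pi fun _ : Fin N => μ))
    {ψ : (Fin T → Fin din → ℝ) → ℝ} (hψ : ψ ∈ scalarClass din d ds L T U) :
    ∫ s, (risk μ (fhat s) - risk μ f0) ∂(Measure.pi fun _ : Fin N => μ)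
      ≤ 2 * (∫ p, (ψ p.1 - f0 p.1) ^ 2 ∂μ)
        + (2 * (7 * U + 4 * B) ^ 2 * Real.log (netCellBound (Fintype.card (NetIdx din d L))
            (L * T + 3) d L T (N + N) (r + 1)) / N + (24 * U + 8 * B) * δ
          + 16 * U * ((∫ p, Real.exp (σ * |p.2|) ∂μ) * (Real.exp (-(σ * B)) / σ))) := by
  have hsnd : Integrable (fun p : (Fin T → Fin din → ℝ) × ℝ => p.2) μ := by
    simpa using integrable_pow_snd hσ hexp 1
  obtain ⟨f1, hf1, hf1U, hf10, hreg⟩ := exists_measurable_regression hsnd (by linarith) hf0 hf0U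
  obtain ⟨θ, hθU, hθ⟩ := exists_dense_seq_scalarClass ⟨ψ, hψ⟩
  have hθU' : ∀ k (X : Fin T → Fin din → ℝ), |paramForward (θ k) (extendInput X) (T - 1)| ≤ U :=
    fun k X => (hθU k X).resolve_right (by omega)
  have hθm : ∀ k, Measurable fun X : Fin T → Fin din → ℝ =>
      paramForward (θ k) (extendInput X) (T - 1) := fun k =>
    (continuous_paramForward continuous_const (fun t i => continuous_extendInput t i) _).measurable
  obtain ⟨net, hnet, hψe⟩ := hψ
  have hψm : Measurable ψ := by
    have : ψ = fun X => paramForward net.params (extendInput X) (T - 1) := by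
      ext X; rw [hψe, net.forward_eq_paramForward]
    rw [this]
    exact (continuous_paramForward continuous_const
      (fun t i => continuous_extendInput t i) _).measurable
  have hψU : ∀ X, |ψ X| ≤ U := fun X => by
    rw [hψe]; exact hnet X _ (by omega) 0
  have hNR : (0 : ℝ) < N := by exact_mod_cast hN
  have h := integral_erm_excess_le (n := netCellBound (Fintype.card (NetIdx din d L))
      (L * T + 3) d L T (N + N) (r + 1)) (δ := δ) hN hσ hexp hU hB hf1 hf1U hreg hθm hθU'
    (fun x => by
      obtain ⟨c, hc⟩ := exists_cover_paramForward hT hδ hr (θ := θ)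
        (fun a : Fin (N + N) => extendInput (x (finSumFinEquiv.symm a)))
        (fun k a => hθU' k _)
      refine ⟨c, fun k l h a => ?_⟩
      simpa using hc k l h (finSumFinEquiv a))
    (fun s => hθ _ (hfhat s)) hψm hψU
    (fun s => by
      have := herm s ψ ⟨net, hnet, hψe⟩
      simp only [empRisk] at this
      exact le_of_mul_le_mul_left this (inv_pos.2 hNR)) hint
  have e1 : ∫ p, (f1 p.1 - p.2) ^ 2 ∂μ = risk μ f0 :=
    integral_congr_ae (by filter_upwards [hf10] with p hp; rw [hp])
  have e2 : ∫ p, (ψ p.1 - f1 p.1) ^ 2 ∂μ = ∫ p, (ψ p.1 - f0 p.1) ^ 2 ∂μ :=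
    integral_congr_ae (by filter_upwards [hf10] with p hp; rw [hp])
  rw [e1, e2] at h
  refine h.trans ?_
  have := mul_le_mul_of_nonneg_left (integral_clip_error_le hσ hexp hB)
    (by linarith : 0 ≤ 16 * U)
  linarith

end Cover

/-! ### The statistical error in closed form -/

lemma natLog_two_add_one_le {m : ℕ} {x : ℝ} (hm : 0 < m) (h : Real.log m ≤ x) (hx : 1 ≤ x) :
    ((Nat.log 2 m + 1 : ℕ) : ℝ) ≤ 3 * x := by
  have h1 : ((2 : ℝ) ^ Nat.log 2 m) ≤ m := by exact_mod_cast Nat.pow_log_le_self 2 hm.ne'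
  have h2 := Real.log_le_log (by positivity) h1
  rw [Real.log_pow] at h2
  have h3 := Real.log_two_gt_d9
  have h4 : (0 : ℝ) ≤ (Nat.log 2 m : ℝ) := Nat.cast_nonneg _
  push_cast
  nlinarith

lemma log_signPatternBound (W D M : ℕ) : Real.log (signPatternBound W D M)
    = 2 * W * ((Nat.log 2 (M * D + 1) + 1 : ℕ) : ℝ) * Real.log ((M + 1 : ℕ) : ℝ) := by
  rw [signPatternBound]
  push_cast
  rw [← Nat.cast_succ, ← Real.rpow_natCast, Real.log_rpow (by positivity)]
  push_cast
  ring

lemma log_signPatternBound_le {W D M : ℕ} {x : ℝ} (hx : 1 ≤ x) (hD : 1 ≤ D)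
    (h : Real.log ((M * D + 1 : ℕ) : ℝ) ≤ x) :
    Real.log (signPatternBound W D M) ≤ 6 * W * x ^ 2 := by
  have h1 : Real.log ((M + 1 : ℕ) : ℝ) ≤ x := by
    refine le_trans (Real.log_le_log (by positivity) ?_) h
    exact_mod_cast Nat.succ_le_succ (Nat.le_mul_of_pos_right _ hD)
  have h0 : 0 ≤ Real.log ((M + 1 : ℕ) : ℝ) := Real.log_natCast_nonneg _
  have h2 := natLog_two_add_one_le (Nat.succ_pos _) h hx
  rw [log_signPatternBound]
  calc _ ≤ 2 * W * (3 * x) * x := by gcongr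
    _ = _ := by ring

lemma log_netCellBound_le {W D d L T m r : ℕ} {x y : ℝ} (hx : 1 ≤ x) (hy : 1 ≤ y) (hD : 1 ≤ D)
    (h1 : Real.log ((m * d * D + 1 : ℕ) : ℝ) ≤ x) (h2 : Real.log ((m * r * D + 1 : ℕ) : ℝ) ≤ y) :
    Real.log (netCellBound W D d L T m r) ≤ 6 * W * ((L * T + 1) * x ^ 2 + y ^ 2) := by
  have hp : ∀ M, (0 : ℝ) < signPatternBound W D M := fun M => by
    rw [signPatternBound]; positivity
  rw [netCellBound]
  push_cast
  rw [Real.log_mul (pow_pos (hp _) _).ne' (hp _).ne', Real.log_pow]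
  have e1 := log_signPatternBound_le (W := W) hx hD h1
  have e2 := log_signPatternBound_le (W := W) hy hD h2
  have e3 := mul_le_mul_of_nonneg_left e1 (by positivity : (0 : ℝ) ≤ L * T + 1)
  push_cast
  linarith

lemma card_netIdx_le {din d L : ℕ} (hdin : din ≤ d) (hd : 1 ≤ d) (hL : 1 ≤ L) :
    (Fintype.card (NetIdx din d L) : ℝ) ≤ 8 * L * (d : ℝ) ^ 2 := by
  have : Fintype.card (NetIdx din d L) ≤ 8 * L * d ^ 2 := by
    rw [card_netIdx]
    have h1 : d ≤ d * d := Nat.le_mul_of_pos_left d hd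
    have h2 : d * din ≤ d * d := Nat.mul_le_mul_left _ hdin
    have h3 : d * d ≤ L * (d * d) := Nat.le_mul_of_pos_left _ hL
    have h4 : L * d ≤ L * (d * d) := Nat.mul_le_mul_left _ h1
    calc _ = d * din + 2 * (L * (d * d)) + 2 * (L * d) + d * d + 2 * d := by ring
      _ ≤ 8 * (L * (d * d)) := by omega
      _ = _ := by ring
  exact_mod_cast this

/-- The logarithm of the size of the empirical covers at scale `1 / N`. -/
lemma log_netCellBound_class_le {din d L T N : ℕ} {U : ℝ} (hdin : din ≤ d) (hd : 3 ≤ d)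
    (hL : 1 ≤ L) (hT : 0 < T) (hU : 1 ≤ U) (hdN : d ≤ N) (hLN : L * T + 3 ≤ N)
    (hlog : 1 ≤ Real.log N) :
    Real.log (netCellBound (Fintype.card (NetIdx din d L)) (L * T + 3) d L T (N + N)
      (⌈2 * U * N⌉₊ + 1)) ≤ 3264 * T * (L : ℝ) ^ 2 * (d : ℝ) ^ 2 * U ^ 2 * Real.log N ^ 2 := by
  have hN3 : (3 : ℝ) ≤ N := by exact_mod_cast hd.trans hdN
  have hd' : (d : ℝ) ≤ N := by exact_mod_cast hdN
  have hL' : (L : ℝ) * T + 3 ≤ N := by exact_mod_cast hLN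
  have hlU : Real.log U ≤ U := (Real.log_le_sub_one_of_pos (by linarith)).trans (by linarith)
  have h1 : Real.log (((N + N) * d * (L * T + 3) + 1 : ℕ) : ℝ) ≤ 4 * Real.log N := by
    have : Real.log ((N : ℝ) ^ 4) = 4 * Real.log N := by rw [Real.log_pow]; norm_num
    rw [← this]
    refine Real.log_le_log (by positivity) ?_
    push_cast
    calc ((N : ℝ) + N) * d * (L * T + 3) + 1 ≤ (N + N) * N * N + 1 := by gcongr
      _ ≤ N ^ 4 := by nlinarith [pow_le_pow_left₀ (by norm_num) hN3 3]
  have h2 : Real.log (((N + N) * (⌈2 * U * N⌉₊ + 1) * (L * T + 3) + 1 : ℕ) : ℝ)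
      ≤ 6 * (U * Real.log N) := by
    have : Real.log (U * (N : ℝ) ^ 5) = Real.log U + 5 * Real.log N := by
      rw [Real.log_mul (by positivity) (by positivity), Real.log_pow]; norm_num
    have hr : ((⌈2 * U * N⌉₊ : ℕ) : ℝ) ≤ 2 * U * N + 1 := (Nat.ceil_lt_add_one (by positivity)).le
    have hUN : 3 ≤ U * N := by nlinarith
    refine (Real.log_le_log (y := U * (N : ℝ) ^ 5) (by positivity) ?_).trans ?_
    · push_cast
      calc ((N : ℝ) + N) * (⌈2 * U * N⌉₊ + 1) * (L * T + 3) + 1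
          ≤ (N + N) * (3 * U * N) * N + 1 := by gcongr; linarith
        _ ≤ 9 * (U * N ^ 3) := by nlinarith [pow_le_pow_left₀ (by norm_num) hN3 3]
        _ ≤ N ^ 2 * (U * N ^ 3) := by gcongr; nlinarith
        _ = _ := by ring
    · rw [this]
      nlinarith
  have hUl : 1 ≤ U * Real.log N := one_le_mul_of_one_le_of_one_le hU hlog
  refine (log_netCellBound_le (by linarith) (by linarith) (by omega) h1 h2).trans ?_
  have hW := card_netIdx_le hdin (by omega : 1 ≤ d) hL
  have hLT : (1 : ℝ) ≤ L * T := by exact_mod_cast Nat.mul_pos hL hT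
  have hU2 : 1 ≤ U ^ 2 := one_le_pow₀ hU
  have hb : ((L : ℝ) * T + 1) * (4 * Real.log N) ^ 2 + (6 * (U * Real.log N)) ^ 2
      ≤ 68 * (L * T) * U ^ 2 * Real.log N ^ 2 := by
    have e1 : 16 * ((L : ℝ) * T + 1) + 36 * U ^ 2 ≤ 68 * (L * T) * U ^ 2 := by
      nlinarith [mul_nonneg (sub_nonneg.2 hLT) (sub_nonneg.2 hU2)]
    calc _ = (16 * ((L : ℝ) * T + 1) + 36 * U ^ 2) * Real.log N ^ 2 := by ring
      _ ≤ _ := by gcongr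
  calc _ ≤ 6 * (8 * L * (d : ℝ) ^ 2) * (68 * (L * T) * U ^ 2 * Real.log N ^ 2) := by gcongr
    _ = _ := by ring

/-- Oracle inequality for empirical risk minimization over ParaRNNs, with the statistical error
in closed form. -/
theorem integral_erm_scalarClass_le_closed {din d ds L T N : ℕ} (hT : 0 < T) (hdin : din ≤ d)
    (hd : 3 ≤ d) (hL : 1 ≤ L)
    (hN : 4 * T * ((d : ℝ) ^ 2 * (L : ℝ) ^ 2 * Real.log (max d L)) ≤ N)
    {μ : Measure ((Fin T → Fin din → ℝ) × ℝ)} [IsProbabilityMeasure μ] {σ M : ℝ} (hσ : 0 < σ)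
    (hexp : Integrable (fun p => Real.exp (σ * |p.2|)) μ)
    (hM : ∫ p, Real.exp (σ * |p.2|) ∂μ ≤ M) {U : ℝ} (hU : 1 ≤ U)
    {f0 : (Fin T → Fin din → ℝ) → ℝ}
    (hf0 : (fun p => f0 p.1)
      =ᵐ[μ] μ[(fun p => p.2) | MeasurableSpace.comap Prod.fst inferInstance])
    (hf0U : ∀ᵐ p ∂μ, |f0 p.1| ≤ U)
    {fhat : (Fin N → (Fin T → Fin din → ℝ) × ℝ) → (Fin T → Fin din → ℝ) → ℝ}
    (hfhat : ∀ s, fhat s ∈ scalarClass din d ds L T U)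
    (herm : ∀ s, ∀ φ ∈ scalarClass din d ds L T U, empRisk s (fhat s) ≤ empRisk s φ)
    (hint : Integrable (fun s => risk μ (fhat s)) (Measure.pi fun _ : Fin N => μ))
    {ψ : (Fin T → Fin din → ℝ) → ℝ} (hψ : ψ ∈ scalarClass din d ds L T U) :
    ∫ s, (risk μ (fhat s) - risk μ f0) ∂(Measure.pi fun _ : Fin N => μ)
      ≤ 2 * (∫ p, (ψ p.1 - f0 p.1) ^ 2 ∂μ)
        + (6528 * T * (7 + 4 / σ) ^ 2 + (24 + 8 / σ) + 16 * |M| / σ)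
          * U ^ 5 * Real.log N ^ 5 * (N : ℝ)⁻¹ * (d : ℝ) ^ 2 * (L : ℝ) ^ 2
          * Real.log (max d L) := by
  have hd3 : (3 : ℝ) ≤ d := by exact_mod_cast hd
  have hL1 : (1 : ℝ) ≤ L := by exact_mod_cast hL
  have hT1 : (1 : ℝ) ≤ T := by exact_mod_cast hT
  have he3 : ∀ x : ℝ, 3 ≤ x → 1 ≤ Real.log x := fun x hx => by
    rw [Real.le_log_iff_exp_le (by linarith)]
    exact (Real.exp_one_lt_d9.le.trans (by norm_num)).trans hx
  set ℓ := Real.log (max (d : ℝ) L)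
  have hℓ : 1 ≤ ℓ := he3 _ (hd3.trans (le_max_left _ _))
  have hdL : 1 ≤ (d : ℝ) ^ 2 * (L : ℝ) ^ 2 * ℓ :=
    one_le_mul_of_one_le_of_one_le (one_le_mul_of_one_le_of_one_le
      (one_le_pow₀ (by linarith)) (one_le_pow₀ hL1)) hℓ
  have hdL2 : (d : ℝ) * L ≤ (d : ℝ) ^ 2 * (L : ℝ) ^ 2 * ℓ := by
    have h1 : 1 ≤ (d : ℝ) * L := by nlinarith
    calc (d : ℝ) * L ≤ (d * L) * (d * L) * 1 := by nlinarith
      _ ≤ (d * L) * (d * L) * ℓ := by gcongr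
      _ = _ := by ring
  have hTdL : (4 : ℝ) * T * (d * L) ≤ N := (mul_le_mul_of_nonneg_left hdL2 (by positivity)).trans hN
  have hdN : d ≤ N := by
    have : (d : ℝ) ≤ N := by nlinarith [mul_le_mul hT1 hL1 zero_le_one (by positivity)]
    exact_mod_cast this
  have hLN : L * T + 3 ≤ N := by
    have : (L : ℝ) * T + 3 ≤ N := by nlinarith [mul_le_mul hT1 hL1 zero_le_one (by positivity)]
    exact_mod_cast this
  have hN0 : 0 < N := by omega
  have hNR : (0 : ℝ) < N := by exact_mod_cast hN0
  have hlog : 1 ≤ Real.log N := he3 _ (hd3.trans (by exact_mod_cast hdN))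
  set lg := Real.log N
  have h := integral_erm_scalarClass_le (r := ⌈2 * U * N⌉₊) (δ := 1 / N) (B := lg / σ) hT hN0 hσ
    hexp hU (by positivity) (by positivity) (by rw [div_div_eq_mul_div, div_one]; exact Nat.le_ceil _)
    hf0 hf0U hfhat herm hint hψ
  refine h.trans (add_le_add le_rfl ?_)
  have hcell := log_netCellBound_class_le hdin hd hL hT hU hdN hLN hlog
  have hexpN : Real.exp (-(σ * (lg / σ))) = (N : ℝ)⁻¹ := by
    rw [mul_div_cancel₀ _ hσ.ne', Real.exp_neg, Real.exp_log hNR]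
  rw [hexpN]
  have hUl : ∀ a b : ℕ, a ≤ 5 → b ≤ 5 → U ^ a * lg ^ b ≤ U ^ 5 * lg ^ 5 := fun a b ha hb => by
    gcongr
  set Y := (d : ℝ) ^ 2 * (L : ℝ) ^ 2 * ℓ with hY
  have hY2 : (d : ℝ) ^ 2 * (L : ℝ) ^ 2 ≤ Y := le_mul_of_one_le_right (by positivity) hℓ
  have hB : 7 * U + 4 * (lg / σ) ≤ (7 + 4 / σ) * (U * lg) := by
    have e1 : U ≤ U * lg := le_mul_of_one_le_right (by linarith) hlog
    have e2 : lg ≤ U * lg := le_mul_of_one_le_left (by linarith) hU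
    calc 7 * U + 4 * (lg / σ) = 7 * U + (4 / σ) * lg := by ring
      _ ≤ 7 * (U * lg) + (4 / σ) * (U * lg) := by gcongr
      _ = _ := by ring
  have hB' : 24 * U + 8 * (lg / σ) ≤ (24 + 8 / σ) * (U * lg) := by
    have e1 : U ≤ U * lg := le_mul_of_one_le_right (by linarith) hlog
    have e2 : lg ≤ U * lg := le_mul_of_one_le_left (by linarith) hU
    calc 24 * U + 8 * (lg / σ) = 24 * U + (8 / σ) * lg := by ring
      _ ≤ 24 * (U * lg) + (8 / σ) * (U * lg) := by gcongr
      _ = _ := by ring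
  have hlog0 : 0 ≤ Real.log (netCellBound (Fintype.card (NetIdx din d L)) (L * T + 3) d L T (N + N)
      (⌈2 * U * N⌉₊ + 1)) := Real.log_natCast_nonneg _
  have t1 : 2 * (7 * U + 4 * (lg / σ)) ^ 2 * Real.log (netCellBound
      (Fintype.card (NetIdx din d L)) (L * T + 3) d L T (N + N) (⌈2 * U * N⌉₊ + 1)) / N
      ≤ 6528 * T * (7 + 4 / σ) ^ 2 * (U ^ 5 * lg ^ 5 * (N : ℝ)⁻¹ * Y) := by
    rw [div_eq_mul_inv]
    calc _ ≤ 2 * ((7 + 4 / σ) * (U * lg)) ^ 2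
          * (3264 * T * (L : ℝ) ^ 2 * (d : ℝ) ^ 2 * U ^ 2 * lg ^ 2) * (N : ℝ)⁻¹ := by gcongr
      _ = 6528 * T * (7 + 4 / σ) ^ 2 * ((U ^ 4 * lg ^ 4) * (N : ℝ)⁻¹
          * ((d : ℝ) ^ 2 * (L : ℝ) ^ 2)) := by ring
      _ ≤ 6528 * T * (7 + 4 / σ) ^ 2 * ((U ^ 5 * lg ^ 5) * (N : ℝ)⁻¹ * Y) := by
        gcongr ?_ * (?_ * _ * ?_)
        · exact hUl 4 4 (by norm_num) (by norm_num)
  have t2 : (24 * U + 8 * (lg / σ)) * (1 / N)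
      ≤ (24 + 8 / σ) * (U ^ 5 * lg ^ 5 * (N : ℝ)⁻¹ * Y) := by
    rw [one_div]
    calc _ ≤ (24 + 8 / σ) * (U * lg) * (N : ℝ)⁻¹ := by gcongr
      _ = (24 + 8 / σ) * (U ^ 1 * lg ^ 1 * (N : ℝ)⁻¹ * 1) := by ring
      _ ≤ _ := by
        gcongr ?_ * (?_ * _ * ?_)
        exact hUl 1 1 (by norm_num) (by norm_num)
  have t3 : 16 * U * ((∫ p, Real.exp (σ * |p.2|) ∂μ) * ((N : ℝ)⁻¹ / σ))
      ≤ 16 * |M| / σ * (U ^ 5 * lg ^ 5 * (N : ℝ)⁻¹ * Y) := by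
    calc _ ≤ 16 * U * (|M| * ((N : ℝ)⁻¹ / σ)) := by
          gcongr
          exact hM.trans (le_abs_self M)
      _ = 16 * |M| / σ * (U ^ 1 * lg ^ 0 * (N : ℝ)⁻¹ * 1) := by ring
      _ ≤ _ := by
        gcongr ?_ * (?_ * _ * ?_)
        exact hUl 1 0 (by norm_num) (by norm_num)
  calc _ ≤ _ := add_le_add (add_le_add t1 t2) t3
    _ = _ := by rw [hY]; ring

/-! ### Threshold-ReLU networks

Feedforward networks whose neurons are either ReLU units or Heaviside units; a Heaviside unit counts
twice towards the width, since it is a limit of differences of two ReLU units. -/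

/-- The Heaviside function. -/
noncomputable def heaviside (x : ℝ) : ℝ := if 0 ≤ x then 1 else 0

section Reach

variable {E : Type*}

/-- The affine span of a set of functions. -/
def affSpan (S : Set (E → ℝ)) : Submodule ℝ (E → ℝ) := Submodule.span ℝ (insert 1 S)

/-- The functions in `S'` can be computed by one layer of width `w` from those in `S`. -/
def IsLayer (w : ℕ) (S S' : Set (E → ℝ)) : Prop :=
  ∃ R H : Finset (E → ℝ), (R : Set (E → ℝ)) ⊆ affSpan S ∧ (H : Set (E → ℝ)) ⊆ affSpan S ∧
    R.card + 2 * H.card ≤ w ∧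
    S' ⊆ affSpan ((fun g : E → ℝ => relu ∘ g) '' R ∪ (fun g : E → ℝ => heaviside ∘ g) '' H)

/-- The functions in `S'` can be computed by `l` layers of width `w` from those in `S`. -/
def Reach (w : ℕ) : ℕ → Set (E → ℝ) → Set (E → ℝ) → Prop
  | 0, S, S' => S' ⊆ affSpan S
  | l + 1, S, S' => ∃ S₁, IsLayer w S S₁ ∧ Reach w l S₁ S'

variable {S S' S₁ S₂ A B : Set (E → ℝ)} {w w₁ w₂ l : ℕ} {f g : E → ℝ}

lemma subset_affSpan : S ⊆ affSpan S :=
  (Set.subset_insert _ _).trans Submodule.subset_span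

lemma mem_affSpan (h : f ∈ S) : f ∈ affSpan S := subset_affSpan h

lemma const_mem_affSpan (c : ℝ) : (fun _ => c) ∈ affSpan S := by
  have : (fun _ : E => c) = c • (1 : E → ℝ) := by ext; simp
  rw [this]
  exact Submodule.smul_mem _ _ (Submodule.subset_span (Set.mem_insert _ _))

lemma affSpan_le (h : S' ⊆ affSpan S) : affSpan S' ≤ affSpan S :=
  Submodule.span_le.2 (Set.insert_subset (const_mem_affSpan 1) h)

lemma affSpan_mono (h : S ⊆ S') : affSpan S ≤ affSpan S' :=
  affSpan_le (h.trans subset_affSpan)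

lemma add_mem_affSpan (hf : f ∈ affSpan S) (hg : g ∈ affSpan S) :
    (fun e => f e + g e) ∈ affSpan S := add_mem hf hg

lemma sub_mem_affSpan (hf : f ∈ affSpan S) (hg : g ∈ affSpan S) :
    (fun e => f e - g e) ∈ affSpan S := sub_mem hf hg

lemma mul_mem_affSpan (c : ℝ) (hf : f ∈ affSpan S) : (fun e => c * f e) ∈ affSpan S :=
  (affSpan S).smul_mem c hf

lemma sum_mem_affSpan {ι : Type*} {s : Finset ι} {f : ι → E → ℝ} (h : ∀ i ∈ s, f i ∈ affSpan S) :
    (fun e => ∑ i ∈ s, f i e) ∈ affSpan S := by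
  have := (affSpan S).sum_mem h
  convert this using 1
  ext e
  simp

lemma IsLayer.mono (h : IsLayer w S S') (hS : S ⊆ affSpan S₁) (hw : w ≤ w₁) :
    IsLayer w₁ S₁ S' := by
  obtain ⟨R, H, hR, hH, hc, h'⟩ := h
  exact ⟨R, H, hR.trans (affSpan_le hS), hH.trans (affSpan_le hS), hc.trans hw, h'⟩

lemma isLayer_of_families {η η' : Type*} [Fintype η] [Fintype η'] (g : η → E → ℝ)
    (g' : η' → E → ℝ) (hg : ∀ i, g i ∈ affSpan S) (hg' : ∀ i, g' i ∈ affSpan S)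
    (hw : Fintype.card η + 2 * Fintype.card η' ≤ w)
    (h : S' ⊆ affSpan (Set.range (fun i e => relu (g i e))
      ∪ Set.range (fun i e => heaviside (g' i e)))) :
    IsLayer w S S' := by
  classical
  refine ⟨Finset.univ.image g, Finset.univ.image g', by simpa [Set.range_subset_iff] using hg,
    by simpa [Set.range_subset_iff] using hg', le_trans ?_ hw, h.trans (affSpan_mono ?_)⟩
  · exact add_le_add Finset.card_image_le (Nat.mul_le_mul_left _ Finset.card_image_le)
  · refine Set.union_subset_union ?_ ?_ <;> rintro _ ⟨i, rfl⟩
    · exact ⟨g i, by simp, rfl⟩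
    · exact ⟨g' i, by simp, rfl⟩

lemma isLayer_of_relu {η : Type*} [Fintype η] (g : η → E → ℝ) (hg : ∀ i, g i ∈ affSpan S)
    (hw : Fintype.card η ≤ w) (h : S' ⊆ affSpan (Set.range fun i e => relu (g i e))) :
    IsLayer w S S' :=
  isLayer_of_families (η' := Empty) g (fun i => i.elim) hg (fun i => i.elim) (by simpa using hw)
    (h.trans (affSpan_mono Set.subset_union_left))

lemma IsLayer.union (h₁ : IsLayer w₁ S A) (h₂ : IsLayer w₂ S B) :
    IsLayer (w₁ + w₂) S (A ∪ B) := by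
  classical
  obtain ⟨R, H, hR, hH, hc, h⟩ := h₁
  obtain ⟨R', H', hR', hH', hc', h'⟩ := h₂
  refine ⟨R ∪ R', H ∪ H', by simp [hR, hR'], by simp [hH, hH'], ?_, Set.union_subset
    (h.trans (affSpan_mono ?_)) (h'.trans (affSpan_mono ?_))⟩
  · have := Finset.card_union_le R R'
    have := Finset.card_union_le H H'
    omega
  · exact Set.union_subset_union (Set.image_mono (by simp)) (Set.image_mono (by simp))
  · exact Set.union_subset_union (Set.image_mono (by simp)) (Set.image_mono (by simp))

lemma Reach.mono (h : Reach w l S S') (hS : S ⊆ affSpan S₁) (hS' : S₂ ⊆ affSpan S')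
    (hw : w ≤ w₁) : Reach w₁ l S₁ S₂ := by
  induction l generalizing S S₁ with
  | zero => exact hS'.trans ((affSpan_le h).trans (affSpan_le hS))
  | succ l ih =>
    obtain ⟨T, hT, hT'⟩ := h
    exact ⟨T, hT.mono hS hw, ih hT' subset_affSpan⟩

lemma Reach.trans {l' : ℕ} (h : Reach w l S S₁) (h' : Reach w l' S₁ S') :
    Reach w (l + l') S S' := by
  induction l generalizing S with
  | zero => rw [zero_add]; exact h'.mono h subset_affSpan le_rfl
  | succ l ih =>
    obtain ⟨T, hT, hT'⟩ := h
    rw [Nat.add_right_comm]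
    exact ⟨T, hT, ih hT'⟩

lemma Reach.union (h₁ : Reach w₁ l S A) (h₂ : Reach w₂ l S B) :
    Reach (w₁ + w₂) l S (A ∪ B) := by
  induction l generalizing S with
  | zero => exact Set.union_subset h₁ h₂
  | succ l ih =>
    obtain ⟨T, hT, hT'⟩ := h₁
    obtain ⟨T₂, hT₂, hT₂'⟩ := h₂
    exact ⟨T ∪ T₂, hT.union hT₂, ih
      (hT'.mono (Set.subset_union_left.trans subset_affSpan) subset_affSpan le_rfl)
      (hT₂'.mono (Set.subset_union_right.trans subset_affSpan) subset_affSpan le_rfl)⟩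

lemma IsLayer.reach (h : IsLayer w S S') : Reach w 1 S S' := ⟨S', h, subset_affSpan⟩

lemma relu_of_nonneg {x : ℝ} (hx : 0 ≤ x) : relu x = x := max_eq_left hx

lemma relu_of_nonpos {x : ℝ} (hx : x ≤ 0) : relu x = 0 := max_eq_right hx

lemma reach_carry {η : Type*} [Fintype η] {c : η → E → ℝ} (hc : ∀ i, c i ∈ affSpan S)
    (h0 : ∀ i e, 0 ≤ c i e) (l : ℕ) : Reach (Fintype.card η) l S (Set.range c) := by
  induction l generalizing S with
  | zero => exact Set.range_subset_iff.2 hc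
  | succ l ih =>
    refine ⟨Set.range c, isLayer_of_relu c hc le_rfl ?_, ih fun i => mem_affSpan ⟨i, rfl⟩⟩
    have : (fun i e => relu (c i e)) = c := by
      ext i e
      exact relu_of_nonneg (h0 i e)
    rw [this]
    exact subset_affSpan

lemma reach_carry_singleton (hf : f ∈ affSpan S) (h0 : ∀ e, 0 ≤ f e) (l : ℕ) :
    Reach 1 l S {f} := by
  simpa using reach_carry (c := fun _ : Unit => f) (fun _ => hf) (fun _ => h0) l

lemma reach_empty (l : ℕ) : Reach 0 l S ∅ := by
  have h := reach_carry (S := S) (c := (Empty.elim : Empty → E → ℝ)) (fun i => i.elim)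
    (fun i => i.elim) l
  rwa [Set.range_eq_empty, Fintype.card_empty] at h

lemma Reach.iUnion {ι : Type*} [Fintype ι] {A : ι → Set (E → ℝ)} (h : ∀ i, Reach w l S (A i)) :
    Reach (Fintype.card ι * w) l S (⋃ i, A i) := by
  classical
  have key : ∀ s : Finset ι, Reach (s.card * w) l S (⋃ i ∈ s, A i) := fun s => by
    induction s using Finset.induction_on with
    | empty => simpa using reach_empty l
    | insert a s ha ih =>
      rw [Finset.card_insert_of_notMem ha, Finset.set_biUnion_insert, add_mul, one_mul, add_comm]
      exact (h a).union ih
  simpa using key Finset.univ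

lemma reach_iterate {St : ℕ → Set (E → ℝ)} {n : ℕ} (h : ∀ i < n, Reach w l (St i) (St (i + 1))) :
    Reach w (n * l) (St 0) (St n) := by
  induction n with
  | zero => rw [zero_mul]; exact subset_affSpan
  | succ n ih =>
    rw [Nat.succ_mul]
    exact (ih fun i hi => h i (by omega)).trans (h n (by omega))

end Reach

/-! ### Digit expansions by threshold functions -/

lemma heaviside_of_nonneg {x : ℝ} (hx : 0 ≤ x) : heaviside x = 1 := if_pos hx

lemma heaviside_of_neg {x : ℝ} (hx : x < 0) : heaviside x = 0 := if_neg hx.not_ge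

lemma heaviside_nonneg (x : ℝ) : 0 ≤ heaviside x := by
  unfold heaviside; split_ifs <;> norm_num

lemma heaviside_natCast_sub (m n : ℕ) : heaviside ((m : ℝ) - n) = if n ≤ m then 1 else 0 := by
  unfold heaviside
  simp only [sub_nonneg, Nat.cast_le]

lemma sum_heaviside {y θ : ℝ} (hy : 0 ≤ y) (hθ : 0 < θ) (M : ℕ) :
    ∑ j ∈ Finset.range M, heaviside (y - (j + 1) * θ) = ((min ⌊y / θ⌋₊ M : ℕ) : ℝ) := by
  induction M with
  | zero => simp
  | succ M ih =>
    rw [Finset.sum_range_succ, ih]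
    have h : heaviside (y - (M + 1) * θ) = if M + 1 ≤ ⌊y / θ⌋₊ then 1 else 0 := by
      unfold heaviside
      congr 1
      rw [Nat.le_floor_iff (by positivity), le_div_iff₀ hθ, sub_nonneg]
      push_cast
      rfl
    rw [h]
    split_ifs with h1
    · rw [min_eq_right h1, min_eq_right (by omega)]; push_cast; ring
    · rw [min_eq_left (by omega), min_eq_left (by omega), add_zero]

/-- The leading base-`b` digit of a number in `[0, 1]`. -/
noncomputable def leadDigit (b : ℕ) (r : ℝ) : ℝ :=
  ∑ j ∈ Finset.range (b - 1), heaviside (b * r - (j + 1))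

/-- The first `l` base-`b` digits of a number in `[0, 1]`. -/
noncomputable def digitTrunc (b : ℕ) : ℕ → ℝ → ℝ
  | 0, _ => 0
  | l + 1, r => (leadDigit b r + digitTrunc b l (b * r - leadDigit b r)) / b

/-- The number left after shifting away the first `l` base-`b` digits. -/
noncomputable def digitTail (b : ℕ) : ℕ → ℝ → ℝ
  | 0, r => r
  | l + 1, r => digitTail b l (b * r - leadDigit b r)

/-- The number whose first `l` base-`b` digits are those of `r`, followed by those of `R`. -/
noncomputable def digitSplice (b : ℕ) : ℕ → ℝ → ℝ → ℝ
  | 0, _, R => R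
  | l + 1, r, R => (leadDigit b r + digitSplice b l (b * r - leadDigit b r) R) / b

section Digits

variable {b : ℕ} {r R : ℝ}

lemma leadDigit_eq (hr : 0 ≤ r) : leadDigit b r = ((min ⌊b * r⌋₊ (b - 1) : ℕ) : ℝ) := by
  have := sum_heaviside (y := b * r) (by positivity) one_pos (b - 1)
  simpa [leadDigit] using this

lemma leadDigit_nonneg (b : ℕ) (r : ℝ) : 0 ≤ leadDigit b r :=
  Finset.sum_nonneg fun _ _ => heaviside_nonneg _

lemma shift_mem_Icc (hb : 0 < b) (hr : r ∈ Set.Icc (0 : ℝ) 1) :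
    b * r - leadDigit b r ∈ Set.Icc (0 : ℝ) 1 := by
  rw [leadDigit_eq hr.1]
  have hb' : (1 : ℝ) ≤ b := by exact_mod_cast hb
  have h0 : 0 ≤ b * r := by have := hr.1; positivity
  have h1 := Nat.floor_le h0
  have h2 := Nat.lt_floor_add_one (b * r)
  rcases le_total ⌊b * r⌋₊ (b - 1) with h | h
  · rw [min_eq_left h]
    constructor <;> linarith
  · rw [min_eq_right h]
    have h3 : ((b - 1 : ℕ) : ℝ) ≤ ⌊b * r⌋₊ := by exact_mod_cast h
    rw [Nat.cast_sub hb, Nat.cast_one] at h3 ⊢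
    constructor
    · linarith
    · nlinarith [hr.2]

lemma leadDigit_digit_add {a : ℕ} (ha : a < b) {x : ℝ} (hx : x ∈ Set.Ico (0 : ℝ) 1) :
    leadDigit b ((a + x) / b) = a := by
  have hb : (0 : ℝ) < b := by exact_mod_cast (by omega : 0 < b)
  rw [leadDigit_eq (by have := hx.1; positivity), mul_div_cancel₀ _ hb.ne']
  have : ⌊(a : ℝ) + x⌋₊ = a := by
    rw [Nat.floor_eq_iff (by have := hx.1; positivity)]
    constructor <;> linarith [hx.1, hx.2]
  rw [this, min_eq_left (by omega)]

lemma exists_leadDigit_eq (hb : 0 < b) (hr : 0 ≤ r) : ∃ a < b, leadDigit b r = (a : ℕ) :=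
  ⟨_, by omega, leadDigit_eq hr⟩

lemma digitTail_mem_Icc (hb : 0 < b) (l : ℕ) (hr : r ∈ Set.Icc (0 : ℝ) 1) :
    digitTail b l r ∈ Set.Icc (0 : ℝ) 1 := by
  induction l generalizing r with
  | zero => exact hr
  | succ l ih => exact ih (shift_mem_Icc hb hr)

lemma digitTrunc_add_digitTail (hb : 0 < b) (l : ℕ) (r : ℝ) :
    digitTrunc b l r + digitTail b l r / (b : ℝ) ^ l = r := by
  have hb' : (b : ℝ) ≠ 0 := by exact_mod_cast hb.ne'
  induction l generalizing r with
  | zero => simp [digitTrunc, digitTail]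
  | succ l ih =>
    simp only [digitTrunc, digitTail]
    calc _ = (leadDigit b r + (digitTrunc b l (b * r - leadDigit b r)
          + digitTail b l (b * r - leadDigit b r) / (b : ℝ) ^ l)) / b := by
          field_simp
          ring
      _ = r := by
          rw [ih, add_sub_cancel, mul_div_cancel_left₀ _ hb']

lemma digitTrunc_nonneg (b l : ℕ) (r : ℝ) : 0 ≤ digitTrunc b l r := by
  induction l generalizing r with
  | zero => exact le_rfl
  | succ l ih => exact div_nonneg (add_nonneg (leadDigit_nonneg _ _) (ih _)) (Nat.cast_nonneg _)

lemma digitTrunc_le (hb : 0 < b) (l : ℕ) (hr : r ∈ Set.Icc (0 : ℝ) 1) : digitTrunc b l r ≤ r := by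
  have h := digitTrunc_add_digitTail hb l r
  have := (digitTail_mem_Icc hb l hr).1
  have : 0 ≤ digitTail b l r / (b : ℝ) ^ l := by positivity
  linarith

lemma digitTrunc_mem_Icc (hb : 0 < b) (l : ℕ) (hr : r ∈ Set.Icc (0 : ℝ) 1) :
    digitTrunc b l r ∈ Set.Icc (0 : ℝ) 1 :=
  ⟨digitTrunc_nonneg b l r, (digitTrunc_le hb l hr).trans hr.2⟩

lemma sub_digitTrunc_le (hb : 0 < b) (l : ℕ) (hr : r ∈ Set.Icc (0 : ℝ) 1) :
    r - digitTrunc b l r ≤ ((b : ℝ) ^ l)⁻¹ := by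
  have h := digitTrunc_add_digitTail hb l r
  have h1 := (digitTail_mem_Icc hb l hr).2
  have : digitTail b l r / (b : ℝ) ^ l ≤ ((b : ℝ) ^ l)⁻¹ := by
    rw [div_eq_mul_inv]
    exact mul_le_of_le_one_left (by positivity) h1
  linarith

lemma digitSplice_mem_Ico (hb : 0 < b) (l : ℕ) (hr : r ∈ Set.Icc (0 : ℝ) 1)
    (hR : R ∈ Set.Ico (0 : ℝ) 1) : digitSplice b l r R ∈ Set.Ico (0 : ℝ) 1 := by
  have hb' : (0 : ℝ) < b := by exact_mod_cast hb
  induction l generalizing r with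
  | zero => exact hR
  | succ l ih =>
    obtain ⟨h1, h2⟩ := ih (shift_mem_Icc hb hr)
    obtain ⟨a, ha, hd⟩ := exists_leadDigit_eq hb hr.1
    have ha' : (a : ℝ) + 1 ≤ b := by exact_mod_cast ha
    simp only [digitSplice]
    exact ⟨div_nonneg (by linarith [leadDigit_nonneg b r]) hb'.le,
      (div_lt_one hb').2 (by linarith)⟩

lemma digitTrunc_digitSplice (hb : 0 < b) (l : ℕ) (hr : r ∈ Set.Icc (0 : ℝ) 1)
    (hR : R ∈ Set.Ico (0 : ℝ) 1) :
    digitTrunc b l (digitSplice b l r R) = digitTrunc b l r ∧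
      digitTail b l (digitSplice b l r R) = R := by
  have hb' : (b : ℝ) ≠ 0 := by exact_mod_cast hb.ne'
  induction l generalizing r with
  | zero => exact ⟨rfl, rfl⟩
  | succ l ih =>
    have h1 := shift_mem_Icc hb hr
    have h2 := digitSplice_mem_Ico hb l h1 hR
    have h3 := ih h1
    obtain ⟨a, ha, hd⟩ := exists_leadDigit_eq hb hr.1
    simp only [digitSplice, digitTrunc, digitTail]
    rw [hd] at h2 h3 ⊢
    rw [leadDigit_digit_add ha h2, mul_div_cancel₀ _ hb', add_sub_cancel_left]
    exact ⟨by rw [h3.1], h3.2⟩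

end Digits

/-! ### Gadgets -/

section Gadgets

variable {E : Type*} {S S' : Set (E → ℝ)}

/-- A sum of `I * J` Heaviside functions is computed by `I` layers. -/
lemma reach_sum_heaviside {y : E → ℝ} (hy : y ∈ affSpan S) (hy0 : ∀ e, 0 ≤ y e) (θ : ℕ → ℝ)
    (I J : ℕ) :
    Reach (2 * J + 2) I S {y, fun e => ∑ j ∈ Finset.range (I * J), heaviside (y e - θ j)} := by
  have step : ∀ i < I, Reach (2 * J + 2) 1
      {y, fun e => ∑ j ∈ Finset.range (i * J), heaviside (y e - θ j)}
      {y, fun e => ∑ j ∈ Finset.range ((i + 1) * J), heaviside (y e - θ j)} := by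
    intro i _
    refine IsLayer.reach (isLayer_of_families (η := Bool) (η' := Fin J)
      (fun t => cond t y fun e => ∑ j ∈ Finset.range (i * J), heaviside (y e - θ j))
      (fun j e => y e - θ (i * J + j)) ?_ (fun j => ?_) (by simp; omega) ?_)
    · rintro (_ | _) <;> exact mem_affSpan (by simp)
    · exact sub_mem_affSpan (mem_affSpan (by simp)) (const_mem_affSpan _)
    · refine Set.insert_subset (mem_affSpan (.inl ⟨true, ?_⟩))
        (Set.singleton_subset_iff.2 ?_)
      · ext e; exact relu_of_nonneg (hy0 e)
      · have e1 : (fun e => ∑ j ∈ Finset.range ((i + 1) * J), heaviside (y e - θ j))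
            = fun e => relu (∑ j ∈ Finset.range (i * J), heaviside (y e - θ j))
              + ∑ j : Fin J, heaviside (y e - θ (i * J + j)) := by
          ext e
          rw [relu_of_nonneg (Finset.sum_nonneg fun _ _ => heaviside_nonneg _), add_mul, one_mul,
            Finset.sum_range_add, Fin.sum_univ_eq_sum_range (fun j => heaviside (y e - θ (i * J + j)))]
        rw [e1]
        exact add_mem_affSpan (mem_affSpan (.inl ⟨false, rfl⟩))
          (sum_mem_affSpan fun j _ => mem_affSpan (.inr ⟨j, rfl⟩))
  have h := reach_iterate step
  rw [mul_one] at h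
  refine h.mono (Set.insert_subset hy (Set.singleton_subset_iff.2 ?_)) subset_affSpan le_rfl
  simpa using const_mem_affSpan 0

/-- Two layers shift away the leading digit of `r` and add `c * (y * leadDigit r)`. -/
lemma reach_leadDigit {b : ℕ} (hb : 0 < b) {y r a : E → ℝ} (hy : ∀ e, y e ∈ Set.Icc (0 : ℝ) 1)
    (hr : ∀ e, r e ∈ Set.Icc (0 : ℝ) 1) (ha : ∀ e, 0 ≤ a e) (c : ℝ) :
    Reach (2 * b + 1) 2 {y, r, a} {y, fun e => b * r e - leadDigit b (r e),
      fun e => a e + c * (y e * leadDigit b (r e))} := by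
  set G : Fin 3 ⊕ Fin (b - 1) → E → ℝ := Sum.elim ![y, fun e => b * r e - leadDigit b (r e), a]
    (fun j e => y e + heaviside (b * r e - (j + 1)) - 1) with hG
  refine ⟨{y, r, a} ∪ Set.range fun (j : Fin (b - 1)) e => heaviside (b * r e - (j + 1)),
    isLayer_of_families (η := Fin 3) (η' := Fin (b - 1)) ![y, r, a]
      (fun j e => b * r e - (j + 1)) ?_ (fun j => ?_) (by simp; omega) ?_,
    IsLayer.reach (isLayer_of_relu G ?_
      (by simp; omega) ?_)⟩
  · intro i; fin_cases i <;> exact mem_affSpan (by simp)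
  · exact sub_mem_affSpan (mul_mem_affSpan _ (mem_affSpan (by simp))) (const_mem_affSpan _)
  · refine Set.union_subset ?_ (Set.subset_union_right.trans subset_affSpan)
    have h : ∀ i, (![y, r, a] : Fin 3 → E → ℝ) i ∈ affSpan
        (Set.range (fun i e => relu ((![y, r, a] : Fin 3 → E → ℝ) i e)) ∪
          Set.range fun (j : Fin (b - 1)) e => heaviside (b * r e - (j + 1))) := by
      intro i
      refine mem_affSpan (.inl ⟨i, ?_⟩)
      ext e
      fin_cases i
      · exact relu_of_nonneg (hy e).1
      · exact relu_of_nonneg (hr e).1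
      · exact relu_of_nonneg (ha e)
    exact Set.insert_subset (h 0) (Set.insert_subset (h 1) (Set.singleton_subset_iff.2 (h 2)))
  · rintro (i | j)
    · fin_cases i
      · exact mem_affSpan (.inl (.inl rfl))
      · refine sub_mem_affSpan (mul_mem_affSpan _ (mem_affSpan (by simp))) ?_
        simp only [leadDigit]
        refine sum_mem_affSpan fun j hj => mem_affSpan (.inr ⟨⟨j, by simpa using hj⟩, rfl⟩)
      · exact mem_affSpan (.inl (.inr (.inr rfl)))
    · exact sub_mem_affSpan (add_mem_affSpan (mem_affSpan (by simp)) (mem_affSpan (.inr ⟨j, rfl⟩)))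
        (const_mem_affSpan _)
  · set W := Set.range fun i e => relu (G i e) with hW
    have h1 : y ∈ affSpan W := mem_affSpan (⟨.inl 0, by ext e; exact relu_of_nonneg (hy e).1⟩)
    have h2 : (fun e => b * r e - leadDigit b (r e)) ∈ affSpan W := mem_affSpan
      (⟨.inl 1, by ext e; exact relu_of_nonneg (shift_mem_Icc hb (hr e)).1⟩)
    have h3 : a ∈ affSpan W := mem_affSpan (⟨.inl 2, by ext e; exact relu_of_nonneg (ha e)⟩)
    refine Set.insert_subset h1 (Set.insert_subset h2 (Set.singleton_subset_iff.2
      (add_mem_affSpan h3 (mul_mem_affSpan c ?_))))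
    have e1 : (fun e => y e * leadDigit b (r e)) = fun e =>
        ∑ j : Fin (b - 1), relu (y e + heaviside (b * r e - (j + 1)) - 1) := by
      ext e
      rw [leadDigit, ← Fin.sum_univ_eq_sum_range (fun j => heaviside (b * r e - (j + 1))),
        Finset.mul_sum]
      refine Finset.sum_congr rfl fun j _ => ?_
      unfold heaviside
      split_ifs
      · rw [add_sub_cancel_right, mul_one, relu_of_nonneg (hy e).1]
      · rw [mul_zero, relu_of_nonpos (by linarith [(hy e).2])]
    rw [e1]
    exact sum_mem_affSpan fun j _ => mem_affSpan (⟨.inr j, rfl⟩)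

/-- Multiplication of `y` by the first `l` digits of `r`. -/
lemma reach_digitTrunc {b : ℕ} (hb : 0 < b) {y r a : E → ℝ} (hy : ∀ e, y e ∈ Set.Icc (0 : ℝ) 1)
    (hr : ∀ e, r e ∈ Set.Icc (0 : ℝ) 1) (ha : ∀ e, 0 ≤ a e) {c : ℝ} (hc : 0 ≤ c) (l : ℕ) :
    Reach (2 * b + 1) (l * 2) {y, r, a} {y, fun e => digitTail b l (r e),
      fun e => a e + c * (y e * digitTrunc b l (r e))} := by
  induction l generalizing r a c with
  | zero =>
    rw [zero_mul]
    simp only [digitTail, digitTrunc, mul_zero, add_zero]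
    exact subset_affSpan
  | succ l ih =>
    rw [show (l + 1) * 2 = 2 + l * 2 by ring]
    have hc' : 0 ≤ c / b := by positivity
    refine (reach_leadDigit hb hy hr ha (c / b)).trans ?_
    have h := ih (fun e => shift_mem_Icc hb (hr e)) (fun e => add_nonneg (ha e) (mul_nonneg hc'
      (mul_nonneg (hy e).1 (leadDigit_nonneg b (r e))))) hc'
    have e1 : (fun e => a e + c * (y e * digitTrunc b (l + 1) (r e))) = fun e =>
        a e + c / b * (y e * leadDigit b (r e))
          + c / b * (y e * digitTrunc b l (b * r e - leadDigit b (r e))) := by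
      ext e
      simp only [digitTrunc]
      ring
    rw [e1]
    exact h

end Gadgets

/-! ### Table lookup -/

section Lookup

variable {E : Type*} {S S' : Set (E → ℝ)} {w l : ℕ}

lemma reach_relu {η : Type*} [Fintype η] {g : η → E → ℝ} (hg : ∀ i, g i ∈ affSpan S) :
    Reach (Fintype.card η) 1 S (Set.range fun i e => relu (g i e)) :=
  (isLayer_of_relu g hg le_rfl subset_affSpan).reach

lemma reach_heaviside {η : Type*} [Fintype η] {g : η → E → ℝ} (hg : ∀ i, g i ∈ affSpan S) :
    Reach (2 * Fintype.card η) 1 S (Set.range fun i e => heaviside (g i e)) :=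
  (isLayer_of_families (η := Empty) (fun i => i.elim) g (fun i => i.elim) hg (by simp)
    (Set.subset_union_right.trans subset_affSpan)).reach

lemma heaviside_sub_heaviside (u n : ℕ) :
    heaviside ((u : ℝ) - n) - heaviside ((u : ℝ) - (n + 1 : ℕ)) = if u = n then 1 else 0 := by
  rw [heaviside_natCast_sub, heaviside_natCast_sub]
  split_ifs <;> first | omega | norm_num

lemma sum_heaviside_natCast (m M θ : ℕ) (hθ : 0 < θ) (hm : m / θ ≤ M) :
    ∑ j ∈ Finset.range M, heaviside ((m : ℝ) - (j + 1) * θ) = (m / θ : ℕ) := by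
  rw [sum_heaviside (Nat.cast_nonneg m) (by exact_mod_cast hθ), Nat.floor_div_eq_div,
    min_eq_left hm]

lemma sum_relu_select {J : ℕ} {a : Fin J → ℝ} (ha : ∀ j, a j ∈ Set.Icc (0 : ℝ) 1) (q : Fin J) :
    ∑ j, relu (a j + (if (q : ℕ) = j then 1 else 0) - 1) = a q := by
  rw [Finset.sum_eq_single q]
  · rw [if_pos rfl, add_sub_cancel_right, relu_of_nonneg (ha q).1]
  · intro j _ hj
    rw [if_neg fun h => hj (Fin.ext h.symm), add_zero, relu_of_nonpos (by linarith [(ha j).2])]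
  · simp

/-- Lookup in a table with `I * J` rows and `J` columns. -/
lemma reach_select {I J : ℕ} {u q : E → ℕ} (hu : ∀ e, u e < I * J) (hq : ∀ e, q e < J)
    (huS : (fun e => (u e : ℝ)) ∈ affSpan S)
    (hqS : ∀ j : Fin J, (fun e => if q e = j then (1 : ℝ) else 0) ∈ affSpan S) {mem : ℕ → ℕ → ℝ}
    (hmem : ∀ i j, mem i j ∈ Set.Icc (0 : ℝ) 1) :
    Reach (4 * J + 4) (I * 2) S {fun e => mem (u e) (q e)} := by
  set uR : E → ℝ := fun e => u e
  set Q : Fin J → E → ℝ := fun j e => if q e = j then 1 else 0 with hQ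
  have hQ0 : ∀ j e, 0 ≤ Q j e := fun j e => by simp only [hQ]; split_ifs <;> norm_num
  set acc : ℕ → E → ℝ := fun i e => if u e < i * J then mem (u e) (q e) else 0 with hacc
  have hacc0 : ∀ i e, 0 ≤ acc i e := fun i e => by
    simp only [hacc]; split_ifs; exacts [(hmem _ _).1, le_rfl]
  set St : ℕ → Set (E → ℝ) := fun i => {acc i} ∪ ({uR} ∪ Set.range Q) with hSt
  have step : ∀ i < I, Reach (4 * J + 4) 2 (St i) (St (i + 1)) := by
    intro i _
    have hu' : uR ∈ affSpan (St i) := mem_affSpan (.inr (.inl rfl))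
    have hQ' : ∀ j, Q j ∈ affSpan (St i) := fun j => mem_affSpan (.inr (.inr ⟨j, rfl⟩))
    have ha' : acc i ∈ affSpan (St i) := mem_affSpan (.inl rfl)
    set Hv : Fin (J + 1) → E → ℝ := fun j e => heaviside (uR e - (i * J + j : ℕ)) with hHv
    have h1 : Reach (1 + (J + 2 * (J + 1))) 1 (St i) ({acc i} ∪ (Set.range Q ∪ Set.range Hv)) := by
      have h := (reach_carry_singleton ha' (hacc0 i) 1).union ((reach_carry hQ' hQ0 1).union
        (reach_heaviside (g := fun (j : Fin (J + 1)) e => uR e - (i * J + j : ℕ))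
          fun j => sub_mem_affSpan hu' (const_mem_affSpan _)))
      rwa [Fintype.card_fin, Fintype.card_fin] at h
    set S₁ : Set (E → ℝ) := {acc i} ∪ (Set.range Q ∪ Set.range Hv)
    set G : Fin J → E → ℝ := fun k e =>
      (∑ j : Fin J, mem (i * J + j) k * (Hv j.castSucc e - Hv j.succ e)) + Q k e - 1 with hG
    have hGS : ∀ k, G k ∈ affSpan S₁ := fun k => by
      refine sub_mem_affSpan (add_mem_affSpan (sum_mem_affSpan fun j _ => mul_mem_affSpan _
        (sub_mem_affSpan ?_ ?_)) ?_) (const_mem_affSpan _)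
      · exact mem_affSpan (.inr (.inr ⟨_, rfl⟩))
      · exact mem_affSpan (.inr (.inr ⟨_, rfl⟩))
      · exact mem_affSpan (.inr (.inl ⟨_, rfl⟩))
    have h2 : Reach (1 + J) 1 S₁ ({acc i} ∪ Set.range fun k e => relu (G k e)) := by
      simpa using (reach_carry_singleton (mem_affSpan (.inl rfl)) (hacc0 i) 1).union (reach_relu hGS)
    have e1 : acc (i + 1) = fun e => acc i e + ∑ k, relu (G k e) := by
      ext e
      have e2 : ∀ k : Fin J, ∑ j : Fin J, mem (i * J + j) k * (Hv j.castSucc e - Hv j.succ e)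
          = if i * J ≤ u e ∧ u e < (i + 1) * J then mem (u e) k else 0 := by
        intro k
        have e3 : ∀ j : Fin J, mem (i * J + j) k * (Hv j.castSucc e - Hv j.succ e)
            = if u e = i * J + j then mem (u e) k else 0 := by
          intro j
          have := heaviside_sub_heaviside (u e) (i * J + j)
          simp only [hHv, uR, Fin.val_castSucc, Fin.val_succ, ← add_assoc]
          rw [this]
          split_ifs with h
          · rw [h, mul_one]
          · rw [mul_zero]
        rw [Finset.sum_congr rfl fun j _ => e3 j]
        split_ifs with h
        · have hlt : u e - i * J < J := by
            have := h.2; rw [add_mul, one_mul] at this; omega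
          rw [Finset.sum_eq_single ⟨u e - i * J, hlt⟩]
          · rw [if_pos]; simp only; omega
          · intro j _ hj
            refine if_neg fun h' => hj (Fin.ext ?_)
            simp only; omega
          · simp
        · refine Finset.sum_eq_zero fun j _ => if_neg fun h' => h ?_
          have := j.2
          rw [add_mul, one_mul]; omega
      have e4 := sum_relu_select (a := fun k : Fin J =>
        if i * J ≤ u e ∧ u e < (i + 1) * J then mem (u e) k else 0)
        (fun k => by split_ifs; exacts [hmem _ _, ⟨le_rfl, zero_le_one⟩]) ⟨q e, hq e⟩
      simp only [hG, e2, hQ]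
      rw [e4]
      simp only [hacc, add_mul, one_mul]
      split_ifs <;> first | omega | simp
    have h3 : Reach (1 + (J + 2 * (J + 1))) 2 (St i) {acc (i + 1)} := by
      refine h1.trans (h2.mono subset_affSpan (Set.singleton_subset_iff.2 ?_) (by omega))
      rw [e1]
      exact add_mem_affSpan (mem_affSpan (.inl rfl))
        (sum_mem_affSpan fun k _ => mem_affSpan (.inr ⟨k, rfl⟩))
    have h4 : Reach (1 + J) 2 (St i) ({uR} ∪ Set.range Q) := by
      simpa using (reach_carry_singleton hu' (fun e => Nat.cast_nonneg _) 2).union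
        (reach_carry hQ' hQ0 2)
    exact (h3.union h4).mono subset_affSpan subset_affSpan (by omega)
  refine (reach_iterate step).mono ?_ ?_ le_rfl
  · refine Set.union_subset (Set.singleton_subset_iff.2 ?_) (Set.union_subset
      (Set.singleton_subset_iff.2 huS) (Set.range_subset_iff.2 hqS))
    have : acc 0 = fun _ => 0 := by ext e; simp [hacc]
    rw [this]
    exact const_mem_affSpan 0
  · refine Set.singleton_subset_iff.2 (mem_affSpan (.inl ?_))
    ext e
    simp [hacc, hu e]

/-- A sequence of `n` numbers in `[0, 1]`, each truncated to `l` digits, encoded in one number. -/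
noncomputable def digitEncode (b l : ℕ) : ℕ → (ℕ → ℝ) → ℝ
  | 0, _ => 0
  | n + 1, c => digitSplice b l (c 0) (digitEncode b l n fun i => c (i + 1))

lemma digitEncode_mem_Ico {b : ℕ} (hb : 0 < b) (l n : ℕ) {c : ℕ → ℝ}
    (hc : ∀ i, c i ∈ Set.Icc (0 : ℝ) 1) : digitEncode b l n c ∈ Set.Ico (0 : ℝ) 1 := by
  induction n generalizing c with
  | zero => exact ⟨le_rfl, one_pos⟩
  | succ n ih => exact digitSplice_mem_Ico hb l (hc 0) (ih fun i => hc _)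

/-- Reading the entry with index `⌊w / J⌋` of an encoded sequence. -/
lemma reach_decode {b l I J : ℕ} (hb : 0 < b) (hJ : 0 < J) {w : E → ℕ} (hw : ∀ e, w e < I * J)
    (hwS : (fun e => (w e : ℝ)) ∈ affSpan S) {c : E → ℕ → ℝ} (hc : ∀ e i, c e i ∈ Set.Icc (0 : ℝ) 1)
    (hcS : (fun e => digitEncode b l I (c e)) ∈ affSpan S) :
    Reach (2 * b + 7) (I * (1 + l * 2)) S {fun e => digitTrunc b l (c e (w e / J))} := by
  set wR : E → ℝ := fun e => w e
  have hw0 : ∀ e, 0 ≤ wR e := fun e => Nat.cast_nonneg _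
  set r : ℕ → E → ℝ := fun v e => digitEncode b l (I - v) fun i => c e (v + i) with hr
  have hr' : ∀ v e, r v e ∈ Set.Ico (0 : ℝ) 1 := fun v e => digitEncode_mem_Ico hb l _ fun i => hc _ _
  set a : ℕ → E → ℝ := fun v e => if w e < v * J then digitTrunc b l (c e (w e / J)) else 0 with ha
  have ha0 : ∀ v e, 0 ≤ a v e := fun v e => by
    simp only [ha]; split_ifs; exacts [digitTrunc_nonneg _ _ _, le_rfl]
  have step : ∀ v < I, Reach (2 * b + 7) (1 + l * 2) ({wR} ∪ {r v, a v})
      ({wR} ∪ {r (v + 1), a (v + 1)}) := by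
    intro v hv
    have hwS' : wR ∈ affSpan ({wR} ∪ {r v, a v}) := mem_affSpan (.inl rfl)
    set y : E → ℝ := fun e => heaviside (wR e - (v * J : ℕ)) - heaviside (wR e - ((v + 1) * J : ℕ))
      with hy
    have hye : ∀ e, y e = if v * J ≤ w e ∧ w e < (v + 1) * J then 1 else 0 := by
      intro e
      simp only [hy, wR, heaviside_natCast_sub, add_mul, one_mul]
      split_ifs <;> first | omega | norm_num
    have hy01 : ∀ e, y e ∈ Set.Icc (0 : ℝ) 1 := fun e => by
      rw [hye]; split_ifs <;> simp
    have h1 : Reach (2 * 2 + 2) 1 ({wR} ∪ {r v, a v}) {y, r v, a v} := by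
      have h := (reach_heaviside (η := Bool) (S := {wR} ∪ {r v, a v}) (g := fun t e => wR e -
        cond t (v * J : ℕ) ((v + 1) * J : ℕ)) fun t => sub_mem_affSpan hwS' (const_mem_affSpan _)).union
        (reach_carry (η := Bool) (c := fun t => cond t (r v) (a v)) (S := {wR} ∪ {r v, a v})
          (by rintro (_ | _) <;> exact mem_affSpan (by simp))
          (by rintro (_ | _) e; exacts [ha0 v e, (hr' v e).1]) 1)
      refine h.mono subset_affSpan ?_ (by simp)
      refine Set.insert_subset (sub_mem_affSpan (mem_affSpan (.inl ⟨true, ?_⟩))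
        (mem_affSpan (.inl ⟨false, ?_⟩))) (Set.insert_subset (mem_affSpan (.inr ⟨true, rfl⟩))
        (Set.singleton_subset_iff.2 (mem_affSpan (.inr ⟨false, rfl⟩))))
      · simp
      · simp
    have h2 := reach_digitTrunc hb hy01 (fun e => Set.Ico_subset_Icc_self (hr' v e)) (ha0 v)
      zero_le_one l
    have hI : I - v = (I - (v + 1)) + 1 := by omega
    have hdec : ∀ e, digitTrunc b l (r v e) = digitTrunc b l (c e v) ∧
        digitTail b l (r v e) = r (v + 1) e := by
      intro e
      have h := digitTrunc_digitSplice hb l (hc e v) (digitEncode_mem_Ico hb l (I - (v + 1))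
        (c := fun i => c e (v + (i + 1))) fun i => hc _ _)
      simp only [hr, hI, digitEncode, add_zero]
      refine ⟨h.1, ?_⟩
      rw [h.2]
      congr 1
      ext i
      congr 1
      omega
    have e1 : (fun e => digitTail b l (r v e)) = r (v + 1) := by
      ext e; exact (hdec e).2
    have e2 : (fun e => a v e + 1 * (y e * digitTrunc b l (r v e))) = a (v + 1) := by
      ext e
      rw [one_mul, hye, (hdec e).1]
      simp only [ha]
      by_cases h : v * J ≤ w e ∧ w e < (v + 1) * J
      · have : w e / J = v := by
          rw [Nat.div_eq_iff hJ]
          rw [add_mul, one_mul] at h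
          omega
        rw [if_pos h, if_neg (by omega), if_pos h.2, this]
        ring
      · rw [if_neg h, zero_mul, add_zero]
        rw [add_mul, one_mul] at *
        split_ifs <;> first | omega | rfl
    rw [e1, e2] at h2
    have h3 : Reach (2 * b + 6) (1 + l * 2) ({wR} ∪ {r v, a v}) {r (v + 1), a (v + 1)} :=
      (h1.mono subset_affSpan subset_affSpan (by omega)).trans
        (h2.mono subset_affSpan ((Set.subset_insert _ _).trans subset_affSpan) (by omega))
    exact ((reach_carry_singleton hwS' hw0 _).union h3).mono subset_affSpan subset_affSpan
      (by omega)
  refine (reach_iterate (St := fun v => {wR} ∪ {r v, a v}) step).mono ?_ ?_ le_rfl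
  · refine Set.union_subset (Set.singleton_subset_iff.2 hwS) (Set.insert_subset ?_
      (Set.singleton_subset_iff.2 ?_))
    · simpa [hr] using hcS
    · have : a 0 = fun _ => 0 := by ext e; simp [ha]
      rw [this]
      exact const_mem_affSpan 0
  · refine Set.singleton_subset_iff.2 (mem_affSpan (.inr (.inr ?_)))
    ext e
    simp [ha, hw e]

/-- Lookup in a table with `(I * J) ^ 2` entries. -/
lemma reach_lookup {b l I J : ℕ} (hb : 0 < b) (hI : 0 < I) (hJ : 0 < J) {m : E → ℕ}
    (hm : ∀ e, m e < (I * J) * (I * J)) (hmS : (fun e => (m e : ℝ)) ∈ affSpan S) {tab : ℕ → ℝ}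
    (htab : ∀ i, tab i ∈ Set.Icc (0 : ℝ) 1) :
    Reach (4 * J + 2 * b + 8) (I + (I + (1 + (I * 2 + I * (1 + l * 2))))) S
      {fun e => digitTrunc b l (tab (m e))} := by
  set M := I * J with hM
  have hM0 : 0 < M := Nat.mul_pos hI hJ
  set u : E → ℕ := fun e => m e / M
  set w : E → ℕ := fun e => m e % M
  set q : E → ℕ := fun e => w e % J
  have huM : ∀ e, u e < M := fun e => Nat.div_lt_of_lt_mul (hm e)
  have hwM : ∀ e, w e < M := fun e => Nat.mod_lt _ hM0
  have hqJ : ∀ e, q e < J := fun e => Nat.mod_lt _ hJ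
  have h1 : Reach (2 * J + 2) I S {fun e => (m e : ℝ), fun e => (u e : ℝ)} := by
    have h := reach_sum_heaviside hmS (fun e => Nat.cast_nonneg _) (fun j => ((j : ℝ) + 1) * M) I J
    have : (fun e => ∑ j ∈ Finset.range (I * J), heaviside ((m e : ℝ) - ((j : ℝ) + 1) * M))
        = fun e => (u e : ℝ) := by
      ext e; exact sum_heaviside_natCast _ _ _ hM0 (huM e).le
    rwa [this] at h
  have hwS : (fun e => (w e : ℝ)) ∈ affSpan {fun e => (m e : ℝ), fun e => (u e : ℝ)} := by
    have : (fun e => (w e : ℝ)) = fun e => (m e : ℝ) - M * (u e : ℝ) := by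
      ext e
      have := Nat.div_add_mod (m e) M
      rw [eq_sub_iff_add_eq']
      exact_mod_cast this
    rw [this]
    exact sub_mem_affSpan (mem_affSpan (by simp)) (mul_mem_affSpan _ (mem_affSpan (by simp)))
  have h2 : Reach (2 * 1 + 2 + 1) I {fun e => (m e : ℝ), fun e => (u e : ℝ)}
      ({fun e => (w e : ℝ), fun e => ((w e / J : ℕ) : ℝ)} ∪ {fun e => (u e : ℝ)}) := by
    have h := reach_sum_heaviside hwS (fun e => Nat.cast_nonneg _) (fun j => ((j : ℝ) + 1) * J) I 1
    have : (fun e => ∑ j ∈ Finset.range (I * 1), heaviside ((w e : ℝ) - ((j : ℝ) + 1) * J))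
        = fun e => ((w e / J : ℕ) : ℝ) := by
      ext e
      exact sum_heaviside_natCast _ _ _ hJ ((Nat.div_lt_of_lt_mul
        (by rw [mul_one, mul_comm]; exact hwM e)).le)
    rw [this] at h
    exact h.union (reach_carry_singleton (mem_affSpan (by simp)) (fun e => Nat.cast_nonneg _) _)
  set S₂ : Set (E → ℝ) := {fun e => (w e : ℝ), fun e => ((w e / J : ℕ) : ℝ)} ∪ {fun e => (u e : ℝ)}
  have hqS : (fun e => (q e : ℝ)) ∈ affSpan S₂ := by
    have : (fun e => (q e : ℝ)) = fun e => (w e : ℝ) - J * ((w e / J : ℕ) : ℝ) := by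
      ext e
      have := Nat.div_add_mod (w e) J
      rw [eq_sub_iff_add_eq']
      exact_mod_cast this
    rw [this]
    exact sub_mem_affSpan (mem_affSpan (.inl (.inl rfl)))
      (mul_mem_affSpan _ (mem_affSpan (.inl (.inr rfl))))
  set Hv : Fin (J + 1) → E → ℝ := fun j e => heaviside ((q e : ℝ) - (j : ℕ))
  have h3 : Reach (1 + (1 + 2 * (J + 1))) 1 S₂ ({fun e => (w e : ℝ)} ∪ ({fun e => (u e : ℝ)} ∪
      Set.range Hv)) := by
    simpa using (reach_carry_singleton (mem_affSpan (.inl (.inl rfl)))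
      (fun e => Nat.cast_nonneg _) 1).union ((reach_carry_singleton (mem_affSpan (.inr rfl))
      (fun e => Nat.cast_nonneg _) 1).union (reach_heaviside
        (g := fun (j : Fin (J + 1)) e => (q e : ℝ) - (j : ℕ))
        fun j => sub_mem_affSpan hqS (const_mem_affSpan _)))
  set S₃ : Set (E → ℝ) := {fun e => (w e : ℝ)} ∪ ({fun e => (u e : ℝ)} ∪ Set.range Hv)
  have hmem : ∀ i j, digitEncode b l I (fun v => tab (i * M + v * J + j)) ∈ Set.Icc (0 : ℝ) 1 :=
    fun i j => Set.Ico_subset_Icc_self (digitEncode_mem_Ico hb l I fun _ => htab _)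
  have h4 : Reach (4 * J + 4) (I * 2) S₃
      {fun e => digitEncode b l I (fun v => tab (u e * M + v * J + q e))} := by
    refine reach_select (mem := fun i j => digitEncode b l I (fun v => tab (i * M + v * J + j)))
      huM hqJ (mem_affSpan (.inr (.inl rfl))) (fun j => ?_) hmem
    have : (fun e => if q e = j then (1 : ℝ) else 0) = fun e => Hv j.castSucc e - Hv j.succ e := by
      ext e
      rw [← heaviside_sub_heaviside]
      simp [Hv]
    rw [this]
    exact sub_mem_affSpan (mem_affSpan (.inr (.inr ⟨_, rfl⟩))) (mem_affSpan (.inr (.inr ⟨_, rfl⟩)))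
  have h5 := (reach_carry_singleton (S := S₃) (mem_affSpan (.inl rfl))
    (fun e => Nat.cast_nonneg _) (I * 2)).union h4
  have h6 := reach_decode (l := l) hb hJ hwM (mem_affSpan (.inl rfl)) (fun e i => htab _)
    (mem_affSpan (S := {fun e => (w e : ℝ)} ∪
      {fun e => digitEncode b l I (fun v => tab (u e * M + v * J + q e))}) (.inr rfl))
  have e1 : (fun e => digitTrunc b l (tab (u e * M + w e / J * J + q e)))
      = fun e => digitTrunc b l (tab (m e)) := by
    ext e
    congr 2
    have a1 := Nat.div_add_mod (m e) M
    have a2 := Nat.div_add_mod (w e) J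
    rw [mul_comm] at a1 a2
    simp only [u, q, w] at a2 ⊢
    omega
  rw [e1] at h6
  exact (h1.mono subset_affSpan subset_affSpan (by omega)).trans
    ((h2.mono subset_affSpan subset_affSpan (by omega)).trans
    ((h3.mono subset_affSpan subset_affSpan (by omega)).trans
    ((h5.mono subset_affSpan subset_affSpan (by omega)).trans
    (h6.mono subset_affSpan subset_affSpan (by omega)))))

end Lookup

/-! ### Localized monomials -/

/-- The index of the cell of the uniform partition of `[0, 1]` into `K` cells containing `t`. -/
noncomputable def cellIdx (K : ℕ) (t : ℝ) : ℕ := min ⌊K * t⌋₊ (K - 1)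

/-- The relative position of `t` within its cell. -/
noncomputable def cellPos (K : ℕ) (t : ℝ) : ℝ := K * t - cellIdx K t

lemma cellIdx_lt {K : ℕ} (hK : 0 < K) (t : ℝ) : cellIdx K t < K :=
  (min_le_right _ _).trans_lt (by omega)

lemma cellPos_mem_Icc {K : ℕ} (hK : 0 < K) {t : ℝ} (ht : t ∈ Set.Icc (0 : ℝ) 1) :
    cellPos K t ∈ Set.Icc (0 : ℝ) 1 := by
  have h0 : 0 ≤ K * t := mul_nonneg (Nat.cast_nonneg _) ht.1
  have h1 : K * t ≤ K := mul_le_of_le_one_right (Nat.cast_nonneg _) ht.2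
  have hf := Nat.floor_le h0
  have hl := Nat.lt_floor_add_one (K * t)
  unfold cellPos cellIdx
  rcases le_total ⌊K * t⌋₊ (K - 1) with h | h
  · rw [min_eq_left h]
    constructor <;> linarith
  · rw [min_eq_right h]
    have h3 : ((K - 1 : ℕ) : ℝ) ≤ ⌊K * t⌋₊ := by exact_mod_cast h
    rw [Nat.cast_sub (by omega : 1 ≤ K), Nat.cast_one] at h3 ⊢
    constructor <;> linarith

section Chain

variable {E C : Type*} {S : Set (E → ℝ)} {b l I J K : ℕ}

lemma reach_cell {x : E → ℝ} (hxS : x ∈ affSpan S) (hx : ∀ e, x e ∈ Set.Icc (0 : ℝ) 1)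
    (hI : 0 < I) (hJ : 0 < J) (hK : 0 < K) (hKM : K ≤ (I * J) * (I * J)) :
    Reach (2 * J + 4) (I + (I + 1)) S
      {fun e => (cellIdx K (x e) : ℝ), fun e => cellPos K (x e)} := by
  set M := I * J with hM
  have hM0 : (0 : ℝ) < M := by exact_mod_cast Nat.mul_pos hI hJ
  set y : E → ℝ := fun e => K * x e with hy
  have hy0 : ∀ e, 0 ≤ y e := fun e => mul_nonneg (Nat.cast_nonneg _) (hx e).1
  have hyK : ∀ e, y e ≤ K := fun e => mul_le_of_le_one_right (Nat.cast_nonneg _) (hx e).2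
  set g : E → ℝ := fun e => (⌊y e / M⌋₊ : ℝ) with hg
  have h1 : Reach (2 * J + 2) I S {y, g} := by
    have h := reach_sum_heaviside (mul_mem_affSpan (K : ℝ) hxS) hy0 (fun j => ((j : ℝ) + 1) * M) I J
    have e1 : (fun e => ∑ j ∈ Finset.range (I * J), heaviside (y e - ((j : ℝ) + 1) * M)) = g := by
      ext e
      rw [sum_heaviside (hy0 e) hM0, min_eq_left]
      refine Nat.floor_le_of_le ?_
      rw [div_le_iff₀ hM0]
      exact (hyK e).trans (by exact_mod_cast hKM)
    rwa [e1] at h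
  set v : E → ℝ := fun e => y e - M * g e with hv
  have hv0 : ∀ e, 0 ≤ v e := fun e => by
    have := Nat.floor_le (div_nonneg (hy0 e) hM0.le)
    rw [le_div_iff₀ hM0] at this
    simp only [hv, hg]; linarith
  have hvM : ∀ e, v e < M := fun e => by
    have := Nat.lt_floor_add_one (y e / M)
    rw [div_lt_iff₀ hM0] at this
    simp only [hv, hg]; linarith
  set f : E → ℝ := fun e => (⌊v e⌋₊ : ℝ) with hf
  have h2 : Reach (2 * J + 2 + 1) I {y, g} ({v, f} ∪ {g}) := by
    have h := reach_sum_heaviside (S := {y, g}) (sub_mem_affSpan (mem_affSpan (by simp))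
      (mul_mem_affSpan (M : ℝ) (mem_affSpan (by simp)))) hv0 (fun j => (j : ℝ) + 1) I J
    have e1 : (fun e => ∑ j ∈ Finset.range (I * J), heaviside (v e - ((j : ℝ) + 1))) = f := by
      ext e
      have := sum_heaviside (hv0 e) one_pos M
      simp only [mul_one, div_one] at this
      rw [this, min_eq_left]
      exact Nat.floor_le_of_le (hvM e).le
    rw [e1] at h
    exact h.union (reach_carry_singleton (f := g) (mem_affSpan (.inr rfl))
      (fun e => Nat.cast_nonneg _) _)
  have e2 : (fun e => (⌊y e⌋₊ : ℝ)) = fun e => M * g e + f e := by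
    ext e
    have : y e = v e + ((M * ⌊y e / M⌋₊ : ℕ) : ℝ) := by simp [hv, hg]
    rw [this, Nat.floor_add_natCast (hv0 e)]
    simp only [hf, hg]
    push_cast
    ring
  have e3 : y = fun e => M * g e + v e := by ext e; simp [hv]
  set S₂ : Set (E → ℝ) := {v, f} ∪ {g}
  have hgS : g ∈ affSpan S₂ := mem_affSpan (by simp [S₂])
  have hyS : y ∈ affSpan S₂ := by
    rw [e3]
    exact add_mem_affSpan (mul_mem_affSpan _ hgS) (mem_affSpan (by simp [S₂]))
  have hfS : (fun e => (⌊y e⌋₊ : ℝ)) ∈ affSpan S₂ := by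
    rw [e2]
    exact add_mem_affSpan (mul_mem_affSpan _ hgS) (mem_affSpan (by simp [S₂]))
  have h3 : Reach (1 + (1 + 2)) 1 S₂ {fun e => (cellIdx K (x e) : ℝ), fun e => cellPos K (x e)} := by
    have h := (reach_carry_singleton hyS hy0 1).union ((reach_carry_singleton hfS
      (fun e => Nat.cast_nonneg _) 1).union (reach_heaviside (η := Unit) (S := S₂)
        (g := fun _ e => y e - K) fun _ => sub_mem_affSpan hyS (const_mem_affSpan _)))
    have e4 : (fun e => (cellIdx K (x e) : ℝ)) = fun e => (⌊y e⌋₊ : ℝ) - heaviside (y e - K) := by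
      ext e
      by_cases h : (K : ℝ) ≤ y e
      · have : y e = K := le_antisymm (hyK e) h
        rw [heaviside_of_nonneg (by linarith)]
        change ((min ⌊y e⌋₊ (K - 1) : ℕ) : ℝ) = _
        rw [this, Nat.floor_natCast, min_eq_right (by omega), Nat.cast_sub hK, Nat.cast_one]
      · rw [heaviside_of_neg (by linarith)]
        change ((min ⌊y e⌋₊ (K - 1) : ℕ) : ℝ) = _
        have : ⌊y e⌋₊ < K := (Nat.floor_lt (hy0 e)).2 (not_le.1 h)
        rw [min_eq_left (by omega), sub_zero]
    set S₃ := ({y} ∪ ({fun e => (⌊y e⌋₊ : ℝ)} ∪ Set.range fun (_ : Unit) e => heaviside (y e - K)) :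
      Set (E → ℝ))
    have h5 : (fun e => (cellIdx K (x e) : ℝ)) ∈ affSpan S₃ := by
      rw [e4]
      exact sub_mem_affSpan (mem_affSpan (.inr (.inl rfl))) (mem_affSpan (.inr (.inr ⟨(), rfl⟩)))
    exact h.mono subset_affSpan (Set.insert_subset h5 (Set.singleton_subset_iff.2
      (sub_mem_affSpan (mem_affSpan (.inl rfl)) h5))) (by simp)
  exact (h1.mono subset_affSpan subset_affSpan (by omega)).trans
    ((h2.mono subset_affSpan subset_affSpan (by omega)).trans
    (h3.mono subset_affSpan subset_affSpan (by omega)))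

lemma reach_prod_digitTrunc [Fintype C] (hb : 0 < b) {z : C → E → ℝ}
    (hz : ∀ c e, z c e ∈ Set.Icc (0 : ℝ) 1) (p : List C) {y : E → ℝ}
    (hy : ∀ e, y e ∈ Set.Icc (0 : ℝ) 1) :
    Reach (2 * b + 1 + Fintype.card C) (p.length * (l * 2)) ({y} ∪ Set.range z)
      {fun e => y e * (p.map fun c => digitTrunc b l (z c e)).prod} := by
  induction p generalizing y with
  | nil =>
    rw [List.length_nil, zero_mul]
    refine Set.singleton_subset_iff.2 ?_
    simpa using mem_affSpan (f := y) (S := {y} ∪ Set.range z) (.inl rfl)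
  | cons c p ih =>
    set y' : E → ℝ := fun e => y e * digitTrunc b l (z c e) with hy'
    have hy'1 : ∀ e, y' e ∈ Set.Icc (0 : ℝ) 1 := fun e =>
      have h := digitTrunc_mem_Icc hb l (hz c e)
      ⟨mul_nonneg (hy e).1 h.1, mul_le_one₀ (hy e).2 h.1 h.2⟩
    have h1 := (reach_digitTrunc hb hy (hz c) (a := fun _ => 0) (fun _ => le_rfl)
      zero_le_one l).mono (S₁ := {y} ∪ Set.range z) (S₂ := {y'}) (w₁ := 2 * b + 1)
      (Set.insert_subset (mem_affSpan (.inl rfl)) (Set.insert_subset (mem_affSpan (.inr ⟨c, rfl⟩))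
        (Set.singleton_subset_iff.2 (const_mem_affSpan 0))))
      (Set.singleton_subset_iff.2 (mem_affSpan (by simp [hy']))) le_rfl
    have h2 := h1.union (reach_carry (c := z) (S := {y} ∪ Set.range z)
      (fun i => mem_affSpan (.inr ⟨i, rfl⟩)) (fun i e => (hz i e).1) (l * 2))
    have h3 := h2.trans (ih hy'1)
    rw [List.length_cons, add_mul, one_mul, add_comm (p.length * (l * 2))]
    simpa only [List.map_cons, List.prod_cons, mul_assoc, hy'] using h3

/-- A coefficient depending on the cell of `x`, multiplied by a monomial in the relative position
of `x` within its cell; all factors are truncated to `l` digits. -/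
lemma reach_chain [Fintype C] [Nonempty C] {x : C → E → ℝ} (hxS : ∀ c, x c ∈ affSpan S)
    (hx : ∀ c e, x c e ∈ Set.Icc (0 : ℝ) 1) (hb : 0 < b) (hI : 0 < I) (hJ : 0 < J) (hK : 0 < K)
    (hKM : K ^ Fintype.card C ≤ (I * J) * (I * J)) {tab : (C → ℕ) → ℝ}
    (htab : ∀ κ, tab κ ∈ Set.Icc (0 : ℝ) 1) (p : List C) :
    Reach (Fintype.card C * (2 * J + 4) + (4 * J + 2 * b + 8))
      (I + (I + 1) + (I + (I + (1 + (I * 2 + I * (1 + l * 2)))) + p.length * (l * 2))) S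
      {fun e => digitTrunc b l (tab fun c => cellIdx K (x c e)) *
        (p.map fun c => digitTrunc b l (cellPos K (x c e))).prod} := by
  set n := Fintype.card C with hn
  have hn0 : 0 < n := Fintype.card_pos
  have h1 := Reach.iUnion fun c => reach_cell (hxS c) (hx c) hI hJ hK
    ((Nat.le_self_pow hn0.ne' K).trans hKM)
  set S₁ : Set (E → ℝ) := ⋃ c, {fun e => (cellIdx K (x c e) : ℝ), fun e => cellPos K (x c e)}
  have hκ : ∀ c, (fun e => (cellIdx K (x c e) : ℝ)) ∈ affSpan S₁ := fun c =>
    mem_affSpan (Set.mem_iUnion.2 ⟨c, by simp⟩)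
  have hz : ∀ c, (fun e => cellPos K (x c e)) ∈ affSpan S₁ := fun c =>
    mem_affSpan (Set.mem_iUnion.2 ⟨c, by simp⟩)
  have hz1 : ∀ c e, cellPos K (x c e) ∈ Set.Icc (0 : ℝ) 1 := fun c e => cellPos_mem_Icc hK (hx c e)
  let eqv : (C → Fin K) ≃ Fin (K ^ n) :=
    (Equiv.arrowCongr (Fintype.equivFin C) (Equiv.refl _)).trans finFunctionFinEquiv
  set k : E → C → Fin K := fun e c => ⟨cellIdx K (x c e), cellIdx_lt hK _⟩ with hk
  set m : E → ℕ := fun e => eqv (k e) with hm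
  set tab' : ℕ → ℝ := fun i => if h : i < K ^ n then tab fun c => eqv.symm ⟨i, h⟩ c else 0 with htab'
  have hmS : (fun e => (m e : ℝ)) ∈ affSpan S₁ := by
    have : (fun e => (m e : ℝ)) = fun e => ∑ i : Fin n, (K : ℝ) ^ (i : ℕ) *
        (cellIdx K (x ((Fintype.equivFin C).symm i) e) : ℝ) := by
      ext e
      simp only [hm, eqv, Equiv.trans_apply, finFunctionFinEquiv_apply, hk]
      push_cast
      refine Finset.sum_congr rfl fun i _ => ?_
      rw [mul_comm]
      rfl
    rw [this]
    exact sum_mem_affSpan fun i _ => mul_mem_affSpan _ (hκ _)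
  have h2 := (reach_lookup (l := l) hb hI hJ (fun e => (eqv (k e)).2.trans_le hKM) hmS (tab := tab')
    fun i => by
      simp only [htab']
      split_ifs
      exacts [htab _, ⟨le_rfl, zero_le_one⟩]).union
    (reach_carry hz (fun c e => (hz1 c e).1) _)
  have e1 : (fun e => digitTrunc b l (tab' (m e)))
      = fun e => digitTrunc b l (tab fun c => cellIdx K (x c e)) := by
    ext e
    simp [htab', hm, hk]
  rw [e1] at h2
  have h3 := reach_prod_digitTrunc (l := l) hb hz1 p
    (fun e => digitTrunc_mem_Icc hb l (htab fun c => cellIdx K (x c e)))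
  rw [← hn] at h1 h2 h3
  have h4 : n ≤ n * (2 * J + 4) := Nat.le_mul_of_pos_right _ (by omega)
  exact (h1.mono subset_affSpan subset_affSpan (by omega)).trans
    ((h2.mono subset_affSpan subset_affSpan (by omega)).trans
    (h3.mono subset_affSpan subset_affSpan (by omega)))

end Chain

/-! ### Piecewise polynomials -/

section PiecewisePoly

variable {E C : Type*} {S : Set (E → ℝ)} {b l I J K : ℕ}

lemma prod_map_mem_Icc {f : C → ℝ} (hf : ∀ c, f c ∈ Set.Icc (0 : ℝ) 1) (p : List C) :
    (p.map f).prod ∈ Set.Icc (0 : ℝ) 1 := by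
  induction p with
  | nil => simp
  | cons c p ih =>
    rw [List.map_cons, List.prod_cons]
    exact ⟨mul_nonneg (hf c).1 ih.1, mul_le_one₀ (hf c).2 ih.1 ih.2⟩

lemma abs_mul_sub_mul_le {a a' y y' ε δ : ℝ} (ha : a ∈ Set.Icc (0 : ℝ) 1)
    (hy' : y' ∈ Set.Icc (0 : ℝ) 1) (h : |a - a'| ≤ ε) (h' : |y - y'| ≤ δ) :
    |a * y - a' * y'| ≤ ε + δ := by
  have e : a * y - a' * y' = (a - a') * y' + a * (y - y') := by ring
  rw [e]
  refine (abs_add_le _ _).trans (add_le_add ?_ ?_)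
  · rw [abs_mul, abs_of_nonneg hy'.1]
    exact (mul_le_of_le_one_right (abs_nonneg _) hy'.2).trans h
  · rw [abs_mul, abs_of_nonneg ha.1]
    exact (mul_le_of_le_one_left (abs_nonneg _) ha.2).trans h'

lemma abs_prod_map_sub_le {f g : C → ℝ} {ε : ℝ} (hf : ∀ c, f c ∈ Set.Icc (0 : ℝ) 1)
    (hg : ∀ c, g c ∈ Set.Icc (0 : ℝ) 1) (h : ∀ c, |f c - g c| ≤ ε) (p : List C) :
    |(p.map f).prod - (p.map g).prod| ≤ p.length * ε := by
  induction p with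
  | nil => simp
  | cons c p ih =>
    rw [List.map_cons, List.prod_cons, List.map_cons, List.prod_cons, List.length_cons]
    refine (abs_mul_sub_mul_le (hf c) (prod_map_mem_Icc hg p) (h c) ih).trans_eq ?_
    push_cast
    ring

lemma abs_sub_digitTrunc_le (hb : 0 < b) (l : ℕ) {r : ℝ} (hr : r ∈ Set.Icc (0 : ℝ) 1) :
    |r - digitTrunc b l r| ≤ ((b : ℝ) ^ l)⁻¹ := by
  rw [abs_of_nonneg (sub_nonneg.2 (digitTrunc_le hb l hr))]
  exact sub_digitTrunc_le hb l hr

/-- Approximate computation of functions which are polynomial on each cell. -/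
lemma exists_reach_piecewisePoly {ι : Type*} [Fintype ι] [Fintype C] [Nonempty C] {x : C → E → ℝ}
    (hxS : ∀ c, x c ∈ affSpan S) (hx : ∀ c e, x c e ∈ Set.Icc (0 : ℝ) 1) (hb : 0 < b) (hI : 0 < I)
    (hJ : 0 < J) (hK : 0 < K) (hKM : K ^ Fintype.card C ≤ (I * J) * (I * J)) {U : ℝ} (hU : 0 < U)
    {coef : ι → (C → ℕ) → ℝ} (hcoef : ∀ i κ, |coef i κ| ≤ U) {p : ι → List C} {k : ℕ}
    (hp : ∀ i, (p i).length ≤ k) :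
    ∃ (S' : Set (E → ℝ)) (g : E → ℝ),
      Reach (Fintype.card ι * 2 * (Fintype.card C * (2 * J + 4) + (4 * J + 2 * b + 8)))
        (I + (I + 1) + (I + (I + (1 + (I * 2 + I * (1 + l * 2)))) + k * (l * 2))) S S' ∧
      g ∈ affSpan S' ∧ ∀ e, |g e - ∑ i, coef i (fun c => cellIdx K (x c e)) *
        ((p i).map fun c => cellPos K (x c e)).prod|
          ≤ Fintype.card ι * (2 * U * ((k + 1) * ((b : ℝ) ^ l)⁻¹)) := by
  set tab : ι × Bool → (C → ℕ) → ℝ := fun i κ => max (cond i.2 1 (-1) * coef i.1 κ / U) 0 with htab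
  have htab1 : ∀ i κ, tab i κ ∈ Set.Icc (0 : ℝ) 1 := by
    rintro ⟨i, t⟩ κ
    refine ⟨le_max_right _ _, max_le ?_ zero_le_one⟩
    rw [div_le_one hU]
    have := abs_le.1 (hcoef i κ)
    cases t <;> simp only [cond_true, cond_false] <;> linarith
  have htabsub : ∀ i κ, U * (tab (i, true) κ - tab (i, false) κ) = coef i κ := by
    intro i κ
    simp only [htab, cond_true, cond_false, one_mul, neg_mul, neg_div]
    rw [max_zero_sub_max_neg_zero_eq_self, mul_div_cancel₀ _ hU.ne']
  set ε := ((b : ℝ) ^ l)⁻¹ with hε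
  have hε0 : 0 ≤ ε := by positivity
  set out : ι × Bool → E → ℝ := fun i e => digitTrunc b l (tab i fun c => cellIdx K (x c e)) *
        ((p i.1).map fun c => digitTrunc b l (cellPos K (x c e))).prod with hout
  have hz : ∀ c e, cellPos K (x c e) ∈ Set.Icc (0 : ℝ) 1 := fun c e => cellPos_mem_Icc hK (hx c e)
  have hout0 : ∀ i e, 0 ≤ out i e := fun i e => mul_nonneg (digitTrunc_nonneg _ _ _)
    (prod_map_mem_Icc (fun c => digitTrunc_mem_Icc hb l (hz c e)) _).1
  have hreach : ∀ i, Reach (Fintype.card C * (2 * J + 4) + (4 * J + 2 * b + 8))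
      (I + (I + 1) + (I + (I + (1 + (I * 2 + I * (1 + l * 2)))) + k * (l * 2))) S {out i} := by
    intro i
    have h1 := reach_chain hxS hx hb hI hJ hK hKM (l := l) (htab1 i) (p i.1)
    have h2 := h1.trans ((reach_carry_singleton (S := {out i}) (mem_affSpan rfl) (hout0 i)
      ((k - (p i.1).length) * (l * 2))).mono subset_affSpan subset_affSpan (by omega))
    have e1 : (p i.1).length * (l * 2) + (k - (p i.1).length) * (l * 2) = k * (l * 2) := by
      rw [← add_mul, Nat.add_sub_cancel' (hp i.1)]
    rw [← e1]
    simpa only [add_assoc] using h2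
  refine ⟨⋃ i, {out i}, fun e => ∑ i, (U * (out (i, true) e - out (i, false) e)),
    (Reach.iUnion hreach).mono subset_affSpan subset_affSpan (by simp),
    sum_mem_affSpan fun i _ => mul_mem_affSpan _ (sub_mem_affSpan (mem_affSpan (by simp))
      (mem_affSpan (by simp))), fun e => ?_⟩
  have key : ∀ i : ι × Bool, |tab i (fun c => cellIdx K (x c e)) *
      ((p i.1).map fun c => cellPos K (x c e)).prod - out i e| ≤ (k + 1) * ε := by
    intro i
    have h1 := abs_mul_sub_mul_le (htab1 i fun c => cellIdx K (x c e))
      (prod_map_mem_Icc (fun c => digitTrunc_mem_Icc hb l (hz c e)) (p i.1))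
      (abs_sub_digitTrunc_le hb l (htab1 i fun c => cellIdx K (x c e)))
      (abs_prod_map_sub_le (fun c => hz c e) (fun c => digitTrunc_mem_Icc hb l (hz c e))
        (fun c => abs_sub_digitTrunc_le hb l (hz c e)) (p i.1))
    have h2 : ((p i.1).length : ℝ) * ε ≤ k * ε :=
      mul_le_mul_of_nonneg_right (by exact_mod_cast hp i.1) hε0
    refine h1.trans ?_
    linarith
  rw [← Finset.sum_sub_distrib]
  refine (Finset.abs_sum_le_sum_abs _ _).trans ?_
  refine (Finset.sum_le_card_nsmul _ _ (2 * U * ((k + 1) * ε)) fun i _ => ?_).trans_eq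
    (by rw [nsmul_eq_mul, Finset.card_univ])
  have k1 := abs_le.1 (key (i, true))
  have k2 := abs_le.1 (key (i, false))
  rw [← htabsub i]
  set P := ((p i).map fun c => cellPos K (x c e)).prod
  set κ : C → ℕ := fun c => cellIdx K (x c e)
  have e2 : U * (out (i, true) e - out (i, false) e) - U * (tab (i, true) κ - tab (i, false) κ) * P
      = U * ((tab (i, false) κ * P - out (i, false) e) - (tab (i, true) κ * P - out (i, true) e)) := by
    ring
  rw [e2, abs_mul, abs_of_pos hU, mul_comm (2 : ℝ), mul_assoc]
  refine mul_le_mul_of_nonneg_left (abs_le.2 ⟨?_, ?_⟩) hU.le <;> linarith [k1.1, k1.2, k2.1, k2.2]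

end PiecewisePoly

/-! ### Compiling threshold-ReLU networks into ParaRNNs -/

section Realize

variable {din d ds T l : ℕ}

/-- The functions in the family `h` are the hidden units at the last time position of the last one
of `l` recurrent layers. -/
def Realizes (ds l : ℕ) (h : Fin d → cube T din → ℝ) : Prop :=
  ∃ (P : Matrix (Fin d) (Fin din) ℝ) (ls : List (RecLayer d)), ls.length = l ∧
    (∀ ℓ ∈ ls, ℓ.BlockDiag ds) ∧
    ∀ j X, h j X = applyLayers ls (fun s => P.mulVec (extendInput X.1 s)) (T - 1) j

lemma mem_affSpan_range {E ι : Type*} [Fintype ι] {h : ι → E → ℝ} {g : E → ℝ}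
    (hg : g ∈ affSpan (Set.range h)) : ∃ (a : ι → ℝ) (c : ℝ), ∀ e, g e = ∑ i, a i * h i e + c := by
  obtain ⟨c, z, hz, rfl⟩ := Submodule.mem_span_insert.1 hg
  obtain ⟨a, rfl⟩ := (Submodule.mem_span_range_iff_exists_fun ℝ).1 hz
  exact ⟨a, c, fun e => by simp [add_comm]⟩

lemma applyLayers_concat (ls : List (RecLayer d)) (ℓ : RecLayer d) (u : ℕ → Fin d → ℝ) :
    applyLayers (ls ++ [ℓ]) u = ℓ.out (applyLayers ls u) := by
  simp [applyLayers]

lemma Realizes.succ {h : Fin d → cube T din → ℝ} (hh : Realizes ds l h) {η : Type*} [Fintype η]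
    {G : η → cube T din → ℝ} (hG : ∀ i, G i ∈ affSpan (Set.range h)) (hd : Fintype.card η ≤ d) :
    ∃ h' : Fin d → cube T din → ℝ, Realizes ds (l + 1) h' ∧
      ∀ i, (fun e => relu (G i e)) ∈ Set.range h' := by
  classical
  obtain ⟨P, ls, hlen, hbd, hval⟩ := hh
  choose a c hac using fun i => mem_affSpan_range (hG i)
  obtain ⟨φ⟩ := Function.Embedding.nonempty_of_card_le (α := η) (β := Fin d) (by simpa using hd)
  let ℓ : RecLayer d := ⟨0, Matrix.of (Function.extend φ a 0), Function.extend φ c 0, 0⟩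
  refine ⟨fun j X => applyLayers (ls ++ [ℓ]) (fun s => P.mulVec (extendInput X.1 s)) (T - 1) j,
    ⟨P, ls ++ [ℓ], by simp [hlen], ?_, fun _ _ => rfl⟩, fun i => ⟨φ i, ?_⟩⟩
  · intro m hm
    rcases List.mem_append.1 hm with hm | hm
    · exact hbd m hm
    · rw [List.mem_singleton.1 hm]
      intro _ _ _
      rfl
  · ext X
    simp only [applyLayers_concat, RecLayer.out, RecLayer.state, ℓ, zero_mulVec, Pi.zero_apply,
      zero_add]
    simp only [mulVec, dotProduct, of_apply, φ.injective.extend_apply, hac, hval]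

/-- Approximate realization: pointwise, the approximations are eventually exact. -/
def ApproxRealizes (d ds l : ℕ) (S : Set (cube T din → ℝ)) : Prop :=
  ∃ h : ℕ → Fin d → cube T din → ℝ, (∀ n, Realizes ds l (h n)) ∧
    ∀ g ∈ S, ∃ gs : ℕ → cube T din → ℝ, (∀ n, gs n ∈ affSpan (Set.range (h n))) ∧
      ∀ e, ∀ᶠ n in Filter.atTop, gs n e = g e

variable {S S' : Set (cube T din → ℝ)} {w : ℕ}

lemma ApproxRealizes.affSpan (hS : ApproxRealizes d ds l S) :
    ApproxRealizes d ds l (affSpan S : Set (cube T din → ℝ)) := by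
  obtain ⟨h, hh, hg⟩ := hS
  refine ⟨h, hh, fun g hgS => ?_⟩
  induction hgS using Submodule.span_induction with
  | mem g hgm =>
    rcases hgm with rfl | hgm
    · exact ⟨fun _ => 1, fun n => const_mem_affSpan 1, fun e => Filter.Eventually.of_forall
        fun n => rfl⟩
    · exact hg g hgm
  | zero => exact ⟨fun _ => 0, fun n => zero_mem _, fun e => Filter.Eventually.of_forall fun n => rfl⟩
  | add f g _ _ hf hg =>
    obtain ⟨fs, hfs, hf⟩ := hf
    obtain ⟨gs, hgs, hg⟩ := hg
    refine ⟨fun n => fs n + gs n, fun n => add_mem (hfs n) (hgs n), fun e => ?_⟩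
    filter_upwards [hf e, hg e] with n h1 h2
    rw [Pi.add_apply, Pi.add_apply, h1, h2]
  | smul c g _ hg =>
    obtain ⟨gs, hgs, hg⟩ := hg
    refine ⟨fun n => c • gs n, fun n => Submodule.smul_mem _ _ (hgs n), fun e => ?_⟩
    filter_upwards [hg e] with n h1
    rw [Pi.smul_apply, Pi.smul_apply, h1]

lemma ApproxRealizes.mono (hS : ApproxRealizes d ds l S) (h : S' ⊆ S) :
    ApproxRealizes d ds l S' :=
  let ⟨f, hf, hg⟩ := hS
  ⟨f, hf, fun g hgS => hg g (h hgS)⟩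

lemma eventually_relu_sub_relu (y : ℝ) :
    ∀ᶠ n : ℕ in Filter.atTop, relu (n * y + 1) - relu (n * y) = heaviside y := by
  rcases le_or_gt 0 y with hy | hy
  · refine Filter.Eventually.of_forall fun n => ?_
    have : 0 ≤ n * y := mul_nonneg (Nat.cast_nonneg _) hy
    rw [heaviside_of_nonneg hy, relu_of_nonneg this, relu_of_nonneg (by linarith)]
    ring
  · filter_upwards [Filter.eventually_ge_atTop ⌈-y⁻¹⌉₊] with n hn
    have h1 : -y⁻¹ ≤ n := (Nat.le_ceil _).trans (by exact_mod_cast hn)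
    have h2 : n * y ≤ -1 := by
      have := mul_le_mul_of_nonpos_right h1 hy.le
      rwa [neg_mul, inv_mul_cancel₀ hy.ne] at this
    rw [heaviside_of_neg hy, relu_of_nonpos (by linarith), relu_of_nonpos (by linarith), sub_zero]

lemma ApproxRealizes.layer (hS : ApproxRealizes d ds l S) (hL : IsLayer w S S') (hw : w ≤ d) :
    ApproxRealizes d ds (l + 1) S' := by
  obtain ⟨R, H, hR, hH, hc, hS'⟩ := hL
  obtain ⟨h, hh, hg⟩ := hS.affSpan
  choose! gs hgs hgs' using hg
  let G : ℕ → R ⊕ (H × Bool) → cube T din → ℝ := fun n => Sum.elim (fun g => gs g n)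
    (fun p e => n * gs p.1 n e + cond p.2 1 0)
  have hG : ∀ n i, G n i ∈ _root_.affSpan (Set.range (h n)) := by
    rintro n (g | ⟨g, t⟩)
    · exact hgs _ (hR g.2) n
    · exact add_mem_affSpan (mul_mem_affSpan _ (hgs _ (hH g.2) n)) (const_mem_affSpan _)
  choose h' hh' hrange using fun n => (hh n).succ (hG n) (by
    rw [Fintype.card_sum, Fintype.card_prod, Fintype.card_bool, Fintype.card_coe,
      Fintype.card_coe]
    omega)
  refine ApproxRealizes.mono (ApproxRealizes.affSpan ⟨h', hh', ?_⟩) hS'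
  rintro _ (⟨g, hg, rfl⟩ | ⟨g, hg, rfl⟩)
  · refine ⟨fun n e => relu (gs g n e), fun n => mem_affSpan (hrange n (.inl ⟨g, hg⟩)), fun e => ?_⟩
    filter_upwards [hgs' g (hR hg) e] with n hn
    rw [hn, Function.comp_apply]
  · refine ⟨fun n e => relu (n * gs g n e + 1) - relu (n * gs g n e), fun n => ?_, fun e => ?_⟩
    · refine sub_mem_affSpan (mem_affSpan (hrange n (.inr (⟨g, hg⟩, true)))) (mem_affSpan ?_)
      simpa [G] using hrange n (.inr (⟨g, hg⟩, false))
    · filter_upwards [hgs' g (hH hg) e, eventually_relu_sub_relu (g e)] with n h1 h2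
      rw [h1, h2, Function.comp_apply]

lemma ApproxRealizes.reach {l' : ℕ} (hS : ApproxRealizes d ds l S) (hL : Reach w l' S S')
    (hw : w ≤ d) : ApproxRealizes d ds (l + l') S' := by
  induction l' generalizing S l with
  | zero => exact hS.affSpan.mono hL
  | succ l' ih =>
    obtain ⟨S₁, h1, h2⟩ := hL
    rw [add_comm l', ← add_assoc]
    exact ih (hS.layer h1 hw) h2

lemma abs_reluClip_le {U : ℝ} (hU : 0 ≤ U) (y : ℝ) : |relu (y + U) - relu (y - U) - U| ≤ U := by
  unfold relu
  rw [abs_le]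
  rcases max_cases (y + U) 0 with h | h <;> rcases max_cases (y - U) 0 with h' | h' <;>
    constructor <;> linarith

lemma abs_reluClip_sub_le {U : ℝ} (y : ℝ) {z : ℝ} (hz : |z| ≤ U) :
    |relu (y + U) - relu (y - U) - U - z| ≤ |y - z| := by
  have := abs_le.1 hz
  unfold relu
  rcases max_cases (y + U) 0 with h | h <;> rcases max_cases (y - U) 0 with h' | h' <;>
    rcases abs_cases (y - z) with h2 | h2 <;> rw [abs_le] <;> constructor <;> linarith

/-- The final layers of the network clip the output to `[-U, U]`. -/
lemma Realizes.exists_mem_scalarClass {h : Fin d → cube T din → ℝ} (hh : Realizes ds l h)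
    {g : cube T din → ℝ} (hg : g ∈ affSpan (Set.range h)) (hd : 3 ≤ d) {U : ℝ} (hU : 0 ≤ U) :
    ∃ ψ ∈ scalarClass din d ds l T U, ∀ X, ψ X.1 = relu (g X + U) - relu (g X - U) - U := by
  obtain ⟨P, ls, rfl, hbd, hval⟩ := hh
  obtain ⟨a, c, hac⟩ := mem_affSpan_range hg
  obtain ⟨d, rfl⟩ := Nat.exists_eq_add_of_le' hd
  let net : ParaNet din 1 (d + 3) ds ls.length :=
    ⟨P, ls.get, fun i => hbd _ (List.get_mem _ _),
      Matrix.of (Fin.cons a (Fin.cons a (Fin.cons 0 fun _ => 0))),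
      Fin.cons (c + U) (Fin.cons (c - U) (Fin.cons 1 fun _ => 0)),
      Matrix.of fun _ => Fin.cons 1 (Fin.cons (-1) (Fin.cons (-U) fun _ => 0))⟩
  have hnet : ∀ X t i, net.forward X t i = relu ((∑ j, a j *
      applyLayers ls (fun s => P.mulVec (X s)) t j + c) + U) - relu ((∑ j, a j *
      applyLayers ls (fun s => P.mulVec (X s)) t j + c) - U) - U := by
    intro X t i
    simp only [ParaNet.forward, net, List.ofFn_get, mulVec, dotProduct, of_apply]
    have hs : ∀ F : Fin (d + 3) → ℝ, ∑ j, F j = F 0 + (F (Fin.succ 0) + (F (Fin.succ (Fin.succ 0)) +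
        ∑ j : Fin d, F j.succ.succ.succ)) := fun F => by
      rw [Fin.sum_univ_succ, Fin.sum_univ_succ, Fin.sum_univ_succ]
    refine (hs _).trans ?_
    simp only [Fin.cons_zero, Fin.cons_succ, Pi.zero_apply, zero_mul, Finset.sum_const_zero,
      add_zero, zero_add, relu_of_nonneg zero_le_one, ← add_assoc, ← add_sub_assoc]
    ring
  refine ⟨fun X => net.forward (extendInput X) (T - 1) 0, ⟨net, fun X t _ i => ?_, fun _ => rfl⟩,
    fun X => ?_⟩
  · rw [hnet]
    exact abs_reluClip_le hU _
  · simp only [hnet, hac, hval]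

end Realize

/-! ### Collecting the input sequence in the hidden state -/

section Shift

variable {din d ds T : ℕ}

/-- Odd channels delay the preceding even channel by one time step; even channels read the odd
channel `2 * din - 1` positions below, except the first `2 * din` ones, which read themselves. -/
def shiftLayer (din d : ℕ) : RecLayer d where
  Wh := Matrix.of fun j k => if (j : ℕ) % 2 = 1 ∧ (k : ℕ) + 1 = j then 1 else 0
  Wx := Matrix.of fun j k => if (j : ℕ) % 2 = 0 ∧
    ((j : ℕ) < 2 * din ∧ k = j ∨ 2 * din ≤ j ∧ (k : ℕ) + 2 * din = j + 1) then 1 else 0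
  b := 0
  h0 := 0

lemma shiftLayer_blockDiag (hds : Even ds) : (shiftLayer din d).BlockDiag ds := by
  obtain ⟨r, rfl⟩ := hds
  intro i j hij
  refine if_neg fun h => hij ?_
  rw [← two_mul, ← Nat.div_div_eq_div_mul, ← Nat.div_div_eq_div_mul]
  congr 1
  omega

lemma shiftLayer_state_odd (u : ℕ → Fin d → ℝ) (t : ℕ) {q : ℕ} (hq : 2 * q + 1 < d) :
    (shiftLayer din d).state u (t + 1) ⟨2 * q + 1, hq⟩
      = relu ((shiftLayer din d).state u t ⟨2 * q, by omega⟩) := by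
  have h1 : ∀ v : Fin d → ℝ, ((shiftLayer din d).Wh *ᵥ v) ⟨2 * q + 1, hq⟩
      = v ⟨2 * q, by omega⟩ := by
    intro v
    simp only [shiftLayer, mulVec, dotProduct, of_apply]
    rw [Finset.sum_eq_single ⟨2 * q, by omega⟩]
    · rw [if_pos ⟨by omega, rfl⟩, one_mul]
    · intro k _ hk
      rw [if_neg fun h => hk (Fin.ext (by simpa using h.2)), zero_mul]
    · simp
  have h2 : ∀ v : Fin d → ℝ, ((shiftLayer din d).Wx *ᵥ v) ⟨2 * q + 1, hq⟩ = 0 := by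
    intro v
    simp only [shiftLayer, mulVec, dotProduct, of_apply]
    refine Finset.sum_eq_zero fun k _ => ?_
    rw [if_neg fun h => by omega, zero_mul]
  simp only [RecLayer.state, h1, h2]
  simp [shiftLayer]

lemma shiftLayer_state_even (u : ℕ → Fin d → ℝ) (t : ℕ) {q k : ℕ} (hq : 2 * q < d) (hk : k < d)
    (hkq : q < din ∧ k = 2 * q ∨ din ≤ q ∧ k + 2 * din = 2 * q + 1) :
    (shiftLayer din d).state u (t + 1) ⟨2 * q, hq⟩ = relu (u t ⟨k, hk⟩) := by
  have h1 : ∀ v : Fin d → ℝ, ((shiftLayer din d).Wh *ᵥ v) ⟨2 * q, hq⟩ = 0 := by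
    intro v
    simp only [shiftLayer, mulVec, dotProduct, of_apply]
    refine Finset.sum_eq_zero fun k _ => ?_
    rw [if_neg fun h => by omega, zero_mul]
  have h2 : ∀ v : Fin d → ℝ, ((shiftLayer din d).Wx *ᵥ v) ⟨2 * q, hq⟩ = v ⟨k, hk⟩ := by
    intro v
    simp only [shiftLayer, mulVec, dotProduct, of_apply]
    rw [Finset.sum_eq_single ⟨k, hk⟩]
    · rw [if_pos (by simp only [Fin.mk.injEq]; omega), one_mul]
    · intro k' _ hk'
      rw [if_neg, zero_mul]
      intro h
      refine hk' (Fin.ext ?_)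
      simp only [Fin.ext_iff] at h ⊢
      omega
    · simp
  simp only [RecLayer.state, h1, h2]
  simp [shiftLayer]

/-- Writes the input into the even ones among the first `2 * din` channels. -/
def inputMatrix (din d : ℕ) : Matrix (Fin d) (Fin din) ℝ :=
  Matrix.of fun j i => if (j : ℕ) = 2 * i then 1 else 0

lemma shiftLayers_apply {X : ℕ → Fin din → ℝ} (hX : ∀ t i, 0 ≤ X t i) (m a : ℕ) (ham : a < m)
    (i : Fin din) (t : ℕ) (hat : a ≤ t) (h1 : 2 * (a * din + i) + 1 < d) :
    applyLayers (List.replicate m (shiftLayer din d)) (fun s => (inputMatrix din d).mulVec (X s)) t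
        ⟨2 * (a * din + i), by omega⟩ = X (t - a) i ∧
    applyLayers (List.replicate m (shiftLayer din d)) (fun s => (inputMatrix din d).mulVec (X s)) (t + 1)
        ⟨2 * (a * din + i) + 1, h1⟩ = X (t - a) i := by
  induction m generalizing a t with
  | zero => omega
  | succ m ih =>
    rw [List.replicate_succ', applyLayers_concat]
    set u := applyLayers (List.replicate m (shiftLayer din d))
      (fun s => (inputMatrix din d).mulVec (X s)) with hu
    have heven : (shiftLayer din d).out u t ⟨2 * (a * din + i), by omega⟩ = X (t - a) i := by
      rcases a with _ | a
      · rw [RecLayer.out, shiftLayer_state_even u t (k := 2 * (0 * din + i)) _ (by omega)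
          (.inl ⟨by have := i.2; omega, rfl⟩)]
        rcases m with _ | m
        · simp only [hu, List.replicate_zero, applyLayers, List.foldl_nil, mulVec, dotProduct, inputMatrix,
            of_apply, zero_mul, zero_add, Nat.sub_zero]
          rw [Finset.sum_eq_single i]
          · simp [relu_of_nonneg (hX t i)]
          · intro k _ hk
            rw [if_neg fun h => hk (Fin.ext (by omega)), zero_mul]
          · simp
        · rw [(ih 0 (by omega) t hat h1).1, relu_of_nonneg (hX _ _)]
      · have e1 : (a + 1) * din + (i : ℕ) = a * din + i + din := by ring
        obtain ⟨t, rfl⟩ : ∃ t', t = t' + 1 := ⟨t - 1, by omega⟩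
        rw [RecLayer.out, shiftLayer_state_even u (t + 1) (k := 2 * (a * din + i) + 1) _ (by omega)
          (.inr ⟨by omega, by omega⟩), (ih a (by omega) t (by omega) (by omega)).2,
          relu_of_nonneg (hX _ _), Nat.add_sub_add_right]
    refine ⟨heven, ?_⟩
    rw [RecLayer.out, shiftLayer_state_odd]
    rw [RecLayer.out] at heven
    rw [heven, relu_of_nonneg (hX _ _)]

lemma extendInput_nonneg (X : cube T din) (t : ℕ) (i : Fin din) : 0 ≤ extendInput X.1 t i := by
  unfold extendInput
  split_ifs with h
  · exact (X.2 _ _).1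
  · exact le_rfl

lemma approxRealizes_coord (hd : 2 * (T * din) ≤ d) (hds : Even ds) :
    ApproxRealizes d ds T (Set.range fun (c : Fin T × Fin din) (X : cube T din) => X.1 c.1 c.2) := by
  refine ⟨fun _ j X => applyLayers (List.replicate T (shiftLayer din d))
    (fun s => (inputMatrix din d).mulVec (extendInput X.1 s)) (T - 1) j,
    fun _ => ⟨inputMatrix din d, _, List.length_replicate, ?_, fun _ _ => rfl⟩, ?_⟩
  · intro ℓ hℓ
    rw [List.eq_of_mem_replicate hℓ]
    exact shiftLayer_blockDiag hds
  · rintro _ ⟨⟨t, i⟩, rfl⟩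
    have ht := t.2
    have h1 : (T - 1 - t) * din + i < T * din := by
      have h2 : (T - 1 - t + 1) * din ≤ T * din := Nat.mul_le_mul_right _ (by omega)
      rw [add_mul, one_mul] at h2
      have := i.2
      omega
    refine ⟨fun _ X => X.1 t i, fun _ => mem_affSpan ⟨⟨2 * ((T - 1 - t) * din + i), by omega⟩, ?_⟩,
      fun e => Filter.Eventually.of_forall fun _ => rfl⟩
    ext X
    have h := (shiftLayers_apply (d := d) (extendInput_nonneg X) T (T - 1 - t) (by omega) i
      (T - 1) (by omega) (by omega)).1
    refine h.trans ?_
    rw [Nat.sub_sub_self (by omega)]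
    simp [extendInput]

/-- A function computed by a threshold-ReLU network on the cube is the pointwise limit of functions
in the ParaRNN class, up to clipping. -/
lemma exists_tendsto_of_reach {w l : ℕ} {S' : Set (cube T din → ℝ)} (hd : 2 * (T * din) ≤ d)
    (hds : Even ds) (hL : Reach w l (Set.range fun (c : Fin T × Fin din) (X : cube T din) =>
      X.1 c.1 c.2) S') (hw : w ≤ d) (hd3 : 3 ≤ d) {U : ℝ} (hU : 0 ≤ U) {g : cube T din → ℝ}
    (hg : g ∈ affSpan S') :
    ∃ ψ : ℕ → (Fin T → Fin din → ℝ) → ℝ, (∀ n, ψ n ∈ scalarClass din d ds (T + l) T U) ∧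
      ∀ X : cube T din, ∀ᶠ n in Filter.atTop,
        ψ n X.1 = relu (g X + U) - relu (g X - U) - U := by
  obtain ⟨h, hh, hS⟩ := ((approxRealizes_coord hd hds).reach hL hw).affSpan
  obtain ⟨gs, hgs, hg⟩ := hS g hg
  choose ψ hψ hψ' using fun n => (hh n).exists_mem_scalarClass (hgs n) hd3 hU
  refine ⟨ψ, hψ, fun X => ?_⟩
  filter_upwards [hg X] with n hn
  rw [hψ', hn]

end Shift

/-! ### Taylor expansion of Hölder functions on the cube -/

section Taylor

/-- Taylor's formula with the remainder controlled by the oscillation of the top derivative. -/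
lemma abs_sub_taylor_sum_le {v B : ℝ} (hv : 0 ≤ v) (j : ℕ) {φ : ℕ → ℝ → ℝ}
    (hφ : ∀ i < j, ∀ t ∈ Set.Icc 0 v, HasDerivWithinAt (φ i) (φ (i + 1) t) (Set.Icc 0 v) t)
    (hB : ∀ t ∈ Set.Icc 0 v, |φ j t - φ j 0| ≤ B) {t : ℝ} (ht : t ∈ Set.Icc 0 v) :
    |φ 0 t - ∑ i ∈ Finset.range (j + 1), φ i 0 * (t ^ i / i.factorial)| ≤ B * v ^ j := by
  induction j generalizing φ t with
  | zero => simpa using hB t ht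
  | succ j ih =>
    have h1 := fun s hs => ih (φ := fun i => φ (i + 1))
      (fun i hi => hφ (i + 1) (by omega)) hB (t := s) hs
    have h2 : ∀ s ∈ Set.Icc 0 v, HasDerivWithinAt
        (fun s => φ 0 s - ∑ i ∈ Finset.range (j + 1 + 1), φ i 0 * (s ^ i / i.factorial))
        (φ 1 s - ∑ i ∈ Finset.range (j + 1), φ (i + 1) 0 * (s ^ i / i.factorial))
        (Set.Icc 0 v) s := by
      intro s hs
      refine (hφ 0 (by omega) s hs).sub ?_
      have h3 : ∀ i ∈ Finset.range (j + 1), HasDerivWithinAt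
          (fun s : ℝ => φ (i + 1) 0 * (s ^ (i + 1) / (i + 1).factorial))
          (φ (i + 1) 0 * (s ^ i / i.factorial)) (Set.Icc 0 v) s := by
        intro i _
        refine ((((hasDerivAt_pow (i + 1) s).div_const _).const_mul _).congr_deriv
          ?_).hasDerivWithinAt
        rw [Nat.factorial_succ, Nat.add_sub_cancel]
        have := Nat.factorial_ne_zero i
        push_cast
        field_simp
      have h4 := (HasDerivWithinAt.fun_sum h3).add_const (φ 0 0)
      refine h4.congr_of_mem (fun r _ => ?_) hs
      rw [Finset.sum_range_succ']
      simp
    have h5 := (convex_Icc 0 v).norm_image_sub_le_of_norm_hasDerivWithin_le h2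
      (C := B * v ^ j) (fun s hs => h1 s hs) (Set.left_mem_Icc.2 hv) ht
    have h6 : φ 0 0 - ∑ i ∈ Finset.range (j + 1 + 1), φ i 0 * ((0 : ℝ) ^ i / i.factorial) = 0 := by
      rw [Finset.sum_range_succ']
      simp
    rw [h6, sub_zero, sub_zero, Real.norm_eq_abs, Real.norm_eq_abs, abs_of_nonneg ht.1] at h5
    have hB0 : 0 ≤ B := (abs_nonneg _).trans (hB t ht)
    calc _ ≤ B * v ^ j * t := h5
      _ ≤ B * v ^ j * v := by gcongr; exact ht.2
      _ = _ := by ring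

variable {T din : ℕ}

lemma coordVec_apply (c : Fin T × Fin din) (t : Fin T) (i : Fin din) :
    coordVec c t i = if (t, i) = c then 1 else 0 := by
  obtain ⟨t', i'⟩ := c
  rcases eq_or_ne t t' with rfl | ht
  · rcases eq_or_ne i i' with rfl | hi
    · simp [coordVec]
    · simp [coordVec, hi]
  · simp [coordVec, ht]

/-- The iterated partial derivative of `f` on the cube along a list of coordinates. -/
noncomputable def coordDeriv (f : (Fin T → Fin din → ℝ) → ℝ) (l : List (Fin T × Fin din)) :
    (Fin T → Fin din → ℝ) → ℝ :=
  dirDerivList (cube T din) (l.map coordVec) f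

/-- The coordinates in `L`, each repeated according to the multi-index `n`. -/
def monoList {ι : Type*} (L : List ι) (n : ι → ℕ) : List ι :=
  L.flatMap fun c => List.replicate (n c) c

lemma monoList_congr {ι : Type*} {L : List ι} {n n' : ι → ℕ} (h : ∀ c ∈ L, n c = n' c) :
    monoList L n = monoList L n' := by
  unfold monoList
  rw [List.flatMap_def, List.flatMap_def]
  congr 1
  exact List.map_congr_left fun c hc => by rw [h c hc]

lemma monoList_zero {ι : Type*} (L : List ι) : monoList L (0 : ι → ℕ) = [] := by
  simp [monoList]

lemma monoList_concat {ι : Type*} (L : List ι) (c : ι) (n : ι → ℕ) :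
    monoList (L ++ [c]) n = monoList L n ++ List.replicate (n c) c := by
  simp [monoList]

lemma length_monoList {ι : Type*} (L : List ι) (n : ι → ℕ) :
    (monoList L n).length = (L.map n).sum := by
  simp [monoList, List.length_flatMap]

lemma prod_map_monoList {ι : Type*} (L : List ι) (n : ι → ℕ) (v : ι → ℝ) :
    ((monoList L n).map v).prod = (L.map fun c => v c ^ n c).prod := by
  induction L with
  | nil => simp [monoList]
  | cons c L ih =>
    rw [List.map_cons, List.prod_cons, ← ih]
    simp [monoList]

lemma dirsOf_eq {k : ℕ} (n : Fin T × Fin din → Fin (k + 1)) :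
    dirsOf n = (monoList Finset.univ.toList fun c => (n c : ℕ)).map coordVec := by
  unfold dirsOf monoList
  induction (Finset.univ : Finset (Fin T × Fin din)).toList with
  | nil => rfl
  | cons c L ih => simp [ih]

lemma hasDerivWithinAt_coordDeriv_line {f : (Fin T → Fin din → ℝ) → ℝ}
    {l : List (Fin T × Fin din)} {c : Fin T × Fin din} {y : Fin T → Fin din → ℝ} {v : ℝ}
    (hl : ∀ x ∈ cube T din, DifferentiableWithinAt ℝ (coordDeriv f l) (cube T din) x)
    (hy : ∀ t ∈ Set.Icc 0 v, y + t • coordVec c ∈ cube T din) {t : ℝ} (ht : t ∈ Set.Icc 0 v) :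
    HasDerivWithinAt (fun t : ℝ => coordDeriv f l (y + t • coordVec c))
      (coordDeriv f (c :: l) (y + t • coordVec c)) (Set.Icc 0 v) t := by
  have h1 := (hl _ (hy t ht)).hasFDerivWithinAt
  have h2 : HasDerivWithinAt (fun t : ℝ => y + t • coordVec c) (coordVec c) (Set.Icc 0 v) t := by
    simpa using (((hasDerivAt_id t).smul_const (coordVec c)).const_add y).hasDerivWithinAt
  exact h1.comp_hasDerivWithinAt t h2 hy

lemma sum_piAntidiag_insert {ι : Type*} [DecidableEq ι] {s : Finset ι} {c : ι} (hc : c ∉ s)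
    (j : ℕ) (F : (ι → ℕ) → ℝ) :
    ∑ n ∈ Finset.piAntidiag (insert c s) j, F n
      = ∑ i ∈ Finset.range (j + 1), ∑ n ∈ Finset.piAntidiag s (j - i),
          F (n + Pi.single c i) := by
  rw [← Finset.cons_eq_insert _ _ hc, Finset.piAntidiag_cons hc, Finset.sum_disjiUnion,
    Finset.Nat.sum_antidiagonal_eq_sum_range_succ_mk]
  refine Finset.sum_congr rfl fun i _ => ?_
  rw [Finset.sum_map]
  refine Finset.sum_congr rfl fun n _ => ?_
  congr 1
  ext a
  simp [Pi.single_apply]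

lemma sum_range_sum_piAntidiag_insert {ι : Type*} [DecidableEq ι] {s : Finset ι} {c : ι}
    (hc : c ∉ s) (j : ℕ) (F : (ι → ℕ) → ℝ) :
    ∑ m ∈ Finset.range (j + 1), ∑ n ∈ Finset.piAntidiag (insert c s) m, F n
      = ∑ i ∈ Finset.range (j + 1), ∑ m ∈ Finset.range (j - i + 1),
          ∑ n ∈ Finset.piAntidiag s m, F (n + Pi.single c i) := by
  simp only [sum_piAntidiag_insert hc]
  rw [Finset.sum_comm' (t' := Finset.range (j + 1)) (s' := fun i => Finset.Ico i (j + 1))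
    fun m i => by simp only [Finset.mem_range, Finset.mem_Ico]; omega]
  refine Finset.sum_congr rfl fun i hi => ?_
  rw [Finset.sum_Ico_eq_sum_range, Nat.sub_add_comm (by simpa using Nat.lt_succ_iff.1 (Finset.mem_range.1 hi))]
  exact Finset.sum_congr rfl fun m _ => by rw [Nat.add_sub_cancel_left]

end Taylor

section Taylor

variable {T din : ℕ}

lemma abs_coordDeriv_sub_taylor_le {f : (Fin T → Fin din → ℝ) → ℝ} {k : ℕ} {h : ℝ}
    {S : List (Fin T × Fin din) → ℝ} {x₀ : Fin T → Fin din → ℝ} (hx₀ : x₀ ∈ cube T din)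
    (hdiff : ∀ l, l.length < k → ∀ x ∈ cube T din,
      DifferentiableWithinAt ℝ (coordDeriv f l) (cube T din) x)
    (hS : ∀ l, l.length = k → ∀ x ∈ cube T din, ∀ y ∈ cube T din,
      (∀ t i, |x t i - y t i| ≤ h) → |coordDeriv f l x - coordDeriv f l y| ≤ S l)
    {L : List (Fin T × Fin din)} (hL : L.Nodup) {j : ℕ} {l : List (Fin T × Fin din)}
    (hlj : l.length + j = k) {x : Fin T → Fin din → ℝ} (hx : x ∈ cube T din)
    (hxh : ∀ t i, x₀ t i ≤ x t i ∧ x t i ≤ x₀ t i + h)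
    (hxL : ∀ c ∉ L, x c.1 c.2 = x₀ c.1 c.2) :
    |coordDeriv f l x - ∑ m ∈ Finset.range (j + 1), ∑ n ∈ Finset.piAntidiag L.toFinset m,
        coordDeriv f (monoList L n ++ l) x₀
          * ∏ c ∈ L.toFinset, ((x c.1 c.2 - x₀ c.1 c.2) ^ n c / (n c).factorial)|
      ≤ (if j = 0 then 1 else 2)
        * (h ^ j * ∑ n ∈ Finset.piAntidiag L.toFinset j, S (monoList L n ++ l)) := by
  rcases Nat.eq_zero_or_pos j with rfl | hj
  · simpa [monoList_zero] using hS l (by omega) x hx x₀ hx₀ fun t i => by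
      rw [abs_of_nonneg (by linarith [(hxh t i).1])]; linarith [(hxh t i).2]
  induction L using List.reverseRecOn generalizing j l x with
  | nil =>
    have : x = x₀ := funext fun t => funext fun i => hxL (t, i) (by simp)
    subst this
    rw [Finset.sum_range_succ']
    simp [monoList, hj.ne']
  | append_singleton L c ih =>
    obtain ⟨hLn, -, hcL⟩ := List.nodup_append.1 hL
    replace hcL : c ∉ L := fun h => hcL _ h c (by simp) rfl
    have hcs : c ∉ L.toFinset := by simpa using hcL
    have hset : (L ++ [c]).toFinset = insert c L.toFinset := by
      ext a; simp
    set v := x c.1 c.2 - x₀ c.1 c.2 with hv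
    have hv0 : 0 ≤ v := by linarith [(hxh c.1 c.2).1]
    have hvh : v ≤ h := by linarith [(hxh c.1 c.2).2]
    have hh : 0 ≤ h := hv0.trans hvh
    set y : Fin T → Fin din → ℝ := x - v • coordVec c with hy
    have hyline : ∀ (r : ℝ) t i, (y + r • coordVec c) t i
        = if (t, i) = c then x₀ t i + r else x t i := by
      intro r t i
      simp only [hy, Pi.add_apply, Pi.sub_apply, Pi.smul_apply, coordVec_apply, smul_eq_mul]
      split_ifs with hc
      · subst hc
        simp only [hv]
        ring
      · simp
    have hycube : ∀ r ∈ Set.Icc 0 v, y + r • coordVec c ∈ cube T din := by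
      intro r hr t i
      rw [hyline]
      split_ifs with hc
      · subst hc
        exact ⟨add_nonneg (hx₀ t i).1 hr.1, by
          have := (hx t i).2
          have := hr.2
          simp only [hv] at this
          linarith⟩
      · exact hx t i
    have hy0 : ∀ t i, y t i = if (t, i) = c then x₀ t i else x t i := by
      intro t i
      simpa using hyline 0 t i
    have hyv : y + v • coordVec c = x := by simp [hy]
    have hym : y ∈ cube T din := by simpa using hycube 0 ⟨le_rfl, hv0⟩
    -- the univariate expansion in the coordinate `c`
    have huni := abs_sub_taylor_sum_le hv0 j
      (φ := fun i r => coordDeriv f (List.replicate i c ++ l) (y + r • coordVec c))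
      (fun i hi r hr => by
        simpa [List.replicate_succ] using hasDerivWithinAt_coordDeriv_line
          (hdiff (List.replicate i c ++ l) (by simp; omega)) hycube hr)
      (B := S (List.replicate j c ++ l))
      (fun r hr => hS _ (by simp; omega) _ (hycube r hr) _ (hycube 0 ⟨le_rfl, hv0⟩) fun t i => by
        rw [hyline, hyline]
        split_ifs
        · rw [add_zero, add_sub_cancel_left, abs_of_nonneg hr.1]
          exact hr.2.trans hvh
        · simpa using hh) ⟨hv0, le_rfl⟩
    simp only [hyv, zero_smul, add_zero, List.replicate_zero, List.nil_append] at huni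
    have hS0 : 0 ≤ S (List.replicate j c ++ l) :=
      (abs_nonneg _).trans (hS _ (by simp; omega) x hx x hx fun t i => by simpa using hh)
    -- the remaining coordinates
    have hrest : ∀ i ∈ Finset.range (j + 1),
        |coordDeriv f (List.replicate i c ++ l) y
          - ∑ m ∈ Finset.range (j - i + 1), ∑ n ∈ Finset.piAntidiag L.toFinset m,
            coordDeriv f (monoList L n ++ (List.replicate i c ++ l)) x₀
              * ∏ a ∈ L.toFinset, ((y a.1 a.2 - x₀ a.1 a.2) ^ n a / (n a).factorial)|
        ≤ (if j - i = 0 then 1 else 2) * (h ^ (j - i) * ∑ n ∈ Finset.piAntidiag L.toFinset (j - i),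
            S (monoList L n ++ (List.replicate i c ++ l))) := by
      intro i hi
      have hij : i ≤ j := by simpa using Nat.lt_succ_iff.1 (Finset.mem_range.1 hi)
      have hlen : (List.replicate i c ++ l).length + (j - i) = k := by simp; omega
      have hyh : ∀ t i, x₀ t i ≤ y t i ∧ y t i ≤ x₀ t i + h := by
        intro t i
        rw [hy0]
        split_ifs
        · exact ⟨le_rfl, by linarith⟩
        · exact hxh t i
      rcases Nat.eq_zero_or_pos (j - i) with h0 | h0
      · rw [h0] at hlen ⊢
        simpa [monoList_zero] using hS _ hlen y hym x₀ hx₀ fun t i => by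
          rw [abs_of_nonneg (by linarith [(hyh t i).1])]; linarith [(hyh t i).2]
      · refine ih hLn hlen hym hyh (fun a ha => ?_) h0
        rw [hy0]
        split_ifs with hac
        · rfl
        · exact hxL a (by simp [ha, show a ≠ c from hac])
    have hlist : ∀ i m, ∀ n ∈ Finset.piAntidiag L.toFinset m,
        monoList (L ++ [c]) (n + Pi.single c i) ++ l
          = monoList L n ++ (List.replicate i c ++ l) := by
      intro i m n hn
      have hnc : n c = 0 := by
        by_contra hne
        exact hcs ((Finset.mem_piAntidiag.1 hn).2 c hne)
      rw [monoList_concat, List.append_assoc, monoList_congr (n' := n) fun a ha => by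
        have hac : a ≠ c := fun hac => hcL (hac ▸ ha)
        rw [Pi.add_apply, Pi.single_eq_of_ne hac, add_zero]]
      simp [hnc]
    have hF : ∀ i m, ∀ n ∈ Finset.piAntidiag L.toFinset m,
        coordDeriv f (monoList (L ++ [c]) (n + Pi.single c i) ++ l) x₀
          * ∏ a ∈ insert c L.toFinset, ((x a.1 a.2 - x₀ a.1 a.2) ^ (n + Pi.single c i : _ → ℕ) a
            / ((n + Pi.single c i : _ → ℕ) a).factorial)
        = v ^ i / i.factorial * (coordDeriv f (monoList L n ++ (List.replicate i c ++ l)) x₀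
          * ∏ a ∈ L.toFinset, ((y a.1 a.2 - x₀ a.1 a.2) ^ n a / (n a).factorial)) := by
      intro i m n hn
      have hnc : n c = 0 := by
        by_contra hne
        exact hcs ((Finset.mem_piAntidiag.1 hn).2 c hne)
      rw [hlist i m n hn, Finset.prod_insert hcs, mul_left_comm]
      congr 1
      · simp [hnc, hv]
      · congr 1
        refine Finset.prod_congr rfl fun a ha => ?_
        have hac : a ≠ c := fun hac => hcs (hac ▸ ha)
        rw [hy0, if_neg (show (a.1, a.2) ≠ c from hac), Pi.add_apply, Pi.single_eq_of_ne hac,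
          add_zero]
    have hSF : ∀ i m, ∀ n ∈ Finset.piAntidiag L.toFinset m,
        S (monoList (L ++ [c]) (n + Pi.single c i) ++ l)
          = S (monoList L n ++ (List.replicate i c ++ l)) := fun i m n hn => by
      rw [hlist i m n hn]
    rw [hset, sum_range_sum_piAntidiag_insert hcs, sum_piAntidiag_insert hcs, if_neg hj.ne',
      Finset.sum_congr rfl fun i _ => Finset.sum_congr rfl fun m _ =>
        Finset.sum_congr rfl (hF i m), Finset.sum_congr rfl fun i _ =>
        Finset.sum_congr rfl (hSF i (j - i))]
    simp only [← Finset.mul_sum]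
    have hsplit : coordDeriv f l x - ∑ i ∈ Finset.range (j + 1), v ^ i / i.factorial
          * ∑ m ∈ Finset.range (j - i + 1), ∑ n ∈ Finset.piAntidiag L.toFinset m,
            coordDeriv f (monoList L n ++ (List.replicate i c ++ l)) x₀
              * ∏ a ∈ L.toFinset, ((y a.1 a.2 - x₀ a.1 a.2) ^ n a / (n a).factorial)
        = (coordDeriv f l x - ∑ i ∈ Finset.range (j + 1),
            coordDeriv f (List.replicate i c ++ l) y * (v ^ i / i.factorial))
          + ∑ i ∈ Finset.range (j + 1), v ^ i / i.factorial
            * (coordDeriv f (List.replicate i c ++ l) y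
              - ∑ m ∈ Finset.range (j - i + 1), ∑ n ∈ Finset.piAntidiag L.toFinset m,
                coordDeriv f (monoList L n ++ (List.replicate i c ++ l)) x₀
              * ∏ a ∈ L.toFinset, ((y a.1 a.2 - x₀ a.1 a.2) ^ n a / (n a).factorial)) := by
      rw [sub_add, ← Finset.sum_sub_distrib]
      congr 1
      refine Finset.sum_congr rfl fun i _ => ?_
      ring
    rw [hsplit]
    refine (abs_add_le _ _).trans ?_
    have hvi : ∀ i, v ^ i / i.factorial ≤ h ^ i := fun i =>
      (div_le_self (by positivity) 
        (by exact_mod_cast i.factorial_pos)).trans (pow_le_pow_left₀ hv0 hvh i)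
    have hrest' : ∀ i ∈ Finset.range (j + 1), |v ^ i / i.factorial
            * (coordDeriv f (List.replicate i c ++ l) y
              - ∑ m ∈ Finset.range (j - i + 1), ∑ n ∈ Finset.piAntidiag L.toFinset m,
                coordDeriv f (monoList L n ++ (List.replicate i c ++ l)) x₀
              * ∏ a ∈ L.toFinset, ((y a.1 a.2 - x₀ a.1 a.2) ^ n a / (n a).factorial))|
        ≤ (if j - i = 0 then 1 else 2) * (h ^ j * ∑ n ∈ Finset.piAntidiag L.toFinset (j - i),
            S (monoList L n ++ (List.replicate i c ++ l))) := by
      intro i hi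
      have hij : i ≤ j := by simpa using Nat.lt_succ_iff.1 (Finset.mem_range.1 hi)
      rw [abs_mul, abs_of_nonneg (by positivity)]
      refine (mul_le_mul (hvi i) (hrest i hi) (abs_nonneg _) (by positivity)).trans_eq ?_
      conv_rhs => rw [← Nat.add_sub_of_le hij, pow_add, Nat.add_sub_of_le hij]
      ring
    refine (add_le_add (huni.trans (mul_le_mul_of_nonneg_left (pow_le_pow_left₀ hv0 hvh j) hS0))
      ((Finset.abs_sum_le_sum_abs _ _).trans (Finset.sum_le_sum hrest'))).trans ?_
    rw [Finset.sum_range_succ, Finset.sum_range_succ _ j, Nat.sub_self, if_pos rfl,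
      Finset.piAntidiag_zero, Finset.sum_singleton, monoList_zero, List.nil_append]
    rw [Finset.sum_congr rfl fun i hi => by
      rw [if_neg (by have := Finset.mem_range.1 hi; omega)], ← Finset.mul_sum, ← Finset.mul_sum]
    apply le_of_eq
    ring

end Taylor

section Taylor

variable {T din : ℕ}

lemma sum_subtype_multiIndex {ι : Type*} [Fintype ι] [DecidableEq ι] (k : ℕ) (F : (ι → ℕ) → ℝ) :
    ∑ n : {n : ι → Fin (k + 1) // ∑ c, (n c : ℕ) ≤ k}, F (fun c => n.1 c)
      = ∑ m ∈ Finset.range (k + 1), ∑ n ∈ Finset.piAntidiag Finset.univ m, F n := by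
  rw [Finset.sum_sigma']
  refine Finset.sum_nbij (fun n => ⟨∑ c, (n.1 c : ℕ), fun c => n.1 c⟩) ?_ ?_ ?_ fun _ _ => rfl
  · intro n _
    simp [n.2]
  · intro a _ b _ hab
    simp only [Sigma.mk.injEq] at hab
    have := eq_of_heq hab.2
    exact Subtype.ext (funext fun c => Fin.ext (congrFun this c))
  · rintro ⟨m, n⟩ h
    simp only [Finset.coe_sigma, Set.mem_sigma_iff, Finset.mem_coe, Finset.mem_range,
      Finset.mem_piAntidiag] at h
    obtain ⟨hm, rfl, -⟩ := h
    exact ⟨⟨fun c => ⟨n c, (Finset.single_le_sum (f := n) (fun _ _ => Nat.zero_le _)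
      (Finset.mem_univ c)).trans_lt hm⟩, Nat.lt_succ_iff.1 hm⟩, Finset.mem_coe.2 (Finset.mem_univ _), rfl⟩

lemma sum_piAntidiag_univ {ι : Type*} [Fintype ι] [DecidableEq ι] (k : ℕ) (F : (ι → ℕ) → ℝ) :
    ∑ n ∈ Finset.piAntidiag Finset.univ k, F n
      = ∑ n : ι → Fin (k + 1), if ∑ c, (n c : ℕ) = k then F (fun c => n c) else 0 := by
  rw [← Finset.sum_filter]
  symm
  refine Finset.sum_nbij (fun n c => (n c : ℕ)) ?_ ?_ ?_ fun _ _ => rfl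
  · intro n hn
    simpa using hn
  · intro a _ b _ hab
    exact funext fun c => Fin.ext (congrFun hab c)
  · intro n hn
    obtain ⟨hk, -⟩ := Finset.mem_piAntidiag.1 hn
    have hle : ∀ c, n c < k + 1 := fun c => Nat.lt_succ_iff.2 (hk ▸ Finset.single_le_sum
      (f := n) (fun _ _ => Nat.zero_le _) (Finset.mem_univ c))
    exact ⟨fun c => ⟨n c, hle c⟩, by simpa using hk, rfl⟩

/-- The Hölder class is contained in the functions with uniformly accurate Taylor polynomials of
uniformly bounded coefficients. -/
lemma MemHolderClass.exists_taylor {β U : ℝ} {f : (Fin T → Fin din → ℝ) → ℝ}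
    (hf : MemHolderClass T din 1 β U (fun x _ => f x)) :
    (∀ x ∈ cube T din, |f x| ≤ U) ∧ ∃ (k : ℕ) (ω : ℝ), β = k + ω ∧ 0 < ω ∧ ω ≤ 1 ∧
      ∃ a : {n : Fin T × Fin din → Fin (k + 1) // ∑ c, (n c : ℕ) ≤ k} →
          (Fin T → Fin din → ℝ) → ℝ,
        (∀ n, ∀ x ∈ cube T din, |a n x| ≤ U) ∧
        ∀ h : ℝ, 0 < h → ∀ x₀ ∈ cube T din, ∀ x ∈ cube T din,
          (∀ t i, x₀ t i ≤ x t i ∧ x t i ≤ x₀ t i + h) →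
          |f x - ∑ n, a n x₀ * ((monoList Finset.univ.toList fun c => (n.1 c : ℕ)).map
            fun c => x c.1 c.2 - x₀ c.1 c.2).prod| ≤ 2 * U * h ^ β := by
  obtain ⟨k, ω, hβ, ⟨hω0, hω1⟩, hdiff, hbdd, hhol, hsum⟩ := hf
  replace hdiff : ∀ l, l.length < k → ∀ x ∈ cube T din,
    DifferentiableWithinAt ℝ (coordDeriv f l) (cube T din) x := hdiff 0
  replace hbdd : ∀ l, l.length ≤ k → ∃ C : ℝ, ∀ x ∈ cube T din, |coordDeriv f l x| ≤ C := hbdd 0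
  replace hhol : ∀ l, l.length = k → ∃ C : ℝ, ∀ x ∈ cube T din, ∀ y ∈ cube T din,
    |coordDeriv f l x - coordDeriv f l y| ≤ C * ‖x - y‖ ^ ω := hhol 0
  set A : List (Fin T × Fin din) → ℝ := fun l =>
    sSup ((fun x => |coordDeriv f l x|) '' cube T din) with hA
  set H : List (Fin T × Fin din) → ℝ := fun l =>
    sSup {r : ℝ | ∃ x ∈ cube T din, ∃ y ∈ cube T din, x ≠ y ∧
      r = |coordDeriv f l x - coordDeriv f l y| / ‖x - y‖ ^ ω} with hH
  replace hsum : (∑ n : Fin T × Fin din → Fin (k + 1), if ∑ c, (n c : ℕ) ≤ k then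
        A (monoList Finset.univ.toList fun c => (n c : ℕ)) else 0)
      + (∑ n : Fin T × Fin din → Fin (k + 1), if ∑ c, (n c : ℕ) = k then
        H (monoList Finset.univ.toList fun c => (n c : ℕ)) else 0) ≤ U := by
    have := hsum 0
    simp only [dirsOf_eq] at this
    exact this
  have hA0 : ∀ l, 0 ≤ A l := fun l => Real.sSup_nonneg (by
    rintro _ ⟨x, -, rfl⟩
    exact abs_nonneg _)
  have hH0 : ∀ l, 0 ≤ H l := fun l => Real.sSup_nonneg (by
    rintro _ ⟨x, -, y, -, -, rfl⟩
    positivity)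
  have hlen : ∀ n : Fin T × Fin din → ℕ,
      (monoList Finset.univ.toList n).length = ∑ c, n c := fun n => by
    rw [length_monoList, Finset.sum_map_toList]
  have hAU : ∀ n : {n : Fin T × Fin din → Fin (k + 1) // ∑ c, (n c : ℕ) ≤ k}, ∀ x ∈ cube T din,
      |coordDeriv f (monoList Finset.univ.toList fun c => (n.1 c : ℕ)) x| ≤ U := by
    intro n x hx
    obtain ⟨C, hC⟩ := hbdd (monoList Finset.univ.toList fun c => (n.1 c : ℕ))
      ((hlen _).trans_le n.2)
    have h1 : |coordDeriv f (monoList Finset.univ.toList fun c => (n.1 c : ℕ)) x|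
        ≤ A (monoList Finset.univ.toList fun c => (n.1 c : ℕ)) :=
      le_csSup ⟨C, by rintro _ ⟨y, hy, rfl⟩; exact hC y hy⟩ ⟨x, hx, rfl⟩
    have h2 := Finset.single_le_sum (f := fun n : Fin T × Fin din → Fin (k + 1) =>
      if ∑ c, (n c : ℕ) ≤ k then A (monoList Finset.univ.toList fun c => (n c : ℕ)) else 0)
      (fun n _ => by split_ifs <;> simp [hA0]) (Finset.mem_univ n.1)
    simp only [if_pos n.2] at h2
    have h3 : 0 ≤ ∑ n : Fin T × Fin din → Fin (k + 1), if ∑ c, (n c : ℕ) = k then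
        H (monoList Finset.univ.toList fun c => (n c : ℕ)) else 0 :=
      Finset.sum_nonneg fun n _ => by split_ifs <;> simp [hH0]
    linarith
  have hHU : ∑ n ∈ Finset.piAntidiag Finset.univ k, H (monoList Finset.univ.toList n) ≤ U := by
    rw [sum_piAntidiag_univ]
    have h3 : 0 ≤ ∑ n : Fin T × Fin din → Fin (k + 1), if ∑ c, (n c : ℕ) ≤ k then
        A (monoList Finset.univ.toList fun c => (n c : ℕ)) else 0 :=
      Finset.sum_nonneg fun n _ => by split_ifs <;> simp [hA0]
    linarith
  have hU0 : 0 ≤ U := (Finset.sum_nonneg fun n _ => hH0 _).trans hHU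
  refine ⟨fun x hx => ?_, k, ω, hβ, hω0, hω1, fun n x =>
    coordDeriv f (monoList Finset.univ.toList fun c => (n.1 c : ℕ)) x
      / ∏ c, ((n.1 c : ℕ).factorial : ℝ), fun n x hx => ?_, fun h hh x₀ hx₀ x hx hxh => ?_⟩
  · have := hAU ⟨0, by simp⟩ x hx
    have h0 : (monoList Finset.univ.toList fun c : Fin T × Fin din => ((0 : Fin (k + 1)) : ℕ)) = [] :=
      monoList_zero _
    simp only [Pi.zero_apply, h0] at this
    exact this
  · rw [abs_div]
    refine (div_le_self (abs_nonneg _) ?_).trans (hAU n x hx)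
    rw [Finset.abs_prod]
    refine Finset.one_le_prod fun c _ => ?_
    rw [Nat.abs_cast]
    exact_mod_cast Nat.factorial_pos _
  · have hS : ∀ l, l.length = k → ∀ x ∈ cube T din, ∀ y ∈ cube T din,
        (∀ t i, |x t i - y t i| ≤ h) → |coordDeriv f l x - coordDeriv f l y| ≤ H l * h ^ ω := by
      intro l hl x hx y hy hxy
      rcases eq_or_ne x y with rfl | hne
      · rw [sub_self, abs_zero]
        exact mul_nonneg (hH0 l) (by positivity)
      obtain ⟨C, hC⟩ := hhol l hl
      have hpos : ∀ x y : Fin T → Fin din → ℝ, x ≠ y → 0 < ‖x - y‖ ^ ω := fun x y hne =>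
        Real.rpow_pos_of_pos (norm_pos_iff.2 (sub_ne_zero.2 hne)) _
      have h1 : |coordDeriv f l x - coordDeriv f l y| / ‖x - y‖ ^ ω ≤ H l := by
        refine le_csSup ⟨C, ?_⟩ ⟨x, hx, y, hy, hne, rfl⟩
        rintro _ ⟨x', hx', y', hy', hne', rfl⟩
        exact (div_le_iff₀ (hpos _ _ hne')).2 (hC x' hx' y' hy')
      have h2 : ‖x - y‖ ≤ h := (pi_norm_le_iff_of_nonneg hh.le).2 fun t =>
        (pi_norm_le_iff_of_nonneg hh.le).2 fun i => by simpa using hxy t i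
      refine ((div_le_iff₀ (hpos _ _ hne)).1 h1).trans ?_
      gcongr
      exact hH0 l
    have key := abs_coordDeriv_sub_taylor_le (S := fun l => H l * h ^ ω) hx₀ hdiff hS
      (Finset.nodup_toList Finset.univ) (j := k) (l := []) (by simp) hx hxh
      (fun c hc => absurd (by simp) hc)
    simp only [Finset.toList_toFinset, List.append_nil] at key
    rw [← sum_subtype_multiIndex k fun n => coordDeriv f (monoList Finset.univ.toList n) x₀
      * ∏ c, ((x c.1 c.2 - x₀ c.1 c.2) ^ n c / (n c).factorial), ← Finset.sum_mul] at key
    have hterm : ∀ n : {n : Fin T × Fin din → Fin (k + 1) // ∑ c, (n c : ℕ) ≤ k},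
        coordDeriv f (monoList Finset.univ.toList fun c => (n.1 c : ℕ)) x₀
          / (∏ c, ((n.1 c : ℕ).factorial : ℝ))
          * ((monoList Finset.univ.toList fun c => (n.1 c : ℕ)).map
            fun c => x c.1 c.2 - x₀ c.1 c.2).prod
        = coordDeriv f (monoList Finset.univ.toList fun c => (n.1 c : ℕ)) x₀
          * ∏ c, ((x c.1 c.2 - x₀ c.1 c.2) ^ (n.1 c : ℕ) / ((n.1 c : ℕ).factorial : ℝ)) := by
      intro n
      rw [prod_map_monoList, Finset.prod_map_toList, Finset.prod_div_distrib]
      ring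
    rw [Finset.sum_congr rfl fun n _ => hterm n]
    refine key.trans ?_
    rw [hβ, Real.rpow_add hh, Real.rpow_natCast]
    have hle : (if k = 0 then (1 : ℝ) else 2) ≤ 2 := by split_ifs <;> norm_num
    have hs0 : 0 ≤ ∑ n ∈ Finset.piAntidiag Finset.univ k, H (monoList Finset.univ.toList n) :=
      Finset.sum_nonneg fun n _ => hH0 _
    calc _ ≤ 2 * (h ^ k * (U * h ^ ω)) := by gcongr
      _ = _ := by ring

end Taylor

/-! ### Approximation of Hölder functions by threshold-ReLU networks -/

section HolderApprox

lemma count_monoList {ι : Type*} [Fintype ι] [DecidableEq ι] (n : ι → ℕ) (c : ι) :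
    (monoList Finset.univ.toList n).count c = n c := by
  rw [monoList, List.count_flatMap, Finset.sum_map_toList, Finset.sum_eq_single c]
  · simp
  · intro a _ ha
    simp [List.count_replicate, ha]
  · simp

lemma card_multiIndex_le (ι : Type*) [Fintype ι] [DecidableEq ι] [Nonempty ι] (k : ℕ) :
    Fintype.card {n : ι → Fin (k + 1) // ∑ c, (n c : ℕ) ≤ k} ≤ (k + 1) * Fintype.card ι ^ k := by
  have hlen : ∀ n : {n : ι → Fin (k + 1) // ∑ c, (n c : ℕ) ≤ k},
      (monoList Finset.univ.toList fun c => (n.1 c : ℕ)).length < k + 1 := fun n => by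
    rw [length_monoList, Finset.sum_map_toList]
    exact Nat.lt_succ_iff.2 n.2
  set F : {n : ι → Fin (k + 1) // ∑ c, (n c : ℕ) ≤ k} → Σ j : Fin (k + 1), Fin j → ι :=
    fun n => ⟨⟨_, hlen n⟩, (monoList Finset.univ.toList fun c => (n.1 c : ℕ)).get⟩ with hF
  have hinj : Function.Injective F := by
    intro a b hab
    have hr : ∀ n, List.ofFn (F n).2 = monoList Finset.univ.toList fun c => (n.1 c : ℕ) :=
      fun n => List.ofFn_get _
    have h1 := (hr a).symm.trans (hab ▸ hr b)
    refine Subtype.ext (funext fun c => Fin.ext ?_)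
    rw [← count_monoList (fun c => (a.1 c : ℕ)) c, h1, count_monoList]
  refine (Fintype.card_le_of_injective F hinj).trans ?_
  rw [Fintype.card_sigma]
  simp only [Fintype.card_fun, Fintype.card_fin]
  calc ∑ j : Fin (k + 1), Fintype.card ι ^ (j : ℕ)
      ≤ ∑ _j : Fin (k + 1), Fintype.card ι ^ k := Finset.sum_le_sum fun j _ =>
        Nat.pow_le_pow_right Fintype.card_pos (Nat.lt_succ_iff.1 j.2)
    _ = _ := by simp

lemma prod_map_mul_const {ι : Type*} (L : List ι) (a : ℝ) (v : ι → ℝ) :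
    (L.map fun c => a * v c).prod = a ^ L.length * (L.map v).prod := by
  induction L with
  | nil => simp
  | cons c L ih => simp only [List.map_cons, List.prod_cons, ih, List.length_cons]; ring

variable {T din : ℕ}

lemma exists_reach_holder (hT : 0 < T) (hdin : 0 < din) {β U : ℝ} (hU : 0 < U)
    {f : (Fin T → Fin din → ℝ) → ℝ} (hf : MemHolderClass T din 1 β U (fun x _ => f x))
    {b I J K : ℕ} (l : ℕ) (hb : 0 < b) (hI : 0 < I) (hJ : 0 < J) (hK : 0 < K)
    (hKM : K ^ (T * din) ≤ (I * J) * (I * J)) :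
    ∃ (k m : ℕ) (S' : Set (cube T din → ℝ)) (g : cube T din → ℝ), (k : ℝ) < β ∧
      m ≤ (k + 1) * (T * din) ^ k ∧
      Reach (m * 2 * (T * din * (2 * J + 4) + (4 * J + 2 * b + 8)))
        (I + (I + 1) + (I + (I + (1 + (I * 2 + I * (1 + l * 2)))) + k * (l * 2)))
        (Set.range fun (c : Fin T × Fin din) (X : cube T din) => X.1 c.1 c.2) S' ∧
      g ∈ affSpan S' ∧ ∀ X : cube T din,
        |g X - f X| ≤ m * (2 * U * ((k + 1) * ((b : ℝ) ^ l)⁻¹)) + 2 * U * ((K : ℝ)⁻¹) ^ β := by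
  classical
  have : Nonempty (Fin T × Fin din) := ⟨⟨0, hT⟩, ⟨0, hdin⟩⟩
  obtain ⟨-, k, ω, hβ, hω0, hω1, a, haU, hTay⟩ := hf.exists_taylor
  have hK0 : (0 : ℝ) < K := by exact_mod_cast hK
  have hcard : Fintype.card (Fin T × Fin din) = T * din := by simp
  set node : (Fin T × Fin din → ℕ) → Fin T → Fin din → ℝ := fun κ t i => κ (t, i) / K with hnode
  set coef : {n : Fin T × Fin din → Fin (k + 1) // ∑ c, (n c : ℕ) ≤ k} →
      (Fin T × Fin din → ℕ) → ℝ := fun n κ => if node κ ∈ cube T din then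
    a n (node κ) * (K : ℝ)⁻¹ ^ (monoList Finset.univ.toList fun c => (n.1 c : ℕ)).length else 0
    with hcoef
  have hcoefU : ∀ n κ, |coef n κ| ≤ U := by
    intro n κ
    simp only [hcoef]
    split_ifs with hκ
    · rw [abs_mul, abs_of_nonneg (a := _ ^ _) (by positivity)]
      exact (mul_le_of_le_one_right (abs_nonneg _) (pow_le_one₀ (by positivity)
        (inv_le_one_of_one_le₀ (by exact_mod_cast hK)))).trans (haU n _ hκ)
    · simpa using hU.le
  obtain ⟨S', g, hR, hg, hgE⟩ := exists_reach_piecewisePoly (l := l)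
    (S := Set.range fun (c : Fin T × Fin din) (X : cube T din) => X.1 c.1 c.2)
    (x := fun c X => X.1 c.1 c.2) (fun c => mem_affSpan ⟨c, rfl⟩) (fun c X => X.2 c.1 c.2)
    hb hI hJ hK (by rwa [hcard]) hU hcoefU
    (p := fun n => monoList Finset.univ.toList fun c => (n.1 c : ℕ)) (k := k) (fun n => by
      rw [length_monoList, Finset.sum_map_toList]
      exact n.2)
  rw [hcard] at hR
  refine ⟨k, _, S', g, by linarith, hcard ▸ card_multiIndex_le (Fin T × Fin din) k, hR, hg,
    fun X => ?_⟩
  set κ : Fin T × Fin din → ℕ := fun c => cellIdx K (X.1 c.1 c.2) with hκ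
  have hnodemem : node κ ∈ cube T din := fun t i =>
    ⟨by positivity, (div_le_one hK0).2 (by exact_mod_cast (cellIdx_lt hK _).le)⟩
  have hpos : ∀ t i, X.1 t i - node κ t i = (K : ℝ)⁻¹ * cellPos K (X.1 t i) := by
    intro t i
    simp only [hnode, hκ, cellPos]
    field_simp
  have hnear : ∀ t i, node κ t i ≤ X.1 t i ∧ X.1 t i ≤ node κ t i + (K : ℝ)⁻¹ := by
    intro t i
    have h1 := hpos t i
    have h2 := cellPos_mem_Icc hK (X.2 t i)
    have h3 : (0 : ℝ) < (K : ℝ)⁻¹ := by positivity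
    have h4 := mul_nonneg h3.le h2.1
    have h5 := mul_le_of_le_one_right h3.le h2.2
    exact ⟨by linarith, by linarith⟩
  have hT := hTay (K : ℝ)⁻¹ (by positivity) _ hnodemem X.1 X.2 hnear
  have hG := hgE X
  have hsum : ∑ n, coef n κ * ((monoList Finset.univ.toList fun c => (n.1 c : ℕ)).map fun c =>
        cellPos K (X.1 c.1 c.2)).prod
      = ∑ n, a n (node κ) * ((monoList Finset.univ.toList fun c => (n.1 c : ℕ)).map
        fun c => X.1 c.1 c.2 - node κ c.1 c.2).prod := by
    refine Finset.sum_congr rfl fun n _ => ?_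
    simp only [hcoef, if_pos hnodemem, hpos, prod_map_mul_const]
    ring
  rw [hsum] at hG
  rw [abs_sub_comm] at hT
  exact (abs_sub_le _ _ _).trans (add_le_add hG hT)

end HolderApprox

section HolderRate

/-- A number of cells per coordinate adapted to `P ^ 2` cells in dimension `D`. -/
lemma exists_gridSize {D P : ℕ} (hD : 0 < D) (hP : 0 < P) {β : ℝ} (hβ : 0 < β) :
    ∃ K : ℕ, 0 < K ∧ K ^ D ≤ P * P ∧
      ((K : ℝ)⁻¹) ^ β ≤ 2 * (D : ℝ) ^ ((⌊β⌋₊ : ℝ) + max β 1 / 2) * (P : ℝ) ^ (-(2 * β) / D) := by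
  have hP1 : (1 : ℝ) ≤ P := by exact_mod_cast hP
  have hP0 : (0 : ℝ) < P := by linarith
  obtain rfl | hD2 : D = 1 ∨ 2 ≤ D := by omega
  · refine ⟨P * P, Nat.mul_pos hP hP, by simp, ?_⟩
    rw [Nat.cast_one, Real.one_rpow, mul_one, div_one, Nat.cast_mul, ← sq, Real.rpow_neg hP0.le,
      Real.rpow_mul hP0.le, ← Real.inv_rpow (by positivity), Real.rpow_two]
    have : 0 ≤ ((P : ℝ) ^ 2)⁻¹ ^ β := by positivity
    linarith
  · have hD2' : (2 : ℝ) ≤ D := by exact_mod_cast hD2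
    set r : ℝ := (P : ℝ) ^ (2 / (D : ℝ)) with hr
    have hr1 : 1 ≤ r := Real.one_le_rpow hP1 (by positivity)
    have hK : 1 ≤ ⌊r⌋₊ := Nat.le_floor (by simpa using hr1)
    have hK1 : (1 : ℝ) ≤ ⌊r⌋₊ := by exact_mod_cast hK
    refine ⟨⌊r⌋₊, hK, ?_, ?_⟩
    · have h1 : ((⌊r⌋₊ : ℝ)) ^ D ≤ (P : ℝ) * P := by
        calc ((⌊r⌋₊ : ℝ)) ^ D ≤ r ^ D :=
              pow_le_pow_left₀ (by positivity) (Nat.floor_le (by linarith)) D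
          _ = (P : ℝ) * P := by
              rw [hr, ← Real.rpow_natCast, ← Real.rpow_mul hP0.le,
                div_mul_cancel₀ _ (by positivity), Real.rpow_two, sq]
      exact_mod_cast h1
    · have h1 : ((⌊r⌋₊ : ℝ))⁻¹ ≤ 2 * r⁻¹ := by
        rw [← div_eq_mul_inv, inv_le_comm₀ (by positivity) (by positivity), inv_div]
        have := Nat.lt_floor_add_one r
        linarith
      have h2 : (2 : ℝ) ^ β ≤ 2 * (D : ℝ) ^ ((⌊β⌋₊ : ℝ) + max β 1 / 2) := by
        rcases lt_or_ge β 1 with hβ1 | hβ1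
        · have h3 : (2 : ℝ) ^ β ≤ 2 ^ (1 : ℝ) :=
            Real.rpow_le_rpow_of_exponent_le (by norm_num) hβ1.le
          have h4 : 1 ≤ (D : ℝ) ^ ((⌊β⌋₊ : ℝ) + max β 1 / 2) :=
            Real.one_le_rpow (by linarith) (by positivity)
          rw [Real.rpow_one] at h3
          linarith
        · have h3 : (1 : ℝ) ≤ ⌊β⌋₊ := by exact_mod_cast Nat.le_floor (by simpa using hβ1)
          have h4 := Nat.lt_floor_add_one β
          have h5 : (2 : ℝ) ^ β ≤ (D : ℝ) ^ β := Real.rpow_le_rpow (by norm_num) hD2' hβ.le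
          have h6 : (D : ℝ) ^ β ≤ (D : ℝ) ^ ((⌊β⌋₊ : ℝ) + max β 1 / 2) :=
            Real.rpow_le_rpow_of_exponent_le (by linarith) (by rw [max_eq_left hβ1]; linarith)
          have h7 : 0 ≤ (D : ℝ) ^ ((⌊β⌋₊ : ℝ) + max β 1 / 2) := by positivity
          linarith
      calc ((⌊r⌋₊ : ℝ))⁻¹ ^ β ≤ (2 * r⁻¹) ^ β := Real.rpow_le_rpow (by positivity) h1 hβ.le
        _ = 2 ^ β * (P : ℝ) ^ (-(2 * β) / D) := by
            rw [Real.mul_rpow (by norm_num) (by positivity), hr, ← Real.rpow_neg hP0.le,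
              ← Real.rpow_mul hP0.le]
            congr 2
            ring
        _ ≤ _ := by gcongr

variable {din T ds I J : ℕ} {β : ℝ}

lemma three_le_clog {J : ℕ} (hJ : 0 < J) : 3 ≤ Nat.clog 2 (8 * J) :=
  (Nat.lt_clog_iff_pow_lt (by norm_num)).2 (by omega)

lemma le_widthOf (hdin : 0 < din) (hJ : 0 < J) :
    76 * (⌊β⌋₊ + 1) ^ 2 * (T * din) ^ (⌊β⌋₊ + 1) * J ≤ widthOf din T ds J β := by
  have h1 : widthOf din T ds J β = 76 * (⌊β⌋₊ + 1) ^ 2 * (T * din) ^ (⌊β⌋₊ + 1) * J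
      * (3 ^ (din * T) * din * Nat.clog 2 (8 * J)) + ds := by
    unfold widthOf
    ring
  rw [h1]
  have h2 := three_le_clog hJ
  exact (Nat.le_mul_of_pos_right _ (by positivity)).trans (Nat.le_add_right _ _)

lemma mul_le_widthOf (hT : 0 < T) (hdin : 0 < din) (hJ : 0 < J) :
    76 * (T * din) ≤ widthOf din T ds J β := by
  have hD : 0 < T * din := Nat.mul_pos hT hdin
  refine le_trans ?_ (le_widthOf hdin hJ)
  have h1 : T * din ≤ (T * din) ^ (⌊β⌋₊ + 1) := Nat.le_self_pow (by omega) _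
  calc 76 * (T * din) ≤ 76 * (T * din) ^ (⌊β⌋₊ + 1) * ((⌊β⌋₊ + 1) ^ 2 * J) :=
        (Nat.mul_le_mul_left _ h1).trans (Nat.le_mul_of_pos_right _ (by positivity))
    _ = _ := by ring

lemma blocks_le_widthOf (hT : 0 < T) (hdin : 0 < din) (hJ : 0 < J) {k m : ℕ} (hk : k ≤ ⌊β⌋₊)
    (hm : m ≤ (k + 1) * (T * din) ^ k) :
    m * 2 * (T * din * (2 * J + 4) + (4 * J + 2 * (2 * J) + 8)) ≤ widthOf din T ds J β := by
  have hD : 0 < T * din := Nat.mul_pos hT hdin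
  refine le_trans ?_ (le_widthOf hdin hJ)
  set D := T * din
  set B := ⌊β⌋₊
  have h1 : m ≤ (B + 1) * D ^ B :=
    hm.trans (Nat.mul_le_mul (by omega) (Nat.pow_le_pow_right hD hk))
  have h2 : D * (2 * J + 4) + (4 * J + 2 * (2 * J) + 8) ≤ 22 * (D * J) := by
    have h3 : D ≤ D * J := Nat.le_mul_of_pos_right _ hJ
    have h4 : J ≤ D * J := Nat.le_mul_of_pos_left _ hD
    have h5 : 1 ≤ D * J := Nat.mul_pos hD hJ
    rw [mul_add, mul_left_comm]
    omega
  calc m * 2 * (D * (2 * J + 4) + (4 * J + 2 * (2 * J) + 8))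
      ≤ (B + 1) * D ^ B * 2 * (22 * (D * J)) := by gcongr
    _ = 44 * ((B + 1) * D ^ (B + 1) * J) := by ring
    _ ≤ 76 * ((B + 1) * D ^ (B + 1) * J) * (B + 1) :=
        (Nat.mul_le_mul_right _ (by norm_num)).trans (Nat.le_mul_of_pos_right _ (by omega))
    _ = _ := by ring

lemma layers_le_depthOf (hdin : 0 < din) (hI : 0 < I) {k : ℕ} (hk : k ≤ ⌊β⌋₊) :
    T + (I + (I + 1) + (I + (I + (1 + (I * 2 + I *
      (1 + 2 * (⌊β⌋₊ + 1) * Nat.clog 2 (8 * I) * 2))))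
        + k * (2 * (⌊β⌋₊ + 1) * Nat.clog 2 (8 * I) * 2))) ≤ depthOf din T I β := by
  unfold depthOf
  have ha := three_le_clog hI
  set a := Nat.clog 2 (8 * I)
  set B := ⌊β⌋₊
  have h1 : I + k ≤ I * (B + 1) := by
    have := Nat.mul_le_mul hI hk
    rw [mul_add]
    omega
  have h2 : I ≤ (B + 1) ^ 2 * I * a := by
    calc I ≤ I * ((B + 1) ^ 2 * a) := Nat.le_mul_of_pos_right _ (by positivity)
      _ = _ := by ring
  have h3 : 2 * (B + 1) * a * 2 * (I + k) ≤ 4 * ((B + 1) ^ 2 * I * a) := by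
    calc 2 * (B + 1) * a * 2 * (I + k) ≤ 2 * (B + 1) * a * 2 * (I * (B + 1)) := by gcongr
      _ = _ := by ring
  have h4 : T ≤ 6 * din * T := Nat.le_mul_of_pos_left _ (by positivity)
  have h5 : 42 * (B + 1) ^ 2 * I * a = 42 * ((B + 1) ^ 2 * I * a) := by ring
  have h6 : T + (I + (I + 1) + (I + (I + (1 + (I * 2 + I * (1 + 2 * (B + 1) * a * 2))))
      + k * (2 * (B + 1) * a * 2))) = T + 7 * I + 2 + 2 * (B + 1) * a * 2 * (I + k) := by ring
  rw [h5, h6]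
  omega

lemma pow_le_digits (hI : 0 < I) (s : ℕ) :
    ((J * I : ℕ) : ℝ) ^ (2 * s) ≤ ((2 * J : ℕ) : ℝ) ^ (2 * s * Nat.clog 2 (8 * I)) := by
  have ha := three_le_clog hI
  have h1 : 8 * I ≤ 2 ^ Nat.clog 2 (8 * I) := Nat.le_pow_clog (by norm_num) _
  have h2 : J * I ≤ (2 * J) ^ Nat.clog 2 (8 * I) := by
    rw [mul_pow, mul_comm]
    exact Nat.mul_le_mul (by omega) (Nat.le_self_pow (by omega) _)
  rw [mul_comm (2 * s) (Nat.clog 2 (8 * I)), pow_mul ((2 * J : ℕ) : ℝ) (Nat.clog 2 (8 * I))]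
  exact_mod_cast Nat.pow_le_pow_left h2 (2 * s)

lemma exists_reach_holder_rate (hT : 0 < T) (hdin : 0 < din) (hI : 0 < I) (hJ : 0 < J)
    (hβ : 0 < β) {U : ℝ} (hU : 0 < U) {f : (Fin T → Fin din → ℝ) → ℝ}
    (hf : MemHolderClass T din 1 β U (fun x _ => f x)) :
    ∃ (l : ℕ) (S' : Set (cube T din → ℝ)) (g : cube T din → ℝ), T + l = depthOf din T I β ∧
      Reach (widthOf din T ds J β) l
        (Set.range fun (c : Fin T × Fin din) (X : cube T din) => X.1 c.1 c.2) S' ∧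
      g ∈ affSpan S' ∧ ∀ X : cube T din, |g X - f X| ≤ 6 * U * ((⌊β⌋₊ : ℝ) + 1) ^ 2
        * ((din * T : ℕ) : ℝ) ^ ((⌊β⌋₊ : ℝ) + max β 1 / 2)
        * ((J * I : ℕ) : ℝ) ^ (-(2 * β) / ((din * T : ℕ) : ℝ)) := by
  have hD : 0 < din * T := Nat.mul_pos hdin hT
  have hD1 : (1 : ℝ) ≤ (din * T : ℕ) := by exact_mod_cast hD
  have hP : 0 < J * I := Nat.mul_pos hJ hI
  have hP1 : (1 : ℝ) ≤ (J * I : ℕ) := by exact_mod_cast hP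
  obtain ⟨K, hK, hKD, hKβ⟩ := exists_gridSize hD hP hβ
  obtain ⟨k, m, S', g, hkβ, hm, hR, hg, hE⟩ := exists_reach_holder hT hdin hU hf
    (b := 2 * J) (2 * (⌊β⌋₊ + 1) * Nat.clog 2 (8 * I)) (by omega) hI hJ hK
    (by rwa [mul_comm T, mul_comm I])
  have hkB : k ≤ ⌊β⌋₊ := Nat.le_floor hkβ.le
  have hdepth := layers_le_depthOf (T := T) hdin hI hkB
  set Lr := I + (I + 1) + (I + (I + (1 + (I * 2 + I *
      (1 + 2 * (⌊β⌋₊ + 1) * Nat.clog 2 (8 * I) * 2))))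
        + k * (2 * (⌊β⌋₊ + 1) * Nat.clog 2 (8 * I) * 2)) with hLr
  have hcarry := (reach_carry (S := Set.range fun (c : Fin T × Fin din) (X : cube T din) =>
    X.1 c.1 c.2) (fun c => mem_affSpan ⟨c, rfl⟩) (fun c X => (X.2 c.1 c.2).1)
    (depthOf din T I β - T - Lr)).mono subset_affSpan subset_affSpan
    (w₁ := widthOf din T ds J β) (by
      have := mul_le_widthOf (ds := ds) (β := β) hT hdin hJ
      simp only [Fintype.card_prod, Fintype.card_fin]
      omega)
  refine ⟨depthOf din T I β - T - Lr + Lr, S', g, by omega, hcarry.trans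
    (hR.mono subset_affSpan subset_affSpan (blocks_le_widthOf hT hdin hJ hkB hm)), hg,
    fun X => (hE X).trans ?_⟩
  set B := ⌊β⌋₊ with hB
  set Q : ℝ := ((J * I : ℕ) : ℝ) ^ (-(2 * β) / ((din * T : ℕ) : ℝ)) with hQ
  set A : ℝ := ((din * T : ℕ) : ℝ) ^ ((B : ℝ) + max β 1 / 2) with hA
  have hkB' : (k : ℝ) ≤ B := by exact_mod_cast hkB
  have hm' : (m : ℝ) ≤ (B + 1) * A := by
    have h1 : (m : ℝ) ≤ (k + 1) * ((din * T : ℕ) : ℝ) ^ k := by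
      rw [mul_comm din T]
      exact_mod_cast hm
    refine h1.trans (mul_le_mul (by linarith) ?_ (by positivity) (by positivity))
    rw [← Real.rpow_natCast]
    exact Real.rpow_le_rpow_of_exponent_le hD1 (by
      have : 0 ≤ max β 1 / 2 := by positivity
      linarith)
  have hdig : (((2 * J : ℕ) : ℝ) ^ (2 * (B + 1) * Nat.clog 2 (8 * I)))⁻¹ ≤ Q := by
    have h1 := pow_le_digits hI (J := J) (B + 1)
    refine (inv_anti₀ (by positivity) h1).trans ?_
    rw [← Real.rpow_natCast, ← Real.rpow_neg (by positivity)]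
    refine Real.rpow_le_rpow_of_exponent_le hP1 ?_
    rw [neg_div, neg_le_neg_iff]
    refine (div_le_self (by positivity) hD1).trans ?_
    have := Nat.lt_floor_add_one β
    push_cast
    linarith
  have hB1 : (1 : ℝ) ≤ (B + 1) ^ 2 := one_le_pow₀ (by linarith [(Nat.cast_nonneg B : (0 : ℝ) ≤ B)])
  have hA0 : 0 ≤ A := by positivity
  have hQ0 : 0 ≤ Q := by positivity
  calc _ ≤ (B + 1) * A * (2 * U * ((B + 1) * Q)) + 2 * U * (2 * A * Q) := by gcongr
    _ = 2 * U * (B + 1) ^ 2 * A * Q + 4 * U * 1 * A * Q := by ring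
    _ ≤ 2 * U * (B + 1) ^ 2 * A * Q + 4 * U * (B + 1) ^ 2 * A * Q := by gcongr
    _ = _ := by ring

end HolderRate

/-! ### The prediction error bound -/

section PredictionError

open Filter Topology

variable {din d ds L T N : ℕ}

lemma measurable_of_mem_scalarClass {U : ℝ} {ψ : (Fin T → Fin din → ℝ) → ℝ}
    (hψ : ψ ∈ scalarClass din d ds L T U) : Measurable ψ := by
  obtain ⟨net, -, hψe⟩ := hψ
  have : ψ = fun X => paramForward net.params (extendInput X) (T - 1) := by
    ext X
    rw [hψe, net.forward_eq_paramForward]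
  rw [this]
  exact (continuous_paramForward continuous_const
    (fun t i => continuous_extendInput t i) _).measurable

lemma abs_le_of_mem_scalarClass (hT : 0 < T) {U : ℝ} {ψ : (Fin T → Fin din → ℝ) → ℝ}
    (hψ : ψ ∈ scalarClass din d ds L T U) (X : Fin T → Fin din → ℝ) : |ψ X| ≤ U := by
  obtain ⟨net, hnet, hψe⟩ := hψ
  rw [hψe]
  exact hnet X _ (by omega) 0

/-- The excess risk of the empirical risk minimizer in terms of the error of a pointwise limit of
clipped networks. -/
lemma integral_erm_le_of_tendsto (hT : 0 < T) (hdin : din ≤ d)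
    (hd : 3 ≤ d) (hL : 1 ≤ L)
    (hN : 4 * T * ((d : ℝ) ^ 2 * (L : ℝ) ^ 2 * Real.log (max d L)) ≤ N)
    {μ : Measure ((Fin T → Fin din → ℝ) × ℝ)} [IsProbabilityMeasure μ] {σ M : ℝ} (hσ : 0 < σ)
    (hexp : Integrable (fun p => Real.exp (σ * |p.2|)) μ)
    (hM : ∫ p, Real.exp (σ * |p.2|) ∂μ ≤ M) {U : ℝ} (hU : 1 ≤ U)
    {f0 : (Fin T → Fin din → ℝ) → ℝ}
    (hf0 : (fun p => f0 p.1)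
      =ᵐ[μ] μ[(fun p => p.2) | MeasurableSpace.comap Prod.fst inferInstance])
    (hf0U : ∀ X ∈ cube T din, |f0 X| ≤ U) (hcube : ∀ᵐ p ∂μ, p.1 ∈ cube T din)
    {fhat : (Fin N → (Fin T → Fin din → ℝ) × ℝ) → (Fin T → Fin din → ℝ) → ℝ}
    (hfhat : ∀ s, fhat s ∈ scalarClass din d ds L T U)
    (herm : ∀ s, ∀ φ ∈ scalarClass din d ds L T U, empRisk s (fhat s) ≤ empRisk s φ)
    (hint : Integrable (fun s => risk μ (fhat s)) (Measure.pi fun _ : Fin N => μ))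
    {ψ : ℕ → (Fin T → Fin din → ℝ) → ℝ} (hψ : ∀ n, ψ n ∈ scalarClass din d ds L T U)
    {g : cube T din → ℝ}
    (hlim : ∀ X : cube T din, ∀ᶠ n in atTop, ψ n X.1 = relu (g X + U) - relu (g X - U) - U)
    {E : ℝ} (hg : ∀ X : cube T din, |g X - f0 X| ≤ E) :
    ∫ s, (risk μ (fhat s) - risk μ f0) ∂(Measure.pi fun _ : Fin N => μ)
      ≤ 2 * E ^ 2
        + (6528 * T * (7 + 4 / σ) ^ 2 + (24 + 8 / σ) + 16 * |M| / σ)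
          * U ^ 5 * Real.log N ^ 5 * (N : ℝ)⁻¹ * (d : ℝ) ^ 2 * (L : ℝ) ^ 2
          * Real.log (max d L) := by
  have hf0U' : ∀ᵐ p ∂μ, |f0 p.1| ≤ U := hcube.mono fun p hp => hf0U _ hp
  have hf0m : AEStronglyMeasurable (fun p => f0 p.1) μ :=
    integrable_condExp.aestronglyMeasurable.congr hf0.symm
  have hψm : ∀ n, AEStronglyMeasurable (fun p : (Fin T → Fin din → ℝ) × ℝ => ψ n p.1) μ :=
    fun n => ((measurable_of_mem_scalarClass (hψ n)).comp measurable_fst).aestronglyMeasurable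
  have hsq : ∀ n, ∀ᵐ p ∂μ, |(ψ n p.1 - f0 p.1) ^ 2| ≤ (2 * U) ^ 2 := fun n => by
    filter_upwards [hf0U'] with p hp
    rw [abs_pow]
    refine pow_le_pow_left₀ (abs_nonneg _) ((abs_sub _ _).trans ?_) 2
    linarith [abs_le_of_mem_scalarClass hT (hψ n) p.1]
  have hsqm : ∀ n, AEStronglyMeasurable (fun p => (ψ n p.1 - f0 p.1) ^ 2) μ :=
    fun n => ((hψm n).sub hf0m).pow 2
  set u : ℕ → (Fin T → Fin din → ℝ) × ℝ → ℝ :=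
    fun n p => max ((ψ n p.1 - f0 p.1) ^ 2 - E ^ 2) 0 with hu
  have hum : ∀ n, AEStronglyMeasurable (u n) μ := fun n =>
    ((hsqm n).sub aestronglyMeasurable_const).sup aestronglyMeasurable_const
  have hub : ∀ n, ∀ᵐ p ∂μ, ‖u n p‖ ≤ (2 * U) ^ 2 := fun n => by
    filter_upwards [hsq n] with p hp
    rw [hu, Real.norm_eq_abs, abs_of_nonneg (le_max_right _ _)]
    exact max_le (by linarith [le_abs_self ((ψ n p.1 - f0 p.1) ^ 2), sq_nonneg E])
      (by positivity)
  have hu0 : Tendsto (fun n => ∫ p, u n p ∂μ) atTop (𝓝 (∫ _, (0 : ℝ) ∂μ)) := by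
    refine tendsto_integral_of_dominated_convergence (fun _ => (2 * U) ^ 2) hum
      (integrable_const _) hub ?_
    filter_upwards [hcube] with p hp
    refine tendsto_const_nhds.congr' ?_
    filter_upwards [hlim ⟨p.1, hp⟩] with n hn
    refine (max_eq_right (sub_nonpos.2 ?_)).symm
    rw [← sq_abs]
    refine pow_le_pow_left₀ (abs_nonneg _) ?_ 2
    rw [hn]
    exact (abs_reluClip_sub_le _ (hf0U _ hp)).trans (hg ⟨p.1, hp⟩)
  rw [integral_zero] at hu0
  have hle : ∀ n, ∫ p, (ψ n p.1 - f0 p.1) ^ 2 ∂μ ≤ E ^ 2 + ∫ p, u n p ∂μ := fun n => by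
    have hui : Integrable (u n) μ := Integrable.of_bound (hum n) _ (hub n)
    calc ∫ p, (ψ n p.1 - f0 p.1) ^ 2 ∂μ ≤ ∫ p, (E ^ 2 + u n p) ∂μ :=
          integral_mono (Integrable.of_bound (hsqm n) _ (hsq n))
            ((integrable_const _).add hui) fun p => by
              have := le_max_left ((ψ n p.1 - f0 p.1) ^ 2 - E ^ 2) 0
              simp only [hu]
              linarith
      _ = E ^ 2 + ∫ p, u n p ∂μ := by
          rw [integral_add (integrable_const _) hui]
          simp
  have hlim' := ((hu0.const_add (E ^ 2)).const_mul 2).add_const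
    ((6528 * T * (7 + 4 / σ) ^ 2 + (24 + 8 / σ) + 16 * |M| / σ)
          * U ^ 5 * Real.log N ^ 5 * (N : ℝ)⁻¹ * (d : ℝ) ^ 2 * (L : ℝ) ^ 2
          * Real.log (max d L))
  rw [add_zero] at hlim'
  refine ge_of_tendsto' hlim' fun n => ?_
  refine (integral_erm_scalarClass_le_closed hT hdin hd hL hN hσ hexp hM hU hf0 hf0U' hfhat herm
    hint (hψ n)).trans ?_
  gcongr
  exact hle n

end PredictionError

/-- **Non-asymptotic prediction error bound for ParaRNN-based empirical risk minimizers.**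
If `z_T` is sub-exponential, `X_T ∈ [0,1]^{din×T}` a.s., and the regression function `f_0`
lies in `H^β_{din·T,1}([0,1]^{din×T}, U)` with `U ≥ 1`, and the ParaRNN class has width
`d = 76(⌊β⌋+1)² 3^{din T} din^{⌊β⌋+2} T^{⌊β⌋+1} J ⌈log₂(8J)⌉ + ds` and depth
`L = 42(⌊β⌋+1)² I ⌈log₂(8I)⌉ + 6 din T`, then there are constants `c, C > 0`, with `C`
independent of `din, d, L, U, β, N, I, J`, such that whenever `N ≥ c d² L² log max{d, L}`,
`E_S[R(f̂) − R(f_0)] ≤ C U⁵ (log N)⁵ N⁻¹ d² L² log max{d, L}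
  + 542 U² (⌊β⌋+1)⁴ (din T)^{2⌊β⌋ + (β ∨ 1)} (JI)^{−4β/(din T)}`. -/
theorem stmt12 (T ds : ℕ) (hT : 0 < T) (hds0 : 0 < ds) (hds : Even ds)
    (σz Mz : ℝ) (hσz : 0 < σz) :
    ∃ c C : ℝ, 0 < c ∧ 0 < C ∧
      ∀ (din N I J : ℕ) (β U : ℝ),
        0 < din → 0 < N → 0 < I → 0 < J → 0 < β → 1 ≤ U →
        ∀ (μ : MeasureTheory.Measure ((Fin T → Fin din → ℝ) × ℝ))
          [MeasureTheory.IsProbabilityMeasure μ],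
        MeasureTheory.Integrable (fun p => Real.exp (σz * |p.2|)) μ →
        (∫ p, Real.exp (σz * |p.2|) ∂μ) ≤ Mz →
        (∀ᵐ p ∂μ, p.1 ∈ cube T din) →
        ∀ f0 : (Fin T → Fin din → ℝ) → ℝ,
          ((fun p => f0 p.1)
            =ᵐ[μ] μ[(fun p => p.2) | MeasurableSpace.comap Prod.fst inferInstance]) →
          MemHolderClass T din 1 β U (fun x _ => f0 x) →
        ∀ fhat : (Fin N → (Fin T → Fin din → ℝ) × ℝ) → ((Fin T → Fin din → ℝ) → ℝ),
          (∀ s, fhat s ∈ scalarClass din (widthOf din T ds J β) ds (depthOf din T I β) T U) →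
          (∀ s, ∀ φ ∈ scalarClass din (widthOf din T ds J β) ds (depthOf din T I β) T U,
            empRisk s (fhat s) ≤ empRisk s φ) →
          MeasureTheory.Integrable (fun s => risk μ (fhat s))
            (MeasureTheory.Measure.pi fun _ : Fin N => μ) →
        c * ((widthOf din T ds J β : ℝ) ^ 2 * (depthOf din T I β : ℝ) ^ 2
              * Real.log (max (widthOf din T ds J β : ℝ) (depthOf din T I β : ℝ)))
            ≤ (N : ℝ) →
        ∫ s, (risk μ (fhat s) - risk μ f0)
            ∂(MeasureTheory.Measure.pi fun _ : Fin N => μ)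
          ≤ C * U ^ 5 * (Real.log N) ^ 5 * (N : ℝ)⁻¹
              * (widthOf din T ds J β : ℝ) ^ 2 * (depthOf din T I β : ℝ) ^ 2
              * Real.log (max (widthOf din T ds J β : ℝ) (depthOf din T I β : ℝ))
            + 542 * U ^ 2 * ((⌊β⌋₊ : ℝ) + 1) ^ 4
              * ((din * T : ℕ) : ℝ) ^ (2 * (⌊β⌋₊ : ℝ) + max β 1)
              * ((J * I : ℕ) : ℝ) ^ (-(4 * β) / ((din * T : ℕ) : ℝ)) := by
  have hT' : (0 : ℝ) < T := by exact_mod_cast hT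
  refine ⟨4 * T, 6528 * T * (7 + 4 / σz) ^ 2 + (24 + 8 / σz) + 16 * |Mz| / σz, by positivity,
    by positivity, ?_⟩
  intro din N I J β U hdin _ hI hJ hβ hU μ _ hexp hM hcube f0 hf0 hf fhat hfhat herm hint hN
  have hU0 : 0 < U := by linarith
  obtain ⟨l, S', g, hdepth, hR, hgS, hgE⟩ := exists_reach_holder_rate (ds := ds) hT hdin hI hJ hβ
    hU0 hf
  have hw := mul_le_widthOf (ds := ds) (β := β) hT hdin hJ
  have hDT : din ≤ T * din := Nat.le_mul_of_pos_left _ hT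
  obtain ⟨ψ, hψ, hlim⟩ := exists_tendsto_of_reach (by omega) hds hR le_rfl (by omega) hU0.le hgS
  rw [hdepth] at hψ
  refine (integral_erm_le_of_tendsto hT (by omega) (by omega) (by omega) hN hσz hexp hM hU hf0
    hf.exists_taylor.1 hcube hfhat herm hint hψ hlim hgE).trans ?_
  rw [add_comm]
  refine add_le_add_right ?_ _
  have hA : (((din * T : ℕ) : ℝ) ^ ((⌊β⌋₊ : ℝ) + max β 1 / 2)) ^ 2
      = ((din * T : ℕ) : ℝ) ^ (2 * (⌊β⌋₊ : ℝ) + max β 1) := by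
    rw [← Real.rpow_natCast, ← Real.rpow_mul (by positivity)]
    congr 1
    push_cast
    ring
  have hQ : (((J * I : ℕ) : ℝ) ^ (-(2 * β) / ((din * T : ℕ) : ℝ))) ^ 2
      = ((J * I : ℕ) : ℝ) ^ (-(4 * β) / ((din * T : ℕ) : ℝ)) := by
    rw [← Real.rpow_natCast, ← Real.rpow_mul (by positivity)]
    congr 1
    push_cast
    ring
  rw [mul_pow, mul_pow, hA, hQ]
  calc _ = 72 * U ^ 2 * ((⌊β⌋₊ : ℝ) + 1) ^ 4
          * ((din * T : ℕ) : ℝ) ^ (2 * (⌊β⌋₊ : ℝ) + max β 1)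
          * ((J * I : ℕ) : ℝ) ^ (-(4 * β) / ((din * T : ℕ) : ℝ)) := by ring
    _ ≤ _ := by gcongr; norm_num
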